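/- Let M be a connected manifold of finite type (all Betti numbers finite). For each fixed degree i ≥ 0, the function sending k to the dimension over ℚ of the i-th singular homology group H_i(C_k(M); ℚ) of the unordered configuration space C_k(M) is eventually constant in k; that is, there exists N such that for all k, l ≥ N, dim_ℚ H_i(C_k(M); ℚ) = dim_ℚ H_l(C_k(M); ℚ). -/

import Mathlib

open CategoryTheory

/-- The singular chain complex functor with coefficients in a commutative ring `R`:
the levelwise free `R`-module on the singular simplicial set of a space, turned into
a chain complex via the alternating face map complex. -/
noncomputable def singularChainComplexFunctor (R : Type) [CommRing R] :
    TopCat.{0} ⥤ ChainComplex (ModuleCat.{0} R) ℕ :=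
  TopCat.toSSet ⋙ ((SimplicialObject.whiskering _ _).obj (ModuleCat.free R)) ⋙
    AlgebraicTopology.alternatingFaceMapComplex _

/-- The `n`-th singular homology of a topological space, with coefficients in `R`. -/
noncomputable def SingularHomology (R : Type) [CommRing R] (n : ℕ) (X : Type)
    [TopologicalSpace X] : ModuleCat.{0} R :=
  (singularChainComplexFunctor R ⋙ HomologicalComplex.homologyFunctor _ _ n).obj (TopCat.of X)

/-- The setoid on the ordered configuration space (the space of injective tuples
`Fin k → M`) identifying tuples that differ by a permutation of the coordinates. -/
def configSetoid (M : Type) (k : ℕ) : Setoid {f : Fin k → M // Function.Injective f} where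
  r f g := ∃ σ : Equiv.Perm (Fin k), (f : Fin k → M) ∘ σ = g
  iseqv := by
    constructor
    · exact fun f => ⟨Equiv.refl _, rfl⟩
    · rintro f g ⟨σ, h⟩
      exact ⟨σ.symm, by rw [← h]; ext x; simp⟩
    · rintro f g h ⟨σ, hσ⟩ ⟨τ, hτ⟩
      exact ⟨τ.trans σ, by rw [← hτ, ← hσ]; rfl⟩

/-- The unordered configuration space `C_k(M)` of `k` points in `M`: the quotient of
the space of injective tuples `Fin k → M` (with the subspace topology from the product
topology) by the permutation action of the symmetric group, with the quotient topology. -/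
def UnordConfigSpace (M : Type) (k : ℕ) : Type := Quotient (configSetoid M k)

instance (M : Type) [TopologicalSpace M] (k : ℕ) : TopologicalSpace (UnordConfigSpace M k) :=
  instTopologicalSpaceQuotient

namespace CFS

/-- formal linear chains with `m` vertices -/
abbrev LC (m : ℕ) (S : Type) := (Fin m → S) →₀ ℚ

noncomputable section

def cone {m : ℕ} {S : Type} (k : S) : LC m S →ₗ[ℚ] LC (m+1) S :=
  Finsupp.lmapDomain ℚ ℚ (fun l => (Fin.cons k l : Fin (m+1) → S))

def lmap {m : ℕ} {S S' : Type} (f : S → S') : LC m S →ₗ[ℚ] LC m S' :=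
  Finsupp.lmapDomain ℚ ℚ (fun l => f ∘ l)

/-- the basis element -/
abbrev bs {α : Type} (a : α) : α →₀ ℚ := Finsupp.single a 1

def bd {m : ℕ} {S : Type} : LC (m+1) S →ₗ[ℚ] LC m S :=
  Finsupp.linearCombination ℚ (fun l => ∑ j : Fin (m+1), (-1 : ℚ)^(j:ℕ) • bs (l ∘ j.succAbove))

@[simp] lemma cone_bs {m : ℕ} {S : Type} (k : S) (l : Fin m → S) :
    cone k (bs l) = bs (Fin.cons k l : Fin (m+1) → S) := by
  simp [cone, bs]

@[simp] lemma lmap_bs {m : ℕ} {S S' : Type} (f : S → S') (l : Fin m → S) :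
    lmap f (bs l) = bs (f ∘ l) := by
  simp [lmap, bs]

lemma bd_bs {m : ℕ} {S : Type} (l : Fin (m+1) → S) :
    bd (bs l) = ∑ j : Fin (m+1), (-1 : ℚ)^(j:ℕ) • bs (l ∘ j.succAbove) := by
  simp [bd, bs]

lemma lin_ext {α : Type} {W : Type*} [AddCommGroup W] [Module ℚ W] {f g : (α →₀ ℚ) →ₗ[ℚ] W}
    (h : ∀ a, f (bs a) = g (bs a)) : f = g := by
  apply Finsupp.lhom_ext'
  intro a
  ext
  exact h a

lemma lin_ext_apply {α : Type} {W : Type*} [AddCommGroup W] [Module ℚ W] {f g : (α →₀ ℚ) →ₗ[ℚ] W}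
    (h : ∀ a, f (bs a) = g (bs a)) (x : α →₀ ℚ) : f x = g x := by
  rw [lin_ext h]

lemma bd_cone_zero {S : Type} (k : S) (x : LC 0 S) : bd (cone k x) = x := by
  refine lin_ext_apply (f := bd.comp (cone k)) (g := LinearMap.id) (fun l => ?_) x
  simp only [LinearMap.comp_apply, cone_bs, bd_bs, LinearMap.id_apply]
  simp

lemma bd_cone_succ {m : ℕ} {S : Type} (k : S) (x : LC (m+1) S) :
    bd (cone k x) = x - cone k (bd x) := by
  refine lin_ext_apply (f := bd.comp (cone k)) (g := LinearMap.id - (cone k).comp bd)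
    (fun l => ?_) x
  simp only [LinearMap.comp_apply, cone_bs, bd_bs, LinearMap.id_apply, LinearMap.sub_apply]
  rw [Fin.sum_univ_succ]
  simp only [map_sum, map_smul, cone_bs]
  rw [sub_eq_add_neg, ← Finset.sum_neg_distrib]
  congr 1
  · simp
  · refine Finset.sum_congr rfl (fun j _ => ?_)
    rw [← neg_smul]
    congr 1
    · simp [pow_succ]
    · congr 1
      ext i
      refine Fin.cases ?_ (fun i => ?_) i
      · simp
      · simp

lemma bs_cons {m : ℕ} {S : Type} (l : Fin (m+1) → S) :
    bs l = cone (l 0) (bs (Fin.tail l)) := by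
  simp

lemma bd_bd {m : ℕ} {S : Type} (x : LC (m+2) S) : bd (bd x) = 0 := by
  induction m with
  | zero =>
    refine lin_ext_apply (f := bd.comp bd) (g := 0) (fun l => ?_) x
    simp only [LinearMap.comp_apply, LinearMap.zero_apply]
    rw [bs_cons, bd_cone_succ, map_sub, bd_cone_zero, sub_self]
  | succ m ih =>
    refine lin_ext_apply (f := bd.comp bd) (g := 0) (fun l => ?_) x
    simp only [LinearMap.comp_apply, LinearMap.zero_apply]
    rw [bs_cons, bd_cone_succ, map_sub, bd_cone_succ, ih]
    simp

lemma lmap_cone {m : ℕ} {S S' : Type} (f : S → S') (k : S) (x : LC m S) :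
    lmap f (cone k x) = cone (f k) (lmap f x) := by
  refine lin_ext_apply (f := (lmap f).comp (cone k)) (g := (cone (f k)).comp (lmap f))
    (fun l => ?_) x
  simp only [LinearMap.comp_apply, cone_bs, lmap_bs]
  congr 1
  ext i
  refine Fin.cases ?_ (fun i => ?_) i <;> simp

lemma lmap_bd {m : ℕ} {S S' : Type} (f : S → S') (x : LC (m+1) S) :
    lmap f (bd x) = bd (lmap f x) := by
  refine lin_ext_apply (f := (lmap f).comp bd) (g := bd.comp (lmap f))
    (fun l => ?_) x
  simp only [LinearMap.comp_apply, bd_bs, lmap_bs, map_sum, map_smul]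
  rfl

/-- subdivision -/
def sd {S : Type} (bar : ∀ m, (Fin (m+1) → S) → S) : ∀ m, LC m S →ₗ[ℚ] LC m S
  | 0 => LinearMap.id
  | m+1 => Finsupp.linearCombination ℚ (fun l => cone (bar m l) (sd bar m (bd (bs l))))

def sdT {S : Type} (bar : ∀ m, (Fin (m+1) → S) → S) : ∀ m, LC m S →ₗ[ℚ] LC (m+1) S
  | 0 => 0
  | m+1 => Finsupp.linearCombination ℚ (fun l => cone (bar m l) (bs l - sdT bar m (bd (bs l))))

lemma sd_bs {S : Type} (bar : ∀ m, (Fin (m+1) → S) → S) (m : ℕ) (l : Fin (m+1) → S) :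
    sd bar (m+1) (bs l) = cone (bar m l) (sd bar m (bd (bs l))) := by
  simp [sd, bs]

lemma sdT_bs {S : Type} (bar : ∀ m, (Fin (m+1) → S) → S) (m : ℕ) (l : Fin (m+1) → S) :
    sdT bar (m+1) (bs l) = cone (bar m l) (bs l - sdT bar m (bd (bs l))) := by
  simp [sdT, bs]

lemma bd_sd {S : Type} (bar : ∀ m, (Fin (m+1) → S) → S) (m : ℕ) (x : LC (m+1) S) :
    bd (sd bar (m+1) x) = sd bar m (bd x) := by
  induction m with
  | zero =>
    refine lin_ext_apply (f := bd.comp (sd bar 1)) (g := (sd bar 0).comp bd) (fun l => ?_) x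
    simp only [LinearMap.comp_apply, sd_bs, bd_cone_zero]
  | succ m ih =>
    refine lin_ext_apply (f := bd.comp (sd bar _)) (g := (sd bar _).comp bd) (fun l => ?_) x
    simp only [LinearMap.comp_apply]
    rw [sd_bs, bd_cone_succ, ih, bd_bd]
    simp

lemma bd_sdT_one {S : Type} (bar : ∀ m, (Fin (m+1) → S) → S) (m : ℕ) (x : LC (m+1) S) :
    bd (sdT bar (m+1) x) = x - sd bar (m+1) x - sdT bar m (bd x) := by
  induction m with
  | zero =>
    refine lin_ext_apply (f := bd.comp (sdT bar _))
      (g := LinearMap.id - sd bar _ - (sdT bar _).comp bd) (fun l => ?_) x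
    simp only [LinearMap.comp_apply, LinearMap.sub_apply, LinearMap.id_apply]
    rw [sdT_bs, bd_cone_succ, sd_bs]
    simp [sdT, sd]
  | succ m ih =>
    refine lin_ext_apply (f := bd.comp (sdT bar _))
      (g := LinearMap.id - sd bar _ - (sdT bar _).comp bd) (fun l => ?_) x
    simp only [LinearMap.comp_apply, LinearMap.sub_apply, LinearMap.id_apply]
    rw [sdT_bs, bd_cone_succ, sd_bs, map_sub, ih, bd_bd]
    simp only [map_zero, sub_zero, map_sub]
    abel

lemma lmap_sd {S S' : Type} (bar : ∀ m, (Fin (m+1) → S) → S) (bar' : ∀ m, (Fin (m+1) → S') → S')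
    (f : S → S') (hf : ∀ m l, f (bar m l) = bar' m (f ∘ l)) (m : ℕ) (x : LC m S) :
    lmap f (sd bar m x) = sd bar' m (lmap f x) := by
  induction m with
  | zero => rfl
  | succ m ih =>
    refine lin_ext_apply (f := (lmap f).comp (sd bar _)) (g := (sd bar' _).comp (lmap f))
      (fun l => ?_) x
    simp only [LinearMap.comp_apply, sd_bs, lmap_bs, lmap_cone, ih, hf, lmap_bd]

lemma lmap_sdT {S S' : Type} (bar : ∀ m, (Fin (m+1) → S) → S)
    (bar' : ∀ m, (Fin (m+1) → S') → S')
    (f : S → S') (hf : ∀ m l, f (bar m l) = bar' m (f ∘ l)) (m : ℕ) (x : LC m S) :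
    lmap f (sdT bar m x) = sdT bar' m (lmap f x) := by
  induction m with
  | zero => simp [sdT]
  | succ m ih =>
    refine lin_ext_apply (f := (lmap f).comp (sdT bar _)) (g := (sdT bar' _).comp (lmap f))
      (fun l => ?_) x
    simp only [LinearMap.comp_apply, sdT_bs, lmap_bs, lmap_cone, ih, hf, lmap_bd, map_sub]

/-- prism -/
def pri {S B : Type} (o e : B) : ∀ m, LC m S →ₗ[ℚ] LC (m+1) (S × B)
  | 0 => 0
  | m+1 => Finsupp.linearCombination ℚ (fun l =>
      cone (l 0, o) (cone (l 0, e) (lmap (fun s => (s, e)) (bs (Fin.tail l))))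
        - cone (l 0, o) (pri o e m (bs (Fin.tail l))))

lemma pri_cone {S B : Type} (o e : B) (m : ℕ) (k : S) (x : LC m S) :
    pri o e (m+1) (cone k x) =
      cone (k, o) (cone (k, e) (lmap (fun s => (s, e)) x)) - cone (k, o) (pri o e m x) := by
  refine lin_ext_apply (f := (pri o e (m+1)).comp (cone k))
    (g := (cone (k, o)).comp ((cone (k, e)).comp (lmap (fun s => (s, e))))
      - (cone (k, o)).comp (pri o e m)) (fun l => ?_) x
  simp only [LinearMap.comp_apply, LinearMap.sub_apply, cone_bs]
  rw [pri]
  simp [bs]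

lemma bd_pri {S B : Type} (o e : B) (m : ℕ) (x : LC (m+1) S) :
    bd (pri o e (m+1) x) =
      lmap (fun s => (s, e)) x - lmap (fun s => (s, o)) x - pri o e m (bd x) := by
  induction m with
  | zero =>
    refine lin_ext_apply (f := bd.comp (pri o e _))
      (g := lmap (fun s => (s, e)) - lmap (fun s => (s, o)) - (pri o e _).comp bd) (fun l => ?_) x
    simp only [LinearMap.comp_apply, LinearMap.sub_apply]
    rw [bs_cons, pri_cone, lmap_cone, lmap_cone, map_sub, bd_cone_succ, bd_cone_zero]
    simp [pri]
    congr 1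
    congr 1
    ext i
    all_goals exact i.elim0
  | succ m ih =>
    refine lin_ext_apply (f := bd.comp (pri o e _))
      (g := lmap (fun s => (s, e)) - lmap (fun s => (s, o)) - (pri o e _).comp bd) (fun l => ?_) x
    simp only [LinearMap.comp_apply, LinearMap.sub_apply]
    rw [bs_cons, pri_cone, lmap_cone, lmap_cone, map_sub, bd_cone_succ, bd_cone_succ, bd_cone_succ,
      bd_cone_succ, ih, map_sub (pri o e (m+1)), pri_cone]
    simp only [map_sub, lmap_bd]
    abel

lemma lmap_pri {S S' B : Type} (o e : B) (f : S → S') (m : ℕ) (x : LC m S) :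
    lmap (Prod.map f id) (pri o e m x) = pri o e m (lmap f x) := by
  induction m with
  | zero => simp [pri]
  | succ m ih =>
    refine lin_ext_apply (f := (lmap (Prod.map f id)).comp (pri o e _))
      (g := (pri o e _).comp (lmap f)) (fun l => ?_) x
    simp only [LinearMap.comp_apply]
    rw [bs_cons, pri_cone, lmap_cone, pri_cone, map_sub, lmap_cone, lmap_cone, lmap_cone, ih]
    simp only [lmap_bs]
    rfl

end
end CFS

namespace CFS
noncomputable section

lemma supp_map {α : Type} {W : Type*} [AddCommGroup W] [Module ℚ W] (f : (α →₀ ℚ) →ₗ[ℚ] W)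
    (s : Set α) (P : Submodule ℚ W) (h : ∀ a ∈ s, f (bs a) ∈ P) {x : α →₀ ℚ}
    (hx : x ∈ Finsupp.supported ℚ ℚ s) : f x ∈ P := by
  rw [Finsupp.supported_eq_span_single] at hx
  have : Submodule.span ℚ ((fun i => Finsupp.single i (1:ℚ)) '' s) ≤ P.comap f := by
    rw [Submodule.span_le]
    rintro _ ⟨a, ha, rfl⟩
    exact h a ha
  exact this hx

lemma supp_bs {α : Type} {s : Set α} {a : α} (h : a ∈ s) : bs a ∈ Finsupp.supported ℚ ℚ s :=
  Finsupp.single_mem_supported ℚ 1 h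

/-- topological simplex -/
abbrev Dl (n : ℕ) := stdSimplex ℝ (Fin (n+1))

abbrev vt {n : ℕ} (i : Fin (n+1)) : Dl n := stdSimplex.vertex i

def rl {m n : ℕ} (p : Fin (m+1) → Dl n) : C(Dl m, Dl n) where
  toFun t := ⟨∑ i, t i • (p i).1,
    (convex_stdSimplex ℝ _).sum_mem (fun i _ => t.2.1 i) t.2.2 (fun i _ => (p i).2)⟩
  continuous_toFun := by
    refine Continuous.subtype_mk ?_ _
    refine continuous_finsetSum _ (fun i _ => ?_)
    exact ((continuous_apply i).comp continuous_subtype_val).smul continuous_const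

lemma rl_coe {m n : ℕ} (p : Fin (m+1) → Dl n) (t : Dl m) :
    (rl p t).1 = ∑ i, t i • (p i).1 := rfl

lemma rl_apply {m n : ℕ} (p : Fin (m+1) → Dl n) (t : Dl m) (k : Fin (n+1)) :
    rl p t k = ∑ i, t i * p i k := by
  change (rl p t).1 k = _
  rw [rl_coe]
  simp only [Finset.sum_apply]
  rfl

lemma dl_ext {n : ℕ} {s t : Dl n} (h : ∀ k, s k = t k) : s = t :=
  stdSimplex.ext (funext h)

lemma vt_apply {n : ℕ} (i k : Fin (n+1)) : (vt i : Dl n) k = if k = i then 1 else 0 := by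
  change (Pi.single i (1:ℝ) : Fin (n+1) → ℝ) k = _
  rw [Pi.single_apply]

@[simp] lemma rl_vt {m n : ℕ} (p : Fin (m+1) → Dl n) (i : Fin (m+1)) : rl p (vt i) = p i := by
  apply dl_ext
  intro k
  rw [rl_apply]
  simp [vt_apply]

@[simp] lemma rl_id {n : ℕ} (t : Dl n) : rl (vt : Fin (n+1) → Dl n) t = t := by
  apply dl_ext
  intro k
  rw [rl_apply]
  simp [vt_apply]

lemma rl_rl {m n k : ℕ} (p : Fin (m+1) → Dl n) (q : Fin (k+1) → Dl m) (t : Dl k) :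
    rl p (rl q t) = rl (fun i => rl p (q i)) t := by
  apply dl_ext
  intro j
  simp only [rl_apply, Finset.sum_mul, Finset.mul_sum]
  rw [Finset.sum_comm]
  simp only [mul_assoc]

lemma rl_face {m n : ℕ} (p : Fin (m+2) → Dl n) (j : Fin (m+2)) (t : Dl m) :
    rl p (rl (vt ∘ j.succAbove) t) = rl (p ∘ j.succAbove) t := by
  rw [rl_rl]
  congr 2
  ext i
  simp

lemma rl_map {m n : ℕ} (f : Fin (m+1) → Fin (n+1)) (t : Dl m) :
    rl (vt ∘ f) t = stdSimplex.map f t := by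
  apply dl_ext
  intro k
  rw [rl_apply]
  simp only [Function.comp, vt_apply]
  change _ = (FunOnFinite.linearMap ℝ ℝ f) t k
  rw [FunOnFinite.linearMap_apply_apply]
  simp only [mul_ite, mul_one, mul_zero]
  rw [Finset.sum_ite, Finset.sum_const_zero, add_zero]
  apply Finset.sum_congr
  · ext a; simp [eq_comm]
  · intros; rfl

def bary {n : ℕ} (m : ℕ) (l : Fin (m+1) → Dl n) : Dl n := rl l stdSimplex.barycenter

lemma rl_bary {n k : ℕ} (p : Fin (n+1) → Dl k) (m : ℕ) (l : Fin (m+1) → Dl n) :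
    rl p (bary m l) = bary m (rl p ∘ l) := rl_rl _ _ _

lemma bary_coe {n : ℕ} (m : ℕ) (l : Fin (m+1) → Dl n) :
    (bary m l).1 = ((m+1 : ℝ))⁻¹ • ∑ i, (l i).1 := by
  rw [bary, rl_coe, Finset.smul_sum]
  refine Finset.sum_congr rfl (fun i _ => ?_)
  congr 1
  have := stdSimplex.barycenter_apply (𝕜 := ℝ) i
  refine this.trans ?_
  simp

lemma bary_dist {n : ℕ} (m K : ℕ) (hK : m ≤ K) (l : Fin (m+1) → Dl n) (d : ℝ)
    (hl : ∀ i j, dist (l i) (l j) ≤ d) (j : Fin (m+1)) :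
    dist (bary m l) (l j) ≤ K / (K+1) * d := by
  have hd : 0 ≤ d := le_trans dist_nonneg (hl j j)
  rw [Subtype.dist_eq, bary_coe, dist_eq_norm]
  have h1 : (m+1:ℝ)⁻¹ • ∑ i, (l i).1 - (l j).1
      = (m+1:ℝ)⁻¹ • ∑ i, ((l i).1 - (l j).1) := by
    rw [Finset.sum_sub_distrib, smul_sub]
    congr 1
    rw [Finset.sum_const, Finset.card_univ, Fintype.card_fin, ← Nat.cast_smul_eq_nsmul ℝ, smul_smul]
    push_cast
    rw [inv_mul_cancel₀ (by positivity), one_smul]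
  rw [h1, norm_smul]
  have h2 : ‖∑ i, ((l i).1 - (l j).1)‖ ≤ m * d := by
    rw [← Finset.sum_erase (Finset.univ) (a := j) (by simp)]
    refine (norm_sum_le _ _).trans ?_
    refine (Finset.sum_le_card_nsmul _ _ d (fun i _ => ?_)).trans ?_
    · rw [← dist_eq_norm, ← Subtype.dist_eq]; exact hl i j
    · rw [Finset.card_erase_of_mem (Finset.mem_univ _)]
      simp
  have h3 : ‖(m+1:ℝ)⁻¹‖ = (m+1:ℝ)⁻¹ := by
    rw [Real.norm_of_nonneg]; positivity
  rw [h3]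
  calc (m+1:ℝ)⁻¹ * _ ≤ (m+1:ℝ)⁻¹ * (m * d) := by gcongr
    _ = (m / (m+1)) * d := by field_simp
    _ ≤ _ := by
      gcongr ?_ * d
      rw [div_le_div_iff₀ (by positivity) (by positivity)]
      have : (m:ℝ) ≤ K := by exact_mod_cast hK
      nlinarith

/-- hull of vertices -/
def hul {n m : ℕ} (l : Fin m → Dl n) : Set (Fin (n+1) → ℝ) :=
  convexHull ℝ (Set.range (fun i => (l i).1))

lemma hul_dist {n m : ℕ} (l : Fin m → Dl n) (x : Dl n) (c : ℝ)
    (h : ∀ j, dist x (l j) ≤ c) (y : Dl n) (hy : (y).1 ∈ hul l) : dist x y ≤ c := by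
  have : hul l ⊆ Metric.closedBall (x).1 c := by
    apply convexHull_min _ (convex_closedBall _ _)
    rintro _ ⟨i, rfl⟩
    rw [Metric.mem_closedBall, dist_comm]
    exact h i
  have := this hy
  rw [Metric.mem_closedBall, dist_comm] at this
  exact this

/-- small subtuples -/
def smallT {n m : ℕ} (l : Fin m → Dl n) (c : ℝ) : Set (Fin m → Dl n) :=
  {q | (∀ i, (q i).1 ∈ hul l) ∧ ∀ i j, dist (q i) (q j) ≤ c}

lemma sd_small {n : ℕ} (K : ℕ) (d : ℝ) (hd : 0 ≤ d) (m : ℕ) (hm : m ≤ K + 1) (l : Fin m → Dl n)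
    (hl : ∀ i j, dist (l i) (l j) ≤ d) :
    sd bary m (bs l) ∈ Finsupp.supported ℚ ℚ (smallT l (K/(K+1)*d)) := by
  induction m with
  | zero =>
    apply supp_bs
    exact ⟨fun i => i.elim0, fun i => i.elim0⟩
  | succ m ih =>
    rw [sd_bs, bd_bs, map_sum, map_sum]
    refine Submodule.sum_mem _ (fun j _ => ?_)
    rw [map_smul, map_smul]
    refine Submodule.smul_mem _ _ ?_
    refine supp_map _ _ _ ?_ (ih (by omega) (l ∘ j.succAbove) (fun a b => hl _ _))
    rintro q ⟨hq1, hq2⟩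
    rw [cone_bs]
    apply supp_bs
    have hsub : hul (l ∘ j.succAbove) ⊆ hul l := by
      apply convexHull_mono
      rintro _ ⟨i, rfl⟩
      exact ⟨j.succAbove i, rfl⟩
    have hb : ∀ i, dist (bary m l) (q i) ≤ K/(K+1)*d := fun i =>
      hul_dist l _ _ (bary_dist m K (by omega) l d hl) _ (hsub (hq1 i))
    refine ⟨?_, ?_⟩
    · intro i
      refine Fin.cases ?_ (fun i => ?_) i
      · simp only [Fin.cons_zero]
        rw [bary, rl_coe]
        refine (convex_convexHull ℝ _).sum_mem (fun i _ => ?_) ?_ (fun i _ => ?_)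
        · exact (stdSimplex.barycenter (𝕜 := ℝ)).2.1 i
        · exact (stdSimplex.barycenter (𝕜 := ℝ)).2.2
        · exact subset_convexHull _ _ ⟨i, rfl⟩
      · simp only [Fin.cons_succ]
        exact hsub (hq1 i)
    · intro i i'
      refine Fin.cases ?_ (fun i => ?_) i <;> refine Fin.cases ?_ (fun i' => ?_) i'
      · simp; positivity
      · simpa using hb i'
      · simpa [dist_comm] using hb i
      · simpa using hq2 i i'

lemma rl_mem_hul {m n : ℕ} (p : Fin (m+1) → Dl n) (t : Dl m) :
    (rl p t).1 ∈ hul p := by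
  rw [rl_coe]
  exact (convex_convexHull ℝ _).sum_mem (fun i _ => t.2.1 i) t.2.2
    (fun i _ => subset_convexHull _ _ ⟨i, rfl⟩)

lemma rl_dist {m n : ℕ} (p : Fin (m+1) → Dl n) (c : ℝ) (h : ∀ i j, dist (p i) (p j) ≤ c)
    (s t : Dl m) : dist (rl p s) (rl p t) ≤ c := by
  refine hul_dist p _ _ (fun j => ?_) _ (rl_mem_hul p t)
  rw [dist_comm]
  exact hul_dist p _ _ (fun i => h _ _) _ (rl_mem_hul p s)

lemma iter_sd_small {n : ℕ} (m : ℕ) (l : Fin (m+1) → Dl n) (N : ℕ) (d : ℝ) (hd : 0 ≤ d)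
    (hl : ∀ i j, dist (l i) (l j) ≤ d) :
    ((sd bary (m+1))^[N]) (bs l) ∈
      Finsupp.supported ℚ ℚ {q | ∀ i j, dist (q i) (q j) ≤ (((m:ℕ):ℝ)/(m+1))^N * d} := by
  induction N with
  | zero => apply supp_bs; simpa using hl
  | succ N ih =>
    rw [Function.iterate_succ_apply']
    refine supp_map _ _ _ ?_ ih
    intro q hq
    have := sd_small m _ (by positivity) (m+1) le_rfl q hq
    refine Finsupp.supported_mono ?_ this
    rintro q' ⟨-, h⟩ i j
    refine (h i j).trans (le_of_eq ?_)
    rw [pow_succ]; ring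

end
end CFS

namespace CFS
noncomputable section

variable {V M : Type} [TopologicalSpace M]

abbrev Sim (V M : Type) [TopologicalSpace M] := Σ n : ℕ, (V → Option C(Dl n, M))
abbrev Ch (V M : Type) [TopologicalSpace M] := Sim V M →₀ ℚ

def pb {Q R : Type} [TopologicalSpace Q] [TopologicalSpace R] (f : C(Q, R))
    (σ : V → Option C(R, M)) : V → Option C(Q, M) := fun v => (σ v).map (fun g => g.comp f)

lemma pb_pb {Q R S : Type} [TopologicalSpace Q] [TopologicalSpace R] [TopologicalSpace S]
    (f : C(Q, R)) (g : C(R, S)) (σ : V → Option C(S, M)) :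
    pb f (pb g σ) = pb (g.comp f) σ := by
  funext v
  simp [pb, Function.comp_def, ContinuousMap.comp_assoc]

lemma pb_id {Q : Type} [TopologicalSpace Q] (f : C(Q, Q)) (hf : ∀ t, f t = t)
    (σ : V → Option C(Q, M)) : pb f σ = σ := by
  obtain rfl : f = ContinuousMap.id Q := by ext t; exact hf t
  funext v
  simp [pb]

class Afn (Q : Type) [TopologicalSpace Q] where
  re : ∀ {m : ℕ}, (Fin (m+1) → Q) → C(Dl m, Q)
  re_face : ∀ {m : ℕ} (p : Fin (m+2) → Q) (j : Fin (m+2)),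
    (re p).comp (rl (vt ∘ j.succAbove)) = re (p ∘ j.succAbove)

instance (n : ℕ) : Afn (Dl n) where
  re := rl
  re_face p j := by ext1 t; exact rl_face p j t

instance (n k : ℕ) : Afn (Dl n × Dl k) where
  re p := (rl (fun i => (p i).1)).prodMk (rl (fun i => (p i).2))
  re_face p j := by
    ext1 t
    exact Prod.ext (rl_face (fun i => (p i).1) j t) (rl_face (fun i => (p i).2) j t)

open Afn

/-- push a formal chain forward along a family of maps -/
def ps {Q : Type} [TopologicalSpace Q] [Afn Q] (σ : V → Option C(Q, M)) :
    ∀ m, LC m Q →ₗ[ℚ] Ch V M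
  | 0 => 0
  | m+1 => Finsupp.linearCombination ℚ (fun p => bs (⟨m, pb (re p) σ⟩ : Sim V M))

lemma ps_zero {Q : Type} [TopologicalSpace Q] [Afn Q] (σ : V → Option C(Q, M)) (x : LC 0 Q) :
    ps σ 0 x = 0 := rfl

lemma ps_bs {Q : Type} [TopologicalSpace Q] [Afn Q] (σ : V → Option C(Q, M)) (m : ℕ)
    (p : Fin (m+1) → Q) : ps σ (m+1) (bs p) = bs (⟨m, pb (re p) σ⟩ : Sim V M) := by
  simp [ps, bs]

lemma ps_vt {n : ℕ} (σ : V → Option C(Dl n, M)) :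
    ps σ (n+1) (bs vt) = bs (⟨n, σ⟩ : Sim V M) := by
  rw [ps_bs, pb_id]
  exact rl_id

lemma ps_lmap {Q R : Type} [TopologicalSpace Q] [Afn Q] [TopologicalSpace R] [Afn R]
    (f : C(Q, R)) (hf : ∀ (m : ℕ) (p : Fin (m+1) → Q), f.comp (re p) = re (f ∘ p))
    (σ : V → Option C(R, M)) (m : ℕ) (x : LC m Q) :
    ps (pb f σ) m x = ps σ m (lmap f x) := by
  cases m with
  | zero => rfl
  | succ m =>
    refine lin_ext_apply (f := ps (pb f σ) (m+1)) (g := (ps σ (m+1)).comp (lmap f)) (fun p => ?_) x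
    rw [LinearMap.comp_apply, lmap_bs, ps_bs, ps_bs, pb_pb, hf]

lemma rl_aff {m n : ℕ} (p : Fin (m+1) → Dl n) (k : ℕ) (q : Fin (k+1) → Dl m) :
    (rl p).comp (re q) = re (rl p ∘ q) := by
  ext1 t
  exact rl_rl p q t

/-- natural operators -/
def nop (e : ℕ → ℕ) (c : ∀ n, LC (e n) (Dl n)) : Ch V M →ₗ[ℚ] Ch V M :=
  Finsupp.linearCombination ℚ (fun σ => ps σ.2 (e σ.1) (c σ.1))

lemma nop_bs (e : ℕ → ℕ) (c : ∀ n, LC (e n) (Dl n)) (n : ℕ) (σ : V → Option C(Dl n, M)) :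
    nop e c (bs ⟨n, σ⟩) = ps σ (e n) (c n) := by
  simp [nop, bs]

def dd : Ch V M →ₗ[ℚ] Ch V M := nop (fun n => n) (fun _ => bd (bs vt))
def SD : Ch V M →ₗ[ℚ] Ch V M := nop (fun n => n+1) (fun _ => sd bary _ (bs vt))
def TT : Ch V M →ₗ[ℚ] Ch V M := nop (fun n => n+2) (fun _ => sdT bary _ (bs vt))

lemma dd_ps {Q : Type} [TopologicalSpace Q] [Afn Q] (σ : V → Option C(Q, M)) (m : ℕ)
    (x : LC (m+1) Q) : dd (ps σ (m+1) x) = ps σ m (bd x) := by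
  refine lin_ext_apply (f := dd.comp (ps σ (m+1))) (g := (ps σ m).comp bd) (fun p => ?_) x
  rw [LinearMap.comp_apply, LinearMap.comp_apply, ps_bs, dd, nop_bs, bd_bs, bd_bs, map_sum, map_sum]
  refine Finset.sum_congr rfl (fun j _ => ?_)
  rw [map_smul, map_smul]
  congr 1
  cases m with
  | zero => rfl
  | succ m =>
    rw [ps_bs, ps_bs, pb_pb]
    congr 3
    exact re_face p j

lemma SD_ps {n : ℕ} (σ : V → Option C(Dl n, M)) (m : ℕ)
    (x : LC m (Dl n)) : SD (ps σ m x) = ps σ m (sd bary m x) := by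
  cases m with
  | zero => simp [ps]
  | succ m =>
    refine lin_ext_apply (f := SD.comp (ps σ (m+1))) (g := (ps σ _).comp (sd bary _))
      (fun p => ?_) x
    rw [LinearMap.comp_apply, LinearMap.comp_apply, ps_bs, SD, nop_bs]
    change ps (pb (rl p) σ) _ _ = _
    rw [ps_lmap (rl p) (rl_aff p), lmap_sd bary bary _ (rl_bary p), lmap_bs]
    congr 3
    ext1 i
    simp

lemma TT_ps {n : ℕ} (σ : V → Option C(Dl n, M)) (m : ℕ)
    (x : LC m (Dl n)) : TT (ps σ m x) = ps σ (m+1) (sdT bary m x) := by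
  cases m with
  | zero => simp [ps, sdT]
  | succ m =>
    refine lin_ext_apply (f := TT.comp (ps σ (m+1))) (g := (ps σ _).comp (sdT bary _))
      (fun p => ?_) x
    rw [LinearMap.comp_apply, LinearMap.comp_apply, ps_bs, TT, nop_bs]
    change ps (pb (rl p) σ) _ _ = _
    rw [ps_lmap (rl p) (rl_aff p), lmap_sdT bary bary _ (rl_bary p), lmap_bs]
    congr 3
    ext1 i
    simp

lemma dd_bs {n : ℕ} (σ : V → Option C(Dl n, M)) :
    dd (bs ⟨n, σ⟩) = ps σ n (bd (bs vt)) := nop_bs _ _ _ _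

lemma dd_dd (x : Ch V M) : dd (dd x) = 0 := by
  refine lin_ext_apply (f := dd.comp dd) (g := 0) ?_ x
  rintro ⟨n, σ⟩
  rw [LinearMap.comp_apply, dd_bs]
  cases n with
  | zero => simp [ps]
  | succ n => rw [dd_ps, bd_bd]; simp

lemma dd_TT (x : Ch V M) : dd (TT x) = x - SD x - TT (dd x) := by
  refine lin_ext_apply (f := dd.comp TT) (g := LinearMap.id - SD - TT.comp dd) ?_ x
  rintro ⟨n, σ⟩
  simp only [LinearMap.comp_apply, LinearMap.sub_apply, LinearMap.id_apply]
  rw [dd_bs, TT_ps, ← ps_vt, TT_ps, dd_ps, SD_ps, bd_sdT_one, map_sub, map_sub]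

lemma SD_dd (x : Ch V M) : SD (dd x) = dd (SD x) := by
  refine lin_ext_apply (f := SD.comp dd) (g := dd.comp SD) ?_ x
  rintro ⟨n, σ⟩
  simp only [LinearMap.comp_apply]
  rw [dd_bs, SD_ps, ← ps_vt, SD_ps, dd_ps, bd_sd]

/-- support of pushes -/
lemma ps_supp {Q : Type} [TopologicalSpace Q] [Afn Q] (σ : V → Option C(Q, M)) (m : ℕ)
    (x : LC m Q) : ps σ m x ∈ Finsupp.supported ℚ ℚ
      {τ : Sim V M | τ.1 + 1 = m ∧ ∃ f : C(Dl τ.1, Q), τ.2 = pb f σ} := by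
  cases m with
  | zero => exact Submodule.zero_mem _
  | succ m =>
    refine supp_map _ Set.univ _ (fun p _ => ?_) (by rw [Finsupp.supported_univ]; trivial)
    rw [ps_bs]
    exact supp_bs ⟨rfl, _, rfl⟩

/-- evaluation -/
def ev {Q : Type} [TopologicalSpace Q] (σ : V → Option C(Q, M)) (t : Q) : V → Option M :=
  fun v => (σ v).map (fun g => g t)

lemma ev_pb {Q R : Type} [TopologicalSpace Q] [TopologicalSpace R] (f : C(Q, R))
    (σ : V → Option C(R, M)) (t : Q) : ev (pb f σ) t = ev σ (f t) := by
  funext v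
  simp [ev, pb, Function.comp_def]

/-- simplices in `X` -/
def Al (X : Set (V → Option M)) : Set (Sim V M) := {σ | ∀ t, ev σ.2 t ∈ X}

lemma Al_mono {X Y : Set (V → Option M)} (h : X ⊆ Y) : Al X ⊆ Al Y := fun _ hs t => h (hs t)

lemma Al_inter (X Y : Set (V → Option M)) : Al (X ∩ Y) = Al X ∩ Al Y := by
  ext σ
  exact ⟨fun h => ⟨fun t => (h t).1, fun t => (h t).2⟩, fun h t => ⟨h.1 t, h.2 t⟩⟩

abbrev sp (𝒜 : Set (Sim V M)) : Submodule ℚ (Ch V M) := Finsupp.supported ℚ ℚ 𝒜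

lemma ps_Al {Q : Type} [TopologicalSpace Q] [Afn Q] (σ : V → Option C(Q, M)) (m : ℕ)
    (x : LC m Q) (X : Set (V → Option M)) (h : ∀ t, ev σ t ∈ X) : ps σ m x ∈ sp (Al X) := by
  refine Finsupp.supported_mono ?_ (ps_supp σ m x)
  rintro τ ⟨-, f, hf⟩ t
  rw [hf, ev_pb]
  exact h _

lemma nop_Al (e : ℕ → ℕ) (c : ∀ n, LC (e n) (Dl n)) (X : Set (V → Option M)) (x : Ch V M)
    (hx : x ∈ sp (Al X)) : nop e c x ∈ sp (Al X) := by
  refine supp_map _ _ _ ?_ hx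
  rintro ⟨n, σ⟩ h
  rw [nop_bs]
  exact ps_Al _ _ _ _ h

end
end CFS

set_option linter.unusedSectionVars false
set_option linter.unusedSimpArgs false

namespace CFS
noncomputable section

variable {V M : Type} [TopologicalSpace M]

def chi {α : Type} (o : Option α) : ℚ := if o = none then -1 else 1

lemma chi_none {α : Type} : chi (none : Option α) = -1 := by simp [chi]
lemma chi_some {α : Type} {o : Option α} (h : o ≠ none) : chi o = 1 := by simp [chi, h]
lemma chi_sq {α : Type} (o : Option α) : chi o * chi o = 1 := by
  unfold chi; split <;> norm_num
open Classical in
lemma chi_map {α β : Type} (o : Option α) (f : α → β) : chi (o.map f) = chi o := by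
  cases o <;> simp [chi]

variable [Fintype V] [LinearOrder V]

def eps {α : Type} (σ : V → Option α) : ℚ := ∏ t, chi (σ t)
def sgn {α : Type} (s : V) (σ : V → Option α) : ℚ := ∏ t with t < s, chi (σ t)
def park {α : Type} (s : V) (σ : V → Option α) : V → Option α := Function.update σ s none
def nopark {α : Type} (σ : V → Option α) : ℕ := Finset.card {t : V | σ t = none}

lemma eps_sq {α : Type} (σ : V → Option α) : eps σ * eps σ = 1 := by
  rw [eps, ← Finset.prod_mul_distrib]
  exact Finset.prod_eq_one (fun t _ => chi_sq _)

lemma eps_park {α : Type} (s : V) (σ : V → Option α) (h : σ s ≠ none) :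
    eps (park s σ) = - eps σ := by
  rw [eps, eps, ← Finset.mul_prod_erase _ _ (Finset.mem_univ s),
    ← Finset.mul_prod_erase Finset.univ (fun t => chi (σ t)) (Finset.mem_univ s)]
  rw [chi_some h, park, Function.update_self, chi_none]
  rw [neg_mul]
  congr 2
  refine Finset.prod_congr rfl (fun t ht => ?_)
  rw [Function.update_of_ne (Finset.ne_of_mem_erase ht)]

lemma sgn_park {α : Type} (s t : V) (σ : V → Option α) (h : σ s ≠ none) :
    sgn t (park s σ) = (if s < t then -1 else 1) * sgn t σ := by
  unfold sgn
  split_ifs with hst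
  · have hm : s ∈ ({u | u < t} : Finset V) := by simpa using hst
    rw [← Finset.mul_prod_erase _ _ hm, ← Finset.mul_prod_erase _ (fun t => chi (σ t)) hm]
    rw [chi_some h, park, Function.update_self, chi_none, one_mul]
    congr 1
    refine Finset.prod_congr rfl (fun u hu => ?_)
    rw [Function.update_of_ne (Finset.ne_of_mem_erase hu)]
  · rw [one_mul]
    refine Finset.prod_congr rfl (fun u hu => ?_)
    rw [park, Function.update_of_ne]
    rintro rfl
    simp at hu
    exact hst hu

lemma sgn_sq {α : Type} (s : V) (σ : V → Option α) : sgn s σ * sgn s σ = 1 := by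
  rw [sgn, ← Finset.prod_mul_distrib]
  exact Finset.prod_eq_one (fun t _ => chi_sq _)

lemma nopark_park {α : Type} (s : V) (σ : V → Option α) (h : σ s ≠ none) :
    nopark (park s σ) = nopark σ + 1 := by
  unfold nopark
  rw [← Finset.card_insert_of_notMem (a := s) (s := {t : V | σ t = none}) (by simpa using h)]
  congr 1
  ext t
  by_cases hts : t = s
  · subst hts
    have : park t σ t = none := Function.update_self _ _ _
    simp [this]
  · have : park s σ t = σ t := Function.update_of_ne hts _ _
    simp [this, hts]

lemma park_comm {α : Type} (s t : V) (σ : V → Option α) :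
    park s (park t σ) = park t (park s σ) := by
  by_cases h : s = t
  · rw [h]
  · exact (Function.update_comm h _ _ _).symm

section pbl
variable {Q R : Type} [TopologicalSpace Q] [TopologicalSpace R]

lemma pb_none (f : C(Q, R)) (σ : V → Option C(R, M)) (v : V) : pb f σ v = none ↔ σ v = none := by
  simp [pb]

lemma eps_pb (f : C(Q, R)) (σ : V → Option C(R, M)) : eps (pb f σ) = eps σ :=
  Finset.prod_congr rfl (fun _ _ => chi_map _ _)
lemma sgn_pb (s : V) (f : C(Q, R)) (σ : V → Option C(R, M)) : sgn s (pb f σ) = sgn s σ :=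
  Finset.prod_congr rfl (fun _ _ => chi_map _ _)
lemma park_pb (s : V) (f : C(Q, R)) (σ : V → Option C(R, M)) :
    park s (pb f σ) = pb f (park s σ) := by
  funext v
  by_cases h : v = s
  · subst h; simp [park, pb]
  · simp [park, pb, Function.update_of_ne h]
lemma nopark_pb (f : C(Q, R)) (σ : V → Option C(R, M)) : nopark (pb f σ) = nopark σ := by
  unfold nopark
  simp only [pb_none]
lemma park_ev (s : V) (σ : V → Option C(R, M)) (t : R) :
    park s (ev σ t) = ev (park s σ) t := by
  funext v
  by_cases h : v = s
  · subst h; simp [park, ev]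
  · simp [park, ev, Function.update_of_ne h]
end pbl

def Ep : Ch V M →ₗ[ℚ] Ch V M :=
  Finsupp.linearCombination ℚ (fun σ => eps σ.2 • bs σ)

def PP (F : Finset V) : Ch V M →ₗ[ℚ] Ch V M :=
  Finsupp.linearCombination ℚ (fun σ => ∑ s ∈ F,
    if σ.2 s = none then 0 else sgn s σ.2 • bs (⟨σ.1, park s σ.2⟩ : Sim V M))

lemma Ep_bs (σ : Sim V M) : Ep (bs σ) = eps σ.2 • bs σ := by simp [Ep, bs]

lemma PP_bs (F : Finset V) (σ : Sim V M) : PP F (bs σ) = ∑ s ∈ F,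
    if σ.2 s = none then 0 else sgn s σ.2 • bs (⟨σ.1, park s σ.2⟩ : Sim V M) := by
  simp [PP, bs]

open Afn

lemma Ep_ps {Q : Type} [TopologicalSpace Q] [Afn Q] (σ : V → Option C(Q, M)) (m : ℕ)
    (x : LC m Q) : Ep (ps σ m x) = eps σ • ps σ m x := by
  cases m with
  | zero => simp [ps]
  | succ m =>
    refine lin_ext_apply (f := Ep.comp (ps σ (m+1))) (g := eps σ • ps σ (m+1)) (fun p => ?_) x
    rw [LinearMap.comp_apply, LinearMap.smul_apply, ps_bs, Ep_bs, eps_pb]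

lemma PP_ps (F : Finset V) {Q : Type} [TopologicalSpace Q] [Afn Q] (σ : V → Option C(Q, M)) (m : ℕ)
    (x : LC m Q) : PP F (ps σ m x) = ∑ s ∈ F,
      if σ s = none then 0 else sgn s σ • ps (park s σ) m x := by
  cases m with
  | zero => simp [ps]
  | succ m =>
    have := lin_ext_apply (f := (PP F).comp (ps σ (m+1))) (g := ∑ s ∈ F,
      if σ s = none then 0 else sgn s σ • ps (park s σ) (m+1)) (fun p => ?_) x
    · rw [LinearMap.comp_apply] at this
      rw [this, LinearMap.sum_apply]
      refine Finset.sum_congr rfl (fun s _ => ?_)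
      split_ifs <;> simp
    · rw [LinearMap.comp_apply, LinearMap.sum_apply, ps_bs, PP_bs]
      refine Finset.sum_congr rfl (fun s _ => ?_)
      simp only [pb_none]
      split_ifs
      · simp
      · rw [LinearMap.smul_apply, ps_bs, sgn_pb, park_pb]

lemma Ep_nop (e : ℕ → ℕ) (c : ∀ n, LC (e n) (Dl n)) (x : Ch V M) :
    Ep (nop e c x) = nop e c (Ep x) := by
  refine lin_ext_apply (f := Ep.comp (nop e c)) (g := (nop e c).comp Ep) ?_ x
  rintro ⟨n, σ⟩
  simp only [LinearMap.comp_apply]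
  rw [Ep_bs, map_smul, nop_bs, Ep_ps]

lemma PP_nop (F : Finset V) (e : ℕ → ℕ) (c : ∀ n, LC (e n) (Dl n)) (x : Ch V M) :
    PP F (nop e c x) = nop e c (PP F x) := by
  refine lin_ext_apply (f := (PP F).comp (nop e c)) (g := (nop e c).comp (PP F)) ?_ x
  rintro ⟨n, σ⟩
  simp only [LinearMap.comp_apply]
  rw [PP_bs, nop_bs, PP_ps, map_sum]
  refine Finset.sum_congr rfl (fun s _ => ?_)
  dsimp only
  split_ifs
  · simp
  · rw [map_smul, nop_bs]

lemma Ep_Ep (x : Ch V M) : Ep (Ep x) = x := by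
  refine lin_ext_apply (f := Ep.comp Ep) (g := LinearMap.id) ?_ x
  rintro σ
  simp only [LinearMap.comp_apply, LinearMap.id_apply]
  rw [Ep_bs, map_smul, Ep_bs, smul_smul, eps_sq, one_smul]

lemma Ep_PP (F : Finset V) (x : Ch V M) : Ep (PP F x) = - PP F (Ep x) := by
  refine lin_ext_apply (f := Ep.comp (PP F)) (g := - (PP F).comp Ep) ?_ x
  rintro σ
  simp only [LinearMap.comp_apply, LinearMap.neg_apply]
  rw [Ep_bs, map_smul, PP_bs, map_sum, Finset.smul_sum, ← Finset.sum_neg_distrib]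
  refine Finset.sum_congr rfl (fun s _ => ?_)
  split_ifs with h
  · simp
  · rw [map_smul, Ep_bs, smul_smul, smul_smul, ← neg_smul]
    congr 1
    rw [eps_park _ _ h]
    ring

lemma PP_PP (F : Finset V) (x : Ch V M) : PP F (PP F x) = 0 := by
  refine lin_ext_apply (f := (PP F).comp (PP F)) (g := 0) ?_ x
  rintro ⟨n, σ⟩
  simp only [LinearMap.comp_apply, LinearMap.zero_apply]
  let g : V → V → Ch V M := fun s t => if σ s = none ∨ σ t = none ∨ s = t then 0 else
    ((if s < t then -1 else 1 : ℚ) * sgn s σ * sgn t σ) • bs (⟨n, park s (park t σ)⟩ : Sim V M)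
  have key : PP F (PP F (bs ⟨n, σ⟩)) = ∑ s ∈ F, ∑ t ∈ F, g s t := by
    rw [PP_bs, map_sum]
    refine Finset.sum_congr rfl (fun s _ => ?_)
    dsimp only
    split_ifs with h
    · rw [map_zero, Finset.sum_eq_zero]
      intro t _
      simp [g, h]
    · rw [map_smul, PP_bs, Finset.smul_sum]
      refine Finset.sum_congr rfl (fun t _ => ?_)
      dsimp only [g]
      by_cases hst : s = t
      · subst hst; simp [park]
      · have : park s σ t = σ t := Function.update_of_ne (Ne.symm hst) _ _
        by_cases ht : σ t = none
        · rw [if_pos (this.trans ht), if_pos (by tauto), smul_zero]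
        · rw [if_neg (fun h' => ht (this.symm.trans h')), if_neg (by tauto), smul_smul, sgn_park _ _ _ h, park_comm]
          congr 1
          ring
  rw [key]
  have anti : ∀ s t, g s t = - g t s := by
    intro s t
    dsimp only [g]
    by_cases h : σ s = none ∨ σ t = none ∨ s = t
    · rw [if_pos h, if_pos (by tauto), neg_zero]
    · rw [if_neg h, if_neg (c := σ t = none ∨ σ s = none ∨ t = s) (by tauto), park_comm, ← neg_smul]
      congr 1
      push Not at h
      rcases lt_or_gt_of_ne h.2.2 with h1 | h1
      · rw [if_pos h1, if_neg (asymm h1)]; ring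
      · rw [if_pos h1, if_neg (asymm h1)]; ring
  have h2 : ∑ s ∈ F, ∑ t ∈ F, g s t = - ∑ s ∈ F, ∑ t ∈ F, g s t := by
    conv_lhs => rw [Finset.sum_comm]
    rw [← Finset.sum_neg_distrib]
    refine Finset.sum_congr rfl (fun s _ => ?_)
    rw [← Finset.sum_neg_distrib]
    exact Finset.sum_congr rfl (fun t _ => anti _ _)
  exact self_eq_neg.mp h2

/-- total differential -/
def DD (F : Finset V) : Ch V M →ₗ[ℚ] Ch V M := Ep.comp dd + PP F

lemma DD_apply (F : Finset V) (x : Ch V M) : DD F x = Ep (dd x) + PP F x := rfl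

lemma DD_DD (F : Finset V) (x : Ch V M) : DD F (DD F x) = 0 := by
  simp only [DD_apply, map_add, PP_PP, add_zero]
  have h1 : Ep (dd (Ep (dd x))) = (0 : Ch V M) := by
    rw [dd, Ep_nop, ← dd, Ep_Ep, dd_dd]
  have h2 : Ep (dd (PP F x)) = - PP F (Ep (dd x)) := by
    rw [← Ep_PP, dd, PP_nop]
  rw [h1, h2]
  simp

/-- twisted homotopy -/
def TE : Ch V M →ₗ[ℚ] Ch V M := Ep.comp TT

lemma DD_TE (F : Finset V) (x : Ch V M) : DD F (TE x) = x - SD x - TE (DD F x) := by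
  simp only [DD_apply, TE, LinearMap.comp_apply, map_add]
  have h1 : Ep (dd (Ep (TT x))) = dd (TT x) := by
    rw [dd, Ep_nop, ← dd, Ep_Ep]
  have h2 : Ep (TT (Ep (dd x))) = TT (dd x) := by
    rw [TT, Ep_nop, ← TT, Ep_Ep]
  have h3 : Ep (TT (PP F x)) = - PP F (Ep (TT x)) := by
    rw [← Ep_PP, TT, PP_nop]
  rw [h1, h2, h3, dd_TT]
  abel

lemma SD_DD (F : Finset V) (x : Ch V M) : SD (DD F x) = DD F (SD x) := by
  simp only [DD_apply, map_add]
  rw [← SD_dd, SD, ← Ep_nop, PP_nop]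

/-- degree -/
def deg (σ : Sim V M) : ℤ := (σ.1 : ℤ) - nopark σ.2

def Gr (n : ℤ) : Submodule ℚ (Ch V M) := sp {σ | deg σ = n}

lemma ps_Gr {Q : Type} [TopologicalSpace Q] [Afn Q] (σ : V → Option C(Q, M)) (m : ℕ)
    (x : LC m Q) : ps σ m x ∈ (Gr ((m : ℤ) - 1 - nopark σ) : Submodule ℚ (Ch V M)) := by
  refine Finsupp.supported_mono ?_ (ps_supp σ m x)
  rintro τ ⟨h, f, hf⟩
  change deg τ = _
  rw [deg, hf, nopark_pb, ← h]
  push_cast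
  ring

lemma Ep_sp (𝒜 : Set (Sim V M)) (x : Ch V M) (hx : x ∈ sp 𝒜) : Ep x ∈ sp 𝒜 := by
  refine supp_map _ _ _ (fun σ h => ?_) hx
  rw [Ep_bs]
  exact Submodule.smul_mem _ _ (supp_bs h)

lemma PP_Gr (F : Finset V) {n : ℤ} {x : Ch V M} (hx : x ∈ Gr n) : PP F x ∈ Gr (V := V) (M := M) (n-1) := by
  refine supp_map _ _ _ (fun σ h => ?_) hx
  rw [PP_bs]
  refine Submodule.sum_mem _ (fun s _ => ?_)
  split_ifs with hs
  · exact Submodule.zero_mem _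
  · refine Submodule.smul_mem _ _ (supp_bs ?_)
    change deg _ = _
    have h : deg σ = n := h
    rw [← h, deg, deg, nopark_park _ _ hs]
    push_cast
    ring

lemma dd_Gr {n : ℤ} {x : Ch V M} (hx : x ∈ Gr n) : dd x ∈ Gr (V := V) (M := M) (n-1) := by
  refine supp_map _ _ _ (fun σ h => ?_) hx
  obtain ⟨k, σ⟩ := σ
  rw [dd_bs]
  have h : deg _ = n := h
  convert ps_Gr σ k _ using 2
  rw [← h, deg]; ring

lemma DD_Gr (F : Finset V) {n : ℤ} {x : Ch V M} (hx : x ∈ Gr n) :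
    DD F x ∈ Gr (V := V) (M := M) (n-1) :=
  Submodule.add_mem _ (Ep_sp _ _ (dd_Gr hx)) (PP_Gr F hx)

lemma SD_Gr {n : ℤ} {x : Ch V M} (hx : x ∈ Gr n) : SD x ∈ Gr (V := V) (M := M) n := by
  refine supp_map _ _ _ (fun σ h => ?_) hx
  obtain ⟨k, σ⟩ := σ
  rw [SD, nop_bs]
  have h : deg _ = n := h
  convert ps_Gr σ _ _ using 2
  rw [← h, deg]; push_cast; ring

lemma TE_Gr {n : ℤ} {x : Ch V M} (hx : x ∈ Gr n) : TE x ∈ Gr (V := V) (M := M) (n+1) := by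
  refine Ep_sp _ _ ?_
  refine supp_map _ _ (Gr (n+1)) (fun σ h => ?_) hx
  obtain ⟨k, σ⟩ := σ
  rw [TT, nop_bs]
  have h : deg _ = n := h
  convert ps_Gr σ _ _ using 2
  rw [← h, deg]; push_cast; ring

/-- closed under parking -/
def PkCl (F : Finset V) (X : Set (V → Option M)) : Prop := ∀ y ∈ X, ∀ s ∈ F, park s y ∈ X

lemma DD_Al (F : Finset V) {X : Set (V → Option M)} (hX : PkCl F X) {x : Ch V M}
    (hx : x ∈ sp (Al X)) : DD F x ∈ sp (Al X) := by
  refine Submodule.add_mem _ (Ep_sp _ _ (nop_Al _ _ _ _ hx)) ?_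
  refine supp_map _ _ _ (fun σ h => ?_) hx
  rw [PP_bs]
  refine Submodule.sum_mem _ (fun s hs => ?_)
  split_ifs
  · exact Submodule.zero_mem _
  · refine Submodule.smul_mem _ _ (supp_bs (fun t => ?_))
    rw [← park_ev]
    exact hX _ (h t) s hs

lemma SD_Al {X : Set (V → Option M)} {x : Ch V M}
    (hx : x ∈ sp (Al X)) : SD x ∈ sp (Al X) := nop_Al _ _ _ _ hx
lemma TE_Al {X : Set (V → Option M)} {x : Ch V M}
    (hx : x ∈ sp (Al X)) : TE x ∈ sp (Al X) := Ep_sp _ _ (nop_Al _ _ _ _ hx)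

end
end CFS

set_option linter.unusedSectionVars false
set_option linter.unusedSimpArgs false

namespace CFS
noncomputable section

variable {V M : Type} [TopologicalSpace M] [Fintype V] [LinearOrder V]

/-- relative acyclicity in degree `n` -/
def Acy (F : Finset V) (N : Submodule ℚ (Ch V M)) (A B : Set (Sim V M)) (n : ℤ) : Prop :=
  ∀ x ∈ N, x ∈ sp A → x ∈ Gr n → DD F x ∈ sp B →
    ∃ y ∈ N, y ∈ sp A ∧ y ∈ Gr (n+1) ∧ x - DD F y ∈ sp B

def StD (F : Finset V) (N : Submodule ℚ (Ch V M)) : Prop := ∀ x ∈ N, DD F x ∈ N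

structure Sta (F : Finset V) (N : Submodule ℚ (Ch V M)) : Prop where
  hD : ∀ x ∈ N, DD F x ∈ N
  hS : ∀ x ∈ N, SD x ∈ N
  hT : ∀ x ∈ N, TE x ∈ N

lemma Sta_top (F : Finset V) : Sta F (⊤ : Submodule ℚ (Ch V M)) :=
  ⟨fun _ _ => trivial, fun _ _ => trivial, fun _ _ => trivial⟩

open Classical in
def Restr (N : Submodule ℚ (Ch V M)) (A : Set (Sim V M)) : Prop :=
  ∀ x ∈ N, x.filter (· ∈ A) ∈ N

lemma Restr_top (A : Set (Sim V M)) : Restr ⊤ A := fun _ _ => trivial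

lemma acy1 {F : Finset V} {N : Submodule ℚ (Ch V M)} {A B C : Set (Sim V M)} {n : ℤ}
    (hN : StD F N) (hBA : B ⊆ A) (hCB : C ⊆ B)
    (h1 : Acy F N A B n) (h2 : Acy F N B C n) : Acy F N A C n := by
  intro x hxN hxA hxn hDx
  obtain ⟨y, hyN, hyA, hyn, hy⟩ := h1 x hxN hxA hxn (Finsupp.supported_mono hCB hDx)
  obtain ⟨z, hzN, hzB, hzn, hz⟩ := h2 (x - DD F y) (N.sub_mem hxN (hN _ hyN)) hy
    (Submodule.sub_mem _ hxn (by simpa using DD_Gr F hyn)) (by rwa [map_sub, DD_DD, sub_zero])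
  refine ⟨y + z, N.add_mem hyN hzN, Submodule.add_mem _ hyA (Finsupp.supported_mono hBA hzB),
    Submodule.add_mem _ hyn hzn, ?_⟩
  rwa [map_add, ← sub_sub]

lemma acy2 {F : Finset V} {N : Submodule ℚ (Ch V M)} {A B C : Set (Sim V M)} {n : ℤ}
    (hN : StD F N) (hBA : B ⊆ A) (hCB : C ⊆ B)
    (h1 : Acy F N A C n) (h2 : Acy F N B C (n-1)) : Acy F N A B n := by
  intro x hxN hxA hxn hDx
  obtain ⟨y, hyN, hyB, hyn, hy⟩ := h2 (DD F x) (hN _ hxN) hDx (DD_Gr F hxn)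
    (by rw [DD_DD]; exact Submodule.zero_mem _)
  rw [sub_add_cancel] at hyn
  obtain ⟨z, hzN, hzA, hzn, hz⟩ := h1 (x - y) (N.sub_mem hxN hyN)
    (Submodule.sub_mem _ hxA (Finsupp.supported_mono hBA hyB)) (Submodule.sub_mem _ hxn hyn)
    (by rwa [map_sub])
  refine ⟨z, hzN, hzA, hzn, ?_⟩
  have : x - DD F z = (x - y - DD F z) + y := by abel
  rw [this]
  exact Submodule.add_mem _ (Finsupp.supported_mono hCB hz) hyB

lemma acy3 {F : Finset V} {N : Submodule ℚ (Ch V M)} {A B C : Set (Sim V M)} {n : ℤ}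
    (hN : StD F N) (hBA : B ⊆ A) (hCB : C ⊆ B)
    (h1 : Acy F N A C n) (h2 : Acy F N A B (n+1)) : Acy F N B C n := by
  intro x hxN hxB hxn hDx
  obtain ⟨y, hyN, hyA, hyn, hy⟩ := h1 x hxN (Finsupp.supported_mono hBA hxB) hxn hDx
  have hDy : DD F y ∈ sp B := by
    have : DD F y = x - (x - DD F y) := by abel
    rw [this]
    exact Submodule.sub_mem _ hxB (Finsupp.supported_mono hCB hy)
  obtain ⟨w, hwN, hwA, hwn, hw⟩ := h2 y hyN hyA hyn hDy
  refine ⟨y - DD F w, N.sub_mem hyN (hN _ hwN), hw,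
    Submodule.sub_mem _ hyn (by simpa using DD_Gr F hwn), ?_⟩
  rwa [map_sub, DD_DD, sub_zero]

lemma sta_iter {F : Finset V} {N : Submodule ℚ (Ch V M)} (hN : Sta F N) (k : ℕ) (x : Ch V M)
    (hx : x ∈ N) : SD^[k] x ∈ N := by
  induction k with
  | zero => exact hx
  | succ k ih => rw [Function.iterate_succ_apply']; exact hN.hS _ ih

lemma SDi_DD (F : Finset V) (k : ℕ) (x : Ch V M) : SD^[k] (DD F x) = DD F (SD^[k] x) := by
  induction k with
  | zero => rfl
  | succ k ih => rw [Function.iterate_succ_apply', ih, SD_DD, ← Function.iterate_succ_apply' SD]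

lemma SDi_Al (k : ℕ) {X : Set (V → Option M)} {x : Ch V M}
    (hx : x ∈ sp (Al X)) : SD^[k] x ∈ sp (Al X) := by
  induction k with
  | zero => exact hx
  | succ k ih => rw [Function.iterate_succ_apply']; exact SD_Al ih

lemma SDi_Gr (k : ℕ) {n : ℤ} {x : Ch V M}
    (hx : x ∈ Gr n) : SD^[k] x ∈ (Gr n : Submodule ℚ (Ch V M)) := by
  induction k with
  | zero => exact hx
  | succ k ih => rw [Function.iterate_succ_apply']; exact SD_Gr ih

lemma iterT (F : Finset V) (k : ℕ) : ∃ L : Ch V M →ₗ[ℚ] Ch V M,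
    (∀ x, DD F (L x) = x - SD^[k] x - L (DD F x)) ∧
    (∀ X x, x ∈ sp (Al X) → L x ∈ sp (Al X)) ∧
    (∀ n x, x ∈ Gr n → L x ∈ Gr (n+1)) ∧
    (∀ N, Sta F N → ∀ x ∈ N, L x ∈ N) := by
  induction k with
  | zero =>
    refine ⟨0, fun x => by simp, fun X x _ => Submodule.zero_mem _, fun n x _ => Submodule.zero_mem _,
      fun N _ x _ => Submodule.zero_mem _⟩
  | succ k ih =>
    obtain ⟨L, h1, h2, h3, h4⟩ := ih
    refine ⟨TE + L.comp SD, fun x => ?_, fun X x hx => ?_, fun n x hx => ?_, fun N hN x hx => ?_⟩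
    · simp only [LinearMap.add_apply, LinearMap.comp_apply, map_add, DD_TE, h1, SD_DD,
        Function.iterate_succ_apply]
      abel
    · exact Submodule.add_mem _ (TE_Al hx) (h2 _ _ (SD_Al hx))
    · exact Submodule.add_mem _ (TE_Gr hx) (h3 _ _ (SD_Gr hx))
    · exact N.add_mem (hN.hT _ hx) (h4 _ hN _ (hN.hS _ hx))

/-- open conditions -/
def IsOp (X : Set (V → Option M)) : Prop :=
  ∀ (n : ℕ) (σ : V → Option C(Dl n, M)), IsOpen {t | ev σ t ∈ X}

lemma IsOp.inter {X Y : Set (V → Option M)} (hX : IsOp X) (hY : IsOp Y) : IsOp (X ∩ Y) :=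
  fun n σ => (hX n σ).inter (hY n σ)
lemma IsOp.union {X Y : Set (V → Option M)} (hX : IsOp X) (hY : IsOp Y) : IsOp (X ∪ Y) :=
  fun n σ => (hX n σ).union (hY n σ)

lemma SDi_bs {n : ℕ} (σ : V → Option C(Dl n, M)) (k : ℕ) :
    SD^[k] (bs ⟨n, σ⟩) = ps σ (n+1) ((sd bary (n+1))^[k] (bs vt)) := by
  induction k with
  | zero => exact (ps_vt σ).symm
  | succ k ih => rw [Function.iterate_succ_apply', ih, SD_ps, ← Function.iterate_succ_apply' (sd bary (n+1))]

lemma small_bs {X Y : Set (V → Option M)} (hX : IsOp X) (hY : IsOp Y) (σ : Sim V M)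
    (hσ : σ ∈ Al (X ∪ Y)) : ∃ k₀, ∀ k ≥ k₀, SD^[k] (bs σ) ∈ sp (Al X ∪ Al Y) := by
  obtain ⟨n, σ⟩ := σ
  obtain ⟨δ, hδ, hleb⟩ := lebesgue_number_lemma_of_metric (α := Dl n) (s := Set.univ)
    (c := fun b : Bool => {t | ev σ t ∈ cond b X Y}) isCompact_univ
    (by rintro (_|_); exacts [hY n σ, hX n σ])
    (by
      intro t _
      rcases hσ t with h | h
      · exact Set.mem_iUnion.2 ⟨true, h⟩
      · exact Set.mem_iUnion.2 ⟨false, h⟩)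
  obtain ⟨C, hC⟩ := Metric.isBounded_iff.1 (isCompact_univ (X := Dl n)).isBounded
  have hr : ((n:ℕ):ℝ)/(n+1) < 1 := by
    rw [div_lt_one (by positivity)]; linarith
  have htend : Filter.Tendsto (fun k => (((n:ℕ):ℝ)/(n+1))^k * |C|) Filter.atTop (nhds (0 * |C|)) :=
    (tendsto_pow_atTop_nhds_zero_of_lt_one (by positivity) hr).mul_const _
  rw [zero_mul] at htend
  obtain ⟨k₀, hk₀⟩ := Filter.eventually_atTop.1 (htend.eventually (gt_mem_nhds hδ))
  refine ⟨k₀, fun k hk => ?_⟩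
  rw [SDi_bs]
  have := iter_sd_small n (vt : Fin (n+1) → Dl n) k |C| (abs_nonneg _)
    (fun i j => (hC (Set.mem_univ _) (Set.mem_univ _)).trans (le_abs_self _))
  refine supp_map _ _ _ (fun q hq => ?_) this
  rw [ps_bs]
  apply supp_bs
  obtain ⟨b, hb⟩ := hleb (q 0) (Set.mem_univ _)
  have hin : ∀ t, ev (pb (rl q) σ) t ∈ cond b X Y := by
    intro t
    rw [ev_pb]
    apply hb
    rw [Metric.mem_ball]
    have h1 := rl_dist q _ hq t (vt 0)
    rw [rl_vt] at h1
    exact lt_of_le_of_lt h1 (hk₀ k hk)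
  cases b with
  | true => exact Or.inl hin
  | false => exact Or.inr hin

lemma small {X Y : Set (V → Option M)} (hX : IsOp X) (hY : IsOp Y) (x : Ch V M)
    (hx : x ∈ sp (Al (X ∪ Y))) : ∃ k, SD^[k] x ∈ sp (Al X ∪ Al Y) := by
  have hlin : ∀ k, (SD (V := V) (M := M))^[k] = ⇑(SD (V := V) (M := M) ^ k) := fun k => by
    funext x; rw [Module.End.pow_apply]
  let P : Submodule ℚ (Ch V M) :=
    { carrier := {x | ∃ k₀, ∀ k ≥ k₀, SD^[k] x ∈ sp (Al X ∪ Al Y)}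
      add_mem' := by
        rintro a b ⟨k, hk⟩ ⟨l, hl⟩
        refine ⟨max k l, fun j hj => ?_⟩
        rw [hlin, map_add, ← hlin]
        exact Submodule.add_mem _ (hk _ (le_trans (le_max_left _ _) hj))
          (hl _ (le_trans (le_max_right _ _) hj))
      zero_mem' := ⟨0, fun k _ => by rw [hlin, map_zero]; exact Submodule.zero_mem _⟩
      smul_mem' := by
        rintro c a ⟨k, hk⟩
        refine ⟨k, fun j hj => ?_⟩
        rw [hlin, map_smul, ← hlin]
        exact Submodule.smul_mem _ _ (hk _ hj) }
  have : LinearMap.id x ∈ P := supp_map _ _ _ (fun σ hσ => small_bs hX hY σ hσ) hx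
  obtain ⟨k, hk⟩ := this
  exact ⟨k, hk k le_rfl⟩

open Classical in
lemma filter_sp {A B : Set (Sim V M)} {x : Ch V M} (hx : x ∈ sp B) :
    x.filter (· ∈ A) ∈ sp (A ∩ B) := by
  rw [Finsupp.mem_supported]
  intro σ hσ
  simp only [Finsupp.support_filter, Finset.coe_filter, Set.mem_setOf_eq] at hσ
  exact ⟨hσ.2, (Finsupp.mem_supported ℚ x).1 hx hσ.1⟩

open Classical in
lemma split_sp {A B C : Set (Sim V M)} (hC : C ⊆ A ∪ B) {x : Ch V M} (hx : x ∈ sp C)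
    {N : Submodule ℚ (Ch V M)} (hN : Restr N A) (hxN : x ∈ N) :
    ∃ x₁ ∈ N, ∃ x₂ ∈ N, x = x₁ + x₂ ∧ x₁ ∈ sp A ∧ x₂ ∈ sp B ∧
      (∀ D, x ∈ sp D → x₁ ∈ sp D ∧ x₂ ∈ sp D) := by
  have hsum : x.filter (· ∈ A) + x.filter (fun a => ¬ a ∈ A) = x := Finsupp.filter_pos_add_filter_neg _ _
  have h2 : x.filter (fun a => ¬ a ∈ A) = x - x.filter (· ∈ A) := by
    rw [eq_sub_iff_add_eq']; exact hsum
  refine ⟨x.filter (· ∈ A), hN _ hxN, x - x.filter (· ∈ A), N.sub_mem hxN (hN _ hxN), by abel,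
    Finsupp.supported_mono Set.inter_subset_left (filter_sp hx), ?_, ?_⟩
  · rw [← h2, Finsupp.mem_supported]
    intro σ hσ
    simp only [Finsupp.support_filter, Finset.coe_filter, Set.mem_setOf_eq] at hσ
    exact (hC ((Finsupp.mem_supported ℚ x).1 hx hσ.1)).resolve_left hσ.2
  · intro D hD
    have := Finsupp.supported_mono Set.inter_subset_right (filter_sp (A := A) hD)
    exact ⟨this, Submodule.sub_mem _ hD this⟩

lemma sp_inter {A B : Set (Sim V M)} {x : Ch V M} (hA : x ∈ sp A) (hB : x ∈ sp B) :
    x ∈ sp (A ∩ B) := by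
  rw [Finsupp.mem_supported] at *
  exact Set.subset_inter hA hB

lemma sp_Al_inter {X Y : Set (V → Option M)} {x : Ch V M} (hA : x ∈ sp (Al X)) (hB : x ∈ sp (Al Y)) :
    x ∈ sp (Al (X ∩ Y)) := by
  rw [Al_inter]; exact sp_inter hA hB

lemma excise_up {F : Finset V} {N : Submodule ℚ (Ch V M)} (hN : Sta F N)
    {X Y : Set (V → Option M)} (hX : IsOp X) (hY : IsOp Y) (hXF : PkCl F X) (hYF : PkCl F Y)
    (hR : Restr N (Al X)) {n : ℤ}
    (h : Acy F N (Al X) (Al (X ∩ Y)) n) : Acy F N (Al (X ∪ Y)) (Al Y) n := by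
  intro x hxN hx hxn hDx
  obtain ⟨k, hk⟩ := small hX hY x hx
  obtain ⟨L, h1, h2, h3, h4⟩ := iterT F (M := M) k
  obtain ⟨x₁, hx₁N, x₂, hx₂N, hxe, hx₁, hx₂, hxD⟩ := split_sp le_rfl hk hR (sta_iter hN k x hxN)
  have hg := hxD _ (SDi_Gr k hxn)
  have hDx₁ : DD F x₁ ∈ sp (Al (X ∩ Y)) := by
    refine sp_Al_inter (DD_Al F hXF hx₁) ?_
    have : DD F x₁ = SD^[k] (DD F x) - DD F x₂ := by
      rw [SDi_DD, hxe, map_add]; abel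
    rw [this]
    exact Submodule.sub_mem _ (SDi_Al k hDx) (DD_Al F hYF hx₂)
  obtain ⟨y, hyN, hy, hyn, hxy⟩ := h x₁ hx₁N hx₁ hg.1 hDx₁
  refine ⟨y + L x, N.add_mem hyN (h4 N hN x hxN),
    Submodule.add_mem _ (Finsupp.supported_mono (Al_mono Set.subset_union_left) hy) (h2 _ _ hx),
    Submodule.add_mem _ hyn (h3 _ _ hxn), ?_⟩
  have : x - DD F (y + L x) = (x₁ - DD F y) + x₂ + L (DD F x) := by
    rw [map_add, h1, hxe]; abel
  rw [this]
  exact Submodule.add_mem _ (Submodule.add_mem _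
    (Finsupp.supported_mono (Al_mono Set.inter_subset_right) hxy) hx₂) (h2 _ _ hDx)

lemma excise_down {F : Finset V} {N : Submodule ℚ (Ch V M)} (hN : Sta F N)
    {X Y : Set (V → Option M)} (hX : IsOp X) (hY : IsOp Y) (hXF : PkCl F X) (hYF : PkCl F Y)
    (hR : Restr N (Al X)) {n : ℤ}
    (h : Acy F N (Al (X ∪ Y)) (Al Y) n) : Acy F N (Al X) (Al (X ∩ Y)) n := by
  intro x hxN hx hxn hDx
  obtain ⟨y, hyN, hy, hyn, hxy⟩ := h x hxN
    (Finsupp.supported_mono (Al_mono Set.subset_union_left) hx) hxn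
    (Finsupp.supported_mono (Al_mono Set.inter_subset_right) hDx)
  obtain ⟨k, hk⟩ := small hX hY y hy
  obtain ⟨L, h1, h2, h3, h4⟩ := iterT F (M := M) k
  obtain ⟨y₁, hy₁N, y₂, hy₂N, hye, hy₁, hy₂, hyD⟩ := split_sp le_rfl hk hR (sta_iter hN k y hyN)
  have hg := hyD _ (SDi_Gr k hyn)
  refine ⟨L x + y₁, N.add_mem (h4 N hN x hxN) hy₁N, Submodule.add_mem _ (h2 _ _ hx) hy₁,
    Submodule.add_mem _ (h3 _ _ hxn) hg.1, ?_⟩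
  have e1 : x - DD F (L x + y₁) = (SD^[k] x - DD F y₁) + L (DD F x) := by
    rw [map_add, h1]; abel
  have e2 : SD^[k] x - DD F y₁ = SD^[k] (x - DD F y) + DD F y₂ := by
    have hlin : (SD (V := V) (M := M))^[k] = ⇑(SD (V := V) (M := M) ^ k) := by
      funext x; rw [Module.End.pow_apply]
    rw [hlin, map_sub, ← hlin, SDi_DD, hye, map_add]; abel
  rw [e1]
  refine Submodule.add_mem _ (sp_Al_inter ?_ ?_) (h2 _ _ hDx)
  · exact Submodule.sub_mem _ (SDi_Al k hx) (DD_Al F hXF hy₁)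
  · rw [e2]
    exact Submodule.add_mem _ (SDi_Al k hxy) (DD_Al F hYF hy₂)

lemma mv {F : Finset V} {N : Submodule ℚ (Ch V M)} (hN : Sta F N)
    {X Y Z : Set (V → Option M)} (hX : IsOp X) (hY : IsOp Y) (hXF : PkCl F X) (hYF : PkCl F Y)
    (hZF : PkCl F Z)
    (hR : Restr N (Al X)) {n : ℤ}
    (h1 : Acy F N (Al X) (Al (X ∩ Z)) n) (h2 : Acy F N (Al Y) (Al (Y ∩ Z)) n)
    (h12 : Acy F N (Al (X ∩ Y)) (Al (X ∩ Y ∩ Z)) (n-1)) :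
    Acy F N (Al (X ∪ Y)) (Al ((X ∪ Y) ∩ Z)) n := by
  intro x hxN hx hxn hDx
  have hDxZ : DD F x ∈ sp (Al Z) := Finsupp.supported_mono (Al_mono Set.inter_subset_right) hDx
  obtain ⟨k, hk⟩ := small hX hY x hx
  obtain ⟨L, l1, l2, l3, l4⟩ := iterT F (M := M) k
  obtain ⟨x₁, hx₁N, x₂, hx₂N, hxe, hx₁, hx₂, hxD⟩ := split_sp le_rfl hk hR (sta_iter hN k x hxN)
  have hg := hxD _ (SDi_Gr k hxn)
  have hb : DD F (SD^[k] x) ∈ sp (Al X ∪ Al Y) := by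
    rw [hxe, map_add]
    exact Submodule.add_mem _ (Finsupp.supported_mono Set.subset_union_left (DD_Al F hXF hx₁))
      (Finsupp.supported_mono Set.subset_union_right (DD_Al F hYF hx₂))
  have hbZ : DD F (SD^[k] x) ∈ sp (Al Z) := by
    rw [← SDi_DD]; exact SDi_Al k hDxZ
  obtain ⟨b₁, hb₁N, b₂, hb₂N, hbe, hb₁, hb₂, hbD⟩ := split_sp le_rfl hb hR
    (hN.hD _ (sta_iter hN k x hxN))
  have hbg := hbD _ (DD_Gr F (SDi_Gr k hxn))
  have hbz := hbD _ hbZ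
  have hcom : DD F x₁ - b₁ = b₂ - DD F x₂ := by
    have : DD F x₁ + DD F x₂ = b₁ + b₂ := by rw [← map_add, ← hxe, hbe]
    rw [sub_eq_sub_iff_add_eq_add, this]; abel
  have hu : DD F x₁ - b₁ ∈ sp (Al (X ∩ Y)) := by
    refine sp_Al_inter (Submodule.sub_mem _ (DD_Al F hXF hx₁) hb₁) ?_
    rw [hcom]
    exact Submodule.sub_mem _ hb₂ (DD_Al F hYF hx₂)
  obtain ⟨y, hyN, hy, hyn, hxy⟩ := h12 (DD F x₁ - b₁) (N.sub_mem (hN.hD _ hx₁N) hb₁N) hu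
    (Submodule.sub_mem _ (DD_Gr F hg.1) hbg.1) (by
      have hcl : PkCl F (X ∩ Y) := fun w hw s hs => ⟨hXF w hw.1 s hs, hYF w hw.2 s hs⟩
      refine sp_Al_inter (DD_Al F hcl hu) ?_
      rw [map_sub, DD_DD, zero_sub]
      exact Submodule.neg_mem _ (DD_Al F hZF hbz.1))
  rw [sub_add_cancel] at hyn
  have hyX : y ∈ sp (Al X) := Finsupp.supported_mono (Al_mono Set.inter_subset_left) hy
  have hyY : y ∈ sp (Al Y) := Finsupp.supported_mono (Al_mono Set.inter_subset_right) hy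
  rw [Set.inter_assoc] at hxy
  obtain ⟨z₁, hz₁N, hz₁, hz₁n, hz₁e⟩ := h1 (x₁ - y) (N.sub_mem hx₁N hyN)
    (Submodule.sub_mem _ hx₁ hyX) (Submodule.sub_mem _ hg.1 hyn) (by
      have : DD F (x₁ - y) = b₁ + (DD F x₁ - b₁ - DD F y) := by rw [map_sub]; abel
      rw [this]
      refine Submodule.add_mem _ (sp_Al_inter hb₁ hbz.1) (Finsupp.supported_mono (Al_mono ?_) hxy)
      exact fun w hw => ⟨hw.1, hw.2.2⟩)
  obtain ⟨z₂, hz₂N, hz₂, hz₂n, hz₂e⟩ := h2 (x₂ + y) (N.add_mem hx₂N hyN)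
    (Submodule.add_mem _ hx₂ hyY) (Submodule.add_mem _ hg.2 hyn) (by
      have : DD F (x₂ + y) = b₂ - (DD F x₁ - b₁ - DD F y) := by rw [map_add, hcom]; abel
      rw [this]
      refine Submodule.sub_mem _ (sp_Al_inter hb₂ hbz.2) (Finsupp.supported_mono (Al_mono ?_) hxy)
      exact fun w hw => ⟨hw.2.1, hw.2.2⟩)
  refine ⟨z₁ + z₂ + L x, N.add_mem (N.add_mem hz₁N hz₂N) (l4 N hN x hxN),
    Submodule.add_mem _ (Submodule.add_mem _
      (Finsupp.supported_mono (Al_mono Set.subset_union_left) hz₁)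
      (Finsupp.supported_mono (Al_mono Set.subset_union_right) hz₂)) (l2 _ _ hx),
    Submodule.add_mem _ (Submodule.add_mem _ hz₁n hz₂n) (l3 _ _ hxn), ?_⟩
  have : x - DD F (z₁ + z₂ + L x) = (x₁ - y - DD F z₁) + (x₂ + y - DD F z₂) + L (DD F x) := by
    rw [map_add, map_add, l1, hxe]; abel
  rw [this]
  refine Submodule.add_mem _ (Submodule.add_mem _ (Finsupp.supported_mono (Al_mono ?_) hz₁e)
    (Finsupp.supported_mono (Al_mono ?_) hz₂e)) (l2 _ _ hDx)
  · exact fun w hw => ⟨Or.inl hw.1, hw.2⟩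
  · exact fun w hw => ⟨Or.inr hw.1, hw.2⟩

/-- compactness for directed unions -/
lemma directed_sp {ι : Type*} [Nonempty ι] (X : ι → Set (V → Option M)) (hop : ∀ i, IsOp (X i))
    (hdir : Directed (· ⊆ ·) X) {x : Ch V M} (hx : x ∈ sp (Al (⋃ i, X i))) :
    ∃ i, x ∈ sp (Al (X i)) := by
  let P : Submodule ℚ (Ch V M) :=
    { carrier := {x | ∃ i, x ∈ sp (Al (X i))}
      add_mem' := by
        rintro a b ⟨i, hi⟩ ⟨j, hj⟩
        obtain ⟨k, hik, hjk⟩ := hdir i j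
        exact ⟨k, Submodule.add_mem _ (Finsupp.supported_mono (Al_mono hik) hi)
          (Finsupp.supported_mono (Al_mono hjk) hj)⟩
      zero_mem' := ⟨Classical.arbitrary ι, Submodule.zero_mem _⟩
      smul_mem' := by
        rintro c a ⟨k, hk⟩
        exact ⟨k, Submodule.smul_mem _ _ hk⟩ }
  have : (LinearMap.id : Ch V M →ₗ[ℚ] Ch V M) x ∈ P := by
    refine supp_map _ _ _ (fun σ hσ => ?_) hx
    obtain ⟨n, σ⟩ := σ
    have := (isCompact_univ (X := Dl n)).elim_directed_cover (fun i => {t | ev σ t ∈ X i})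
      (fun i => hop i n σ) (fun t _ => by simpa using hσ t) (by
        intro i j
        obtain ⟨k, hik, hjk⟩ := hdir i j
        exact ⟨k, fun t ht => hik ht, fun t ht => hjk ht⟩)
    obtain ⟨i, hi⟩ := this
    exact ⟨i, supp_bs (fun t => hi (Set.mem_univ t))⟩
  exact this

end
end CFS

set_option linter.unusedSectionVars false
set_option linter.unusedSimpArgs false

namespace CFS
noncomputable section

variable {V M : Type} [TopologicalSpace M] [Fintype V] [LinearOrder V]

lemma ev_ext {Q : Type} [TopologicalSpace Q] [Nonempty Q] {σ τ : V → Option C(Q, M)}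
    (h : ∀ t, ev σ t = ev τ t) : σ = τ := by
  funext v
  have h' : ∀ t, (σ v).map (fun g => g t) = (τ v).map (fun g => g t) := fun t => congrFun (h t) v
  cases hs : σ v with
  | none =>
    have := h' (Classical.arbitrary Q)
    rw [hs] at this
    cases ht : τ v with
    | none => rfl
    | some g => rw [ht] at this; simp at this
  | some f =>
    cases ht : τ v with
    | none => have := h' (Classical.arbitrary Q); rw [hs, ht] at this; simp at this
    | some g =>
      congr 1
      ext t
      have := h' t
      rw [hs, ht] at this
      simpa using this

instance (n : ℕ) : Nonempty (Dl n) := ⟨vt 0⟩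

lemma ev_none {Q : Type} [TopologicalSpace Q] (σ : V → Option C(Q, M)) (t : Q) (v : V) :
    ev σ t v = none ↔ σ v = none := by simp [ev]

structure Hty (F : Finset V) (X : Set (V → Option M))
    (c : (V → Option M) → Dl 1 → (V → Option M)) : Prop where
  pat : ∀ y ∈ X, ∀ u v, c y u v = none ↔ y v = none
  pk : ∀ y ∈ X, ∀ s ∈ F, y s ≠ none → ∀ u, c (park s y) u = park s (c y u)
  ini : ∀ y ∈ X, c y (vt 0) = y
  cl : PkCl F X
  cont : ∀ (n : ℕ) (σ : V → Option C(Dl n, M)), (∀ t, ev σ t ∈ X) →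
    ∃ τ : V → Option C(Dl n × Dl 1, M), ∀ q, ev τ q = c (ev σ q.1) q.2

open Classical in
def hat (c : (V → Option M) → Dl 1 → (V → Option M)) {n : ℕ} (σ : V → Option C(Dl n, M)) :
    V → Option C(Dl n × Dl 1, M) :=
  if h : ∃ τ : V → Option C(Dl n × Dl 1, M), ∀ q, ev τ q = c (ev σ q.1) q.2 then h.choose
  else pb ContinuousMap.fst σ

def HH (c : (V → Option M) → Dl 1 → (V → Option M)) : Ch V M →ₗ[ℚ] Ch V M :=
  Finsupp.linearCombination ℚ (fun σ => eps σ.2 •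
    ps (hat c σ.2) (σ.1 + 2) (pri (vt 0) (vt 1) (σ.1+1) (bs vt)))

def atE {n : ℕ} (e : Dl 1) : C(Dl n, Dl n × Dl 1) := (ContinuousMap.id _).prodMk (ContinuousMap.const _ e)

def PE (c : (V → Option M) → Dl 1 → (V → Option M)) : Ch V M →ₗ[ℚ] Ch V M :=
  Finsupp.linearCombination ℚ (fun σ => bs ⟨σ.1, pb (atE (vt 1)) (hat c σ.2)⟩)

lemma HH_bs (c : (V → Option M) → Dl 1 → (V → Option M)) {n : ℕ} (σ : V → Option C(Dl n, M)) :
    HH c (bs ⟨n, σ⟩) = eps σ • ps (hat c σ) (n + 2) (pri (vt 0) (vt 1) (n+1) (bs vt)) := by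
  simp [HH, bs]

lemma PE_bs (c : (V → Option M) → Dl 1 → (V → Option M)) {n : ℕ} (σ : V → Option C(Dl n, M)) :
    PE c (bs ⟨n, σ⟩) = bs ⟨n, pb (atE (vt 1)) (hat c σ)⟩ := by
  simp [PE, bs]

section
variable {F : Finset V} {X : Set (V → Option M)}
    {c : (V → Option M) → Dl 1 → (V → Option M)}

lemma Hty.ev_hat (h : Hty F X c) {n : ℕ} {σ : V → Option C(Dl n, M)} (hσ : ∀ t, ev σ t ∈ X) (q : Dl n × Dl 1) :
    ev (hat c σ) q = c (ev σ q.1) q.2 := by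
  have := h.cont n σ hσ
  rw [hat, dif_pos this]
  exact this.choose_spec q

lemma Hty.hat_none (h : Hty F X c) {n : ℕ} {σ : V → Option C(Dl n, M)} (hσ : ∀ t, ev σ t ∈ X) (v : V) :
    hat c σ v = none ↔ σ v = none := by
  rw [← ev_none _ (vt 0, vt 0), h.ev_hat hσ, h.pat _ (hσ _), ev_none]

lemma Hty.hat_eps (h : Hty F X c) {n : ℕ} {σ : V → Option C(Dl n, M)} (hσ : ∀ t, ev σ t ∈ X) :
    eps (hat c σ) = eps σ := by
  refine Finset.prod_congr rfl (fun v _ => ?_)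
  simp only [chi, h.hat_none hσ]

lemma Hty.hat_sgn (h : Hty F X c) {n : ℕ} {σ : V → Option C(Dl n, M)} (hσ : ∀ t, ev σ t ∈ X) (s : V) :
    sgn s (hat c σ) = sgn s σ := by
  refine Finset.prod_congr rfl (fun v _ => ?_)
  simp only [chi, h.hat_none hσ]

lemma Hty.hat_nopark (h : Hty F X c) {n : ℕ} {σ : V → Option C(Dl n, M)} (hσ : ∀ t, ev σ t ∈ X) :
    nopark (hat c σ) = nopark σ := by
  simp only [nopark, h.hat_none hσ]

lemma Hty.hat_pb (h : Hty F X c) {m n : ℕ} {σ : V → Option C(Dl n, M)} (hσ : ∀ t, ev σ t ∈ X) (f : C(Dl m, Dl n)) :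
    hat c (pb f σ) = pb (f.prodMap (ContinuousMap.id _)) (hat c σ) := by
  have : ∀ t, ev (pb f σ) t ∈ X := fun t => by rw [ev_pb]; exact hσ _
  refine ev_ext (fun t => ?_)
  rw [h.ev_hat this, ev_pb, ev_pb, h.ev_hat hσ]
  rfl

lemma Hty.hat_park (h : Hty F X c) {n : ℕ} {σ : V → Option C(Dl n, M)} (hσ : ∀ t, ev σ t ∈ X) {s : V} (hs : s ∈ F)
    (hn : σ s ≠ none) : hat c (park s σ) = park s (hat c σ) := by
  have : ∀ t, ev (park s σ) t ∈ X := fun t => by rw [← park_ev]; exact h.cl _ (hσ _) _ hs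
  refine ev_ext (fun t => ?_)
  rw [h.ev_hat this, ← park_ev, ← park_ev, h.ev_hat hσ, h.pk _ (hσ _) _ hs]
  rwa [Ne, ev_none]

lemma Hty.HH_ps (h : Hty F X c) {n : ℕ} {σ : V → Option C(Dl n, M)} (hσ : ∀ t, ev σ t ∈ X) (m : ℕ)
    (x : LC m (Dl n)) : HH c (ps σ m x) =
      eps σ • ps (hat c σ) (m+1) (pri (vt 0) (vt 1) m x) := by
  cases m with
  | zero => simp [ps, pri]
  | succ m =>
    refine lin_ext_apply (f := (HH c).comp (ps σ (m+1)))
      (g := eps σ • (ps (hat c σ) (m+2)).comp (pri (vt 0) (vt 1) (m+1))) (fun p => ?_) x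
    rw [LinearMap.comp_apply, LinearMap.smul_apply, LinearMap.comp_apply, ps_bs, HH_bs, eps_pb]
    congr 1
    change ps (hat c (pb (rl p) σ)) _ _ = _
    rw [h.hat_pb hσ, ps_lmap]
    · congr 1
      change lmap (Prod.map (rl p) id) _ = _
      rw [lmap_pri, lmap_bs]
      congr 2
      ext1 i
      simp
    · intro k q
      ext1 t
      exact Prod.ext (rl_rl p (fun i => (q i).1) t) rfl

lemma Hty.main (h : Hty F X c) {x : Ch V M} (hx : x ∈ sp (Al X)) :
    DD F (HH c x) + HH c (DD F x) = PE c x - x := by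
  have key : ((DD F).comp (HH c) + (HH c).comp (DD F) - PE c + LinearMap.id : Ch V M →ₗ[ℚ] Ch V M) x
      ∈ (⊥ : Submodule ℚ (Ch V M)) := by
    refine supp_map _ _ _ ?_ hx
    rintro ⟨n, σ⟩ hσ
    have hσ : ∀ t, ev σ t ∈ X := hσ
    rw [Submodule.mem_bot]
    simp only [LinearMap.add_apply, LinearMap.sub_apply, LinearMap.comp_apply, LinearMap.id_apply]
    have e1 : DD F (HH c (bs ⟨n, σ⟩)) = PE c (bs ⟨n, σ⟩) - bs ⟨n, σ⟩
        - ps (hat c σ) (n+1) (pri (vt 0) (vt 1) n (bd (bs vt)))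
        + ∑ s ∈ F, if σ s = none then 0 else (eps σ * sgn s σ) •
          ps (park s (hat c σ)) (n+2) (pri (vt 0) (vt 1) (n+1) (bs vt)) := by
      rw [HH_bs, map_smul, DD_apply, dd_ps, Ep_ps, PP_ps, h.hat_eps hσ, smul_add, smul_smul,
        eps_sq, one_smul, bd_pri, map_sub, map_sub]
      congr 1
      · congr 2
        · rw [lmap_bs, ps_bs, PE_bs]
          congr 3
          ext1 t
          exact Prod.ext (rl_id t) (dl_ext (fun j => by
            simp [Afn.re, atE, rl_apply, ← Finset.sum_mul]))
        · rw [lmap_bs, ps_bs]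
          congr 2
          refine ev_ext (fun t => ?_)
          rw [ev_pb, h.ev_hat hσ]
          have : (Afn.re (fun i => ((vt i : Dl n), (vt 0 : Dl 1))) t) = (t, vt 0) :=
            Prod.ext (rl_id t) (dl_ext (fun j => by
              simp [Afn.re, atE, rl_apply, ← Finset.sum_mul]))
          erw [this]
          rw [h.ini _ (hσ _)]
      · rw [Finset.smul_sum]
        refine Finset.sum_congr rfl (fun s _ => ?_)
        simp only [h.hat_none hσ, h.hat_sgn hσ]
        split_ifs
        · simp
        · rw [smul_smul]
    have e2 : HH c (DD F (bs ⟨n, σ⟩)) = ps (hat c σ) (n+1) (pri (vt 0) (vt 1) n (bd (bs vt)))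
        - ∑ s ∈ F, if σ s = none then 0 else (eps σ * sgn s σ) •
          ps (park s (hat c σ)) (n+2) (pri (vt 0) (vt 1) (n+1) (bs vt)) := by
      rw [DD_apply, dd_bs, Ep_ps, map_add, map_smul, h.HH_ps hσ, smul_smul, eps_sq, one_smul,
        sub_eq_add_neg, PP_bs, map_sum, ← Finset.sum_neg_distrib]
      congr 1
      refine Finset.sum_congr rfl (fun s hs => ?_)
      dsimp only
      split_ifs with hn
      · simp
      · rw [map_smul, HH_bs, h.hat_park hσ hs hn, eps_park _ _ hn, smul_smul, ← neg_smul]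
        congr 1
        ring
    rw [e1, e2]
    abel
  rw [Submodule.mem_bot] at key
  simp only [LinearMap.add_apply, LinearMap.sub_apply, LinearMap.comp_apply, LinearMap.id_apply] at key
  rw [← sub_eq_zero, ← key]
  abel

lemma Hty.HH_Al (h : Hty F X c) {Y Z : Set (V → Option M)} (hY : Y ⊆ X) (hc : ∀ y ∈ Y, ∀ u, c y u ∈ Z)
    {x : Ch V M} (hx : x ∈ sp (Al Y)) : HH c x ∈ sp (Al Z) := by
  refine supp_map _ _ _ ?_ hx
  rintro ⟨n, σ⟩ hσ
  rw [HH_bs]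
  refine Submodule.smul_mem _ _ (ps_Al _ _ _ _ (fun t => ?_))
  rw [h.ev_hat (fun t => hY (hσ t))]
  exact hc _ (hσ _) _

lemma Hty.PE_ev (h : Hty F X c) {n : ℕ} {σ : V → Option C(Dl n, M)} (hσ : ∀ t, ev σ t ∈ X) (t : Dl n) :
    ev (pb (atE (vt 1)) (hat c σ)) t = c (ev σ t) (vt 1) := by
  rw [ev_pb, h.ev_hat hσ]; rfl

lemma Hty.PE_Al (h : Hty F X c) {Y Z : Set (V → Option M)} (hY : Y ⊆ X) (hc : ∀ y ∈ Y, c y (vt 1) ∈ Z)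
    {x : Ch V M} (hx : x ∈ sp (Al Y)) : PE c x ∈ sp (Al Z) := by
  refine supp_map _ _ _ ?_ hx
  rintro ⟨n, σ⟩ hσ
  rw [PE_bs]
  refine supp_bs (fun t => ?_)
  rw [h.PE_ev (fun t => hY (hσ t))]
  exact hc _ (hσ _)

lemma Hty.HH_Gr (h : Hty F X c) {n : ℤ} {x : Ch V M} (hx : x ∈ sp (Al X)) (hg : x ∈ Gr n) :
    HH c x ∈ Gr (V := V) (M := M) (n+1) := by
  refine supp_map _ _ _ ?_ (sp_inter hx hg)
  rintro ⟨k, σ⟩ ⟨hσ, hd⟩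
  rw [HH_bs]
  refine Submodule.smul_mem _ _ ?_
  have hd : deg _ = n := hd
  convert ps_Gr (hat c σ) (k+2) _ using 2
  rw [← hd, deg, h.hat_nopark hσ]
  push_cast; ring

lemma Hty.acy (h : Hty F X c) {Y : Set (V → Option M)} (hY : Y ⊆ X) (hc : ∀ y ∈ X, ∀ u, c y u ∈ X)
    (hc' : ∀ y ∈ Y, ∀ u, c y u ∈ Y) (he : ∀ y ∈ X, c y (vt 1) ∈ Y) (n : ℤ) :
    Acy F ⊤ (Al X) (Al Y) n := by
  intro x _ hx hxn hDx
  refine ⟨- HH c x, trivial, Submodule.neg_mem _ (h.HH_Al le_rfl hc hx),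
    Submodule.neg_mem _ (h.HH_Gr hx hxn), ?_⟩
  have : x - DD F (- HH c x) = PE c x - HH c (DD F x) := by
    have := h.main hx
    rw [map_neg, sub_neg_eq_add, eq_sub_iff_add_eq, add_assoc, this]; abel
  rw [this]
  exact Submodule.sub_mem _ (h.PE_Al le_rfl he hx) (h.HH_Al hY hc' hDx)

end
end
end CFS

set_option linter.unusedSectionVars false
set_option linter.unusedSimpArgs false

namespace CFS
noncomputable section

variable {V M : Type} [TopologicalSpace M] [Fintype V] [LinearOrder V] [Inhabited M]

def fill (y : V → Option M) : V → M := fun v => (y v).getD default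

/-- the basic subsets -/
def XX (F : Finset V) (Γ : Set (V × V)) (W : Set (V → M)) : Set (V → Option M) :=
  {y | (∀ v, v ∉ F → y v ≠ none) ∧ (∀ a b, (a, b) ∈ Γ → ∀ m, y a = some m → y b ≠ some m) ∧
    fill y ∈ W}

def FInd (F : Finset V) (W : Set (V → M)) : Prop :=
  ∀ f g : V → M, (∀ v, v ∉ F → f v = g v) → f ∈ W → g ∈ W

lemma XX_mono (F : Finset V) (Γ : Set (V × V)) {W W' : Set (V → M)} (h : W ⊆ W') :
    XX F Γ W ⊆ XX F Γ W' := fun _ hy => ⟨hy.1, hy.2.1, h hy.2.2⟩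

lemma XX_anti (F : Finset V) {Γ Γ' : Set (V × V)} (W : Set (V → M)) (h : Γ ⊆ Γ') :
    XX F Γ' W ⊆ XX F Γ W := fun _ hy => ⟨hy.1, fun a b hab => hy.2.1 a b (h hab), hy.2.2⟩

lemma XX_inter (F : Finset V) (Γ : Set (V × V)) (W W' : Set (V → M)) :
    XX F Γ W ∩ XX F Γ W' = XX F Γ (W ∩ W') := by
  ext y
  exact ⟨fun h => ⟨h.1.1, h.1.2.1, h.1.2.2, h.2.2.2⟩,
    fun h => ⟨⟨h.1, h.2.1, h.2.2.1⟩, ⟨h.1, h.2.1, h.2.2.2⟩⟩⟩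

lemma XX_union (F : Finset V) (Γ : Set (V × V)) (W W' : Set (V → M)) :
    XX F Γ W ∪ XX F Γ W' = XX F Γ (W ∪ W') := by
  ext y
  simp only [XX, Set.mem_union, Set.mem_ofPred_eq]
  tauto

lemma XX_sUnion (F : Finset V) (Γ : Set (V × V)) (S : Set (Set (V → M))) :
    XX F Γ (⋃₀ S) = ⋃ W : S, XX F Γ W := by
  ext y
  simp only [XX, Set.mem_sUnion, Set.mem_ofPred_eq, Set.mem_iUnion]
  constructor
  · rintro ⟨h1, h2, W, hW, h3⟩
    exact ⟨⟨W, hW⟩, h1, h2, h3⟩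
  · rintro ⟨⟨W, hW⟩, h1, h2, h3⟩
    exact ⟨h1, h2, W, hW, h3⟩

lemma FInd.inter {F : Finset V} {W W' : Set (V → M)} (h : FInd F W) (h' : FInd F W') :
    FInd F (W ∩ W') := fun f g e hf => ⟨h f g e hf.1, h' f g e hf.2⟩
lemma FInd.union {F : Finset V} {W W' : Set (V → M)} (h : FInd F W) (h' : FInd F W') :
    FInd F (W ∪ W') := fun f g e hf => hf.imp (h f g e) (h' f g e)
lemma FInd.sUnion {F : Finset V} {S : Set (Set (V → M))} (h : ∀ W ∈ S, FInd F W) :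
    FInd F (⋃₀ S) := fun f g e ⟨W, hW, hf⟩ => ⟨W, hW, h W hW f g e hf⟩
lemma FInd_coord {F : Finset V} {b : V} (hb : b ∉ F) (U : Set M) :
    FInd F {f : V → M | f b ∈ U} := fun f g e hf => by
  have := e b hb
  change g b ∈ U
  rw [← this]; exact hf
lemma FInd.mono {F F' : Finset V} {W : Set (V → M)} (h : FInd F W) (hF : F' ⊆ F) : FInd F' W :=
  fun f g e hf => h f g (fun v hv => e v (fun hv' => hv (hF hv'))) hf

lemma fill_cont {Q : Type} [TopologicalSpace Q] (σ : V → Option C(Q, M)) :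
    Continuous (fun t => fill (ev σ t)) := by
  refine continuous_pi (fun v => ?_)
  unfold fill ev
  cases σ v with
  | none => exact continuous_const
  | some g => exact g.continuous

lemma XX_IsOp [T2Space M] (F : Finset V) (Γ : Set (V × V)) {W : Set (V → M)} (hW : IsOpen W) :
    IsOp (XX F Γ W) := by
  intro n σ
  have e : {t | ev σ t ∈ XX F Γ W} = {t : Dl n | ∀ v, v ∉ F → σ v ≠ none} ∩
      ((⋂ p : V × V, {t : Dl n | p ∈ Γ → ∀ m, ev σ t p.1 = some m → ev σ t p.2 ≠ some m}) ∩
      {t : Dl n | fill (ev σ t) ∈ W}) := by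
    ext t
    simp only [XX, Set.mem_ofPred_eq, Set.mem_inter_iff, Set.mem_iInter, Prod.forall, ne_eq, ev_none]
  rw [e]
  refine isOpen_const.inter ((isOpen_iInter_of_finite ?_).inter (hW.preimage (fill_cont σ)))
  rintro ⟨a, b⟩
  by_cases hp : (a, b) ∈ Γ
  · simp only [hp, forall_true_left]
    cases ha : σ a with
    | none => simp [ev, ha]
    | some f =>
      cases hb : σ b with
      | none => simp [ev, hb]
      | some g =>
        simp only [ev, ha, hb, Option.map_some, Option.some.injEq, forall_eq', ne_eq]
        exact isOpen_ne_fun g.continuous f.continuous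
  · simp [hp]

lemma XX_PkCl (F : Finset V) (Γ : Set (V × V)) {W : Set (V → M)} (hW : FInd F W) :
    PkCl F (XX F Γ W) := by
  rintro y ⟨h1, h2, h3⟩ s hs
  refine ⟨fun v hv => ?_, fun a b hab m hm hm' => ?_, hW _ _ (fun v hv => ?_) h3⟩
  · rw [park, Function.update_of_ne (fun h => hv (by rw [h]; exact hs))]
    exact h1 v hv
  · unfold park at hm hm'
    by_cases ha : a = s
    · subst ha; simp at hm
    by_cases hb : b = s
    · subst hb; simp at hm'
    rw [Function.update_of_ne ha] at hm
    rw [Function.update_of_ne hb] at hm'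
    exact h2 a b hab m hm hm'
  · rw [fill, fill, park, Function.update_of_ne (fun h => hv (by rw [h]; exact hs))]

/-- change of differential -/
lemma PP_sub (F F' : Finset V) (hF : F' ⊆ F) (x : Ch V M) : DD F x = DD F' x + PP (F \ F') x := by
  rw [DD_apply, DD_apply, add_assoc]
  congr 1
  have : (PP F : Ch V M →ₗ[ℚ] Ch V M) = PP F' + PP (F \ F') := by
    apply lin_ext
    intro σ
    rw [LinearMap.add_apply, PP_bs, PP_bs, PP_bs]
    exact ((add_comm _ _).trans (Finset.sum_sdiff hF)).symm
  rw [this]; rfl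

lemma transfer {F F' : Finset V} (hF : F' ⊆ F) {A A' B B' : Set (V → Option M)}
    (hA' : A' ⊆ A) (hBF : PkCl F B) (hA'F : PkCl F' A')
    (hcov : ∀ y ∈ A, y ∉ A' → y ∈ B)
    (hpat : ∀ y ∈ A, ∀ z ∈ A, (∀ v, y v = none ↔ z v = none) → y ∈ A' → z ∈ A')
    (hpk : ∀ y ∈ A', ∀ s ∈ F, s ∉ F' → park s y ∈ B)
    (hB' : B' = B ∩ A') {n : ℤ}
    (h : Acy F' ⊤ (Al A') (Al B') n) : Acy F ⊤ (Al A) (Al B) n := by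
  have hPP : ∀ x ∈ sp (Al A'), PP (F \ F') x ∈ sp (Al B) := by
    intro x hx
    refine supp_map _ _ _ ?_ hx
    rintro ⟨k, σ⟩ hσ
    rw [PP_bs]
    refine Submodule.sum_mem _ (fun s hs => ?_)
    split_ifs
    · exact Submodule.zero_mem _
    · refine Submodule.smul_mem _ _ (supp_bs (fun t => ?_))
      rw [← park_ev]
      rw [Finset.mem_sdiff] at hs
      exact hpk _ (hσ t) s hs.1 hs.2
  intro x _ hx hxn hDx
  have hsub : Al A ⊆ Al A' ∪ Al B := by
    rintro ⟨k, σ⟩ hσ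
    by_cases h0 : ev σ (vt 0) ∈ A'
    · left
      intro t
      exact hpat _ (hσ (vt 0)) _ (hσ t) (fun v => by simp only [ev_none]) h0
    · right
      intro t
      refine hcov _ (hσ t) (fun ht => h0 ?_)
      exact hpat _ (hσ t) _ (hσ (vt 0)) (fun v => by simp only [ev_none]) ht
  obtain ⟨x₁, -, x₂, -, hxe, hx₁, hx₂, hxD⟩ := split_sp hsub hx (Restr_top (Al A')) trivial
  have hg := hxD _ hxn
  have hD1 : DD F' x₁ ∈ sp (Al B') := by
    rw [hB']
    refine sp_Al_inter ?_ (DD_Al F' hA'F hx₁)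
    have : DD F' x₁ = DD F x - DD F x₂ - PP (F \ F') x₁ := by
      rw [hxe, map_add, PP_sub F F' hF x₁]; abel
    rw [this]
    exact Submodule.sub_mem _ (Submodule.sub_mem _ hDx (DD_Al F hBF hx₂)) (hPP _ hx₁)
  obtain ⟨y, -, hy, hyn, hxy⟩ := h x₁ trivial hx₁ hg.1 hD1
  refine ⟨y, trivial, Finsupp.supported_mono (Al_mono hA') hy, hyn, ?_⟩
  have : x - DD F y = (x₁ - DD F' y) + x₂ - PP (F \ F') y := by
    rw [hxe, PP_sub F F' hF y]; abel
  rw [this]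
  refine Submodule.sub_mem _ (Submodule.add_mem _ (Finsupp.supported_mono (Al_mono ?_) hxy) hx₂) (hPP _ hy)
  rw [hB']; exact Set.inter_subset_left

end
end CFS

set_option linter.unusedSectionVars false
set_option linter.unusedSimpArgs false

namespace CFS
noncomputable section

variable {V M : Type} [TopologicalSpace M] [Fintype V] [LinearOrder V]

def unp {Q : Type} [TopologicalSpace Q] (s : V) (p : M) (σ : V → Option C(Q, M)) :
    V → Option C(Q, M) := Function.update σ s (some (ContinuousMap.const _ p))

lemma unp_pb {Q R : Type} [TopologicalSpace Q] [TopologicalSpace R] (s : V) (p : M) (f : C(Q, R))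
    (σ : V → Option C(R, M)) : unp s p (pb f σ) = pb f (unp s p σ) := by
  funext v
  by_cases h : v = s
  · subst h; simp [unp, pb]
  · simp [unp, pb, Function.update_of_ne h]

lemma ev_unp {Q : Type} [TopologicalSpace Q] (s : V) (p : M) (σ : V → Option C(Q, M)) (t : Q) :
    ev (unp s p σ) t = Function.update (ev σ t) s (some p) := by
  funext v
  by_cases h : v = s
  · subst h; simp [unp, ev]
  · simp [unp, ev, Function.update_of_ne h]

lemma park_unp {Q : Type} [TopologicalSpace Q] (s : V) (p : M) {σ : V → Option C(Q, M)}
    (h : σ s = none) : park s (unp s p σ) = σ := by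
  simp [park, unp, ← h]

lemma unp_s {Q : Type} [TopologicalSpace Q] (s : V) (p : M) (σ : V → Option C(Q, M)) :
    unp s p σ s ≠ none := by simp [unp]

lemma unp_ne {Q : Type} [TopologicalSpace Q] {s t : V} (p : M) (σ : V → Option C(Q, M))
    (h : t ≠ s) : unp s p σ t = σ t := Function.update_of_ne h _ _

def Kop (s : V) (p : M) : Ch V M →ₗ[ℚ] Ch V M :=
  Finsupp.linearCombination ℚ (fun σ => if σ.2 s = none then
    sgn s σ.2 • bs ⟨σ.1, unp s p σ.2⟩ else 0)

lemma Kop_bs (s : V) (p : M) {n : ℕ} (σ : V → Option C(Dl n, M)) :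
    Kop s p (bs ⟨n, σ⟩) = if σ s = none then sgn s σ • bs ⟨n, unp s p σ⟩ else 0 := by
  simp [Kop, bs]

lemma Kop_ps (s : V) (p : M) {n : ℕ} (σ : V → Option C(Dl n, M)) (m : ℕ) (x : LC m (Dl n)) :
    Kop s p (ps σ m x) = if σ s = none then sgn s σ • ps (unp s p σ) m x else 0 := by
  cases m with
  | zero => simp [ps]
  | succ m =>
    have := lin_ext_apply (f := (Kop s p).comp (ps σ (m+1)))
      (g := if σ s = none then sgn s σ • ps (unp s p σ) (m+1) else 0) (fun l => ?_) x
    · rw [LinearMap.comp_apply] at this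
      rw [this]
      split_ifs <;> simp
    · rw [LinearMap.comp_apply, ps_bs, Kop_bs]
      simp only [pb_none]
      split_ifs
      · rw [LinearMap.smul_apply, ps_bs, sgn_pb, unp_pb]
      · simp

lemma Kop_main {F : Finset V} {s : V} (hs : s ∈ F) (p : M) {n : ℕ} (σ : V → Option C(Dl n, M))
    (hσ : σ s = none ∨ σ s = some (ContinuousMap.const _ p)) :
    DD F (Kop s p (bs ⟨n, σ⟩)) + Kop s p (DD F (bs ⟨n, σ⟩)) = bs ⟨n, σ⟩ := by
  rcases hσ with h | h
  · have he : eps σ = - eps (unp s p σ) := by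
      conv_lhs => rw [← park_unp s p h]
      exact eps_park _ _ (unp_s s p σ)
    have hsg : ∀ t, sgn t σ = (if s < t then -1 else 1) * sgn t (unp s p σ) := by
      intro t
      conv_lhs => rw [← park_unp s p h]
      exact sgn_park _ _ _ (unp_s s p σ)
    have e1 : Kop s p (bs ⟨n, σ⟩) = sgn s σ • bs ⟨n, unp s p σ⟩ := by rw [Kop_bs, if_pos h]
    rw [e1, DD_apply, map_smul, dd_bs, map_smul, Ep_ps, DD_apply, map_add, dd_bs, Ep_ps,
      map_smul, map_smul, Kop_ps, if_pos h, PP_bs, PP_bs, map_sum]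
    have e2 : (sgn s σ • eps (unp s p σ) • ps (unp s p σ) n (bd (bs vt)) : Ch V M)
        = - (eps σ • sgn s σ • ps (unp s p σ) n (bd (bs vt))) := by
      rw [he, smul_smul, smul_smul, ← neg_smul]; congr 1; ring
    rw [e2]
    have e3 : (sgn s σ • ∑ t ∈ F, if unp s p σ t = none then 0 else
          sgn t (unp s p σ) • bs (⟨n, park t (unp s p σ)⟩ : Sim V M)) +
        ∑ t ∈ F, Kop s p (if σ t = none then 0 else sgn t σ • bs (⟨n, park t σ⟩ : Sim V M))
        = bs ⟨n, σ⟩ := by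
      rw [Finset.smul_sum, ← Finset.sum_add_distrib, Finset.sum_eq_single s]
      · rw [if_neg (unp_s s p σ), if_pos h, map_zero, add_zero, smul_smul, park_unp s p h]
        have := hsg s
        rw [if_neg (lt_irrefl s), one_mul] at this
        rw [← this, sgn_sq, one_smul]
      · intro t _ hts
        rw [unp_ne p σ hts]
        split_ifs with ht
        · simp
        · have h1 : park t σ s = none := by
            rw [park, Function.update_of_ne (Ne.symm hts)]; exact h
          have h2 : park t (unp s p σ) = unp s p (park t σ) := by
            exact Function.update_comm (Ne.symm hts) _ _ _
          rw [map_smul, Kop_bs, if_pos h1, h2, smul_smul, smul_smul, ← add_smul, sgn_park _ _ _ ht,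
            hsg t]
          convert zero_smul ℚ _
          rcases lt_or_gt_of_ne hts with h3 | h3
          · rw [if_pos h3, if_neg (asymm h3)]; ring
          · rw [if_pos h3, if_neg (asymm h3)]; ring
      · intro h'; exact absurd hs h'
    dsimp only at e3 ⊢
    rw [← e3]
    abel
  · have h0 : σ s ≠ none := by rw [h]; simp
    have e1 : Kop s p (bs ⟨n, σ⟩) = 0 := by rw [Kop_bs, if_neg h0]
    rw [e1, map_zero, zero_add, DD_apply, map_add, dd_bs, Ep_ps, map_smul, Kop_ps, if_neg h0,
      smul_zero, zero_add, PP_bs, map_sum, Finset.sum_eq_single s]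
    · have h1 : park s σ s = none := by simp [park]
      dsimp only
      rw [if_neg h0, map_smul, Kop_bs, if_pos h1, smul_smul, sgn_park _ _ _ h0, if_neg (lt_irrefl s),
        one_mul, sgn_sq, one_smul]
      congr 2
      simp [unp, park, ← h]
    · intro t _ hts
      dsimp only
      split_ifs with ht
      · simp
      · have h1 : park t σ s ≠ none := by
          rw [park, Function.update_of_ne (Ne.symm hts)]; exact h0
        rw [map_smul, Kop_bs, if_neg h1, smul_zero]
    · intro h'; exact absurd hs h'

lemma unpark_acy {F : Finset V} {s : V} (hs : s ∈ F) (p : M) {C : Set (V → Option M)}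
    (h1 : ∀ y ∈ C, y s = none ∨ y s = some p) (h2 : ∀ y ∈ C, Function.update y s (some p) ∈ C)
    (n : ℤ) : Acy F ⊤ (Al C) ∅ n := by
  intro x _ hx hxn hDx
  have hDx0 : DD F x = 0 := by simpa [sp] using hDx
  refine ⟨Kop s p x, trivial, ?_, ?_, ?_⟩
  · refine supp_map _ _ _ ?_ hx
    rintro ⟨k, σ⟩ hσ
    rw [Kop_bs]
    split_ifs
    · refine Submodule.smul_mem _ _ (supp_bs (fun t => ?_))
      rw [ev_unp]
      exact h2 _ (hσ t)
    · exact Submodule.zero_mem _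
  · refine supp_map _ _ _ ?_ hxn
    rintro ⟨k, σ⟩ hσ
    rw [Kop_bs]
    split_ifs with h
    · refine Submodule.smul_mem _ _ (supp_bs ?_)
      have hσ : deg _ = n := hσ
      change deg _ = _
      rw [← hσ, deg, deg]
      have := nopark_park s _ (unp_s s p σ)
      rw [park_unp s p h] at this
      rw [this]; push_cast; ring
    · exact Submodule.zero_mem _
  · have key : ((DD F).comp (Kop s p) + (Kop s p).comp (DD F) - LinearMap.id :
        Ch V M →ₗ[ℚ] Ch V M) x ∈ (⊥ : Submodule ℚ (Ch V M)) := by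
      refine supp_map _ _ _ ?_ hx
      rintro ⟨k, σ⟩ hσ
      rw [Submodule.mem_bot]
      simp only [LinearMap.add_apply, LinearMap.sub_apply, LinearMap.comp_apply, LinearMap.id_apply]
      rw [Kop_main hs p σ, sub_self]
      by_cases hn : σ s = none
      · exact Or.inl hn
      · right
        obtain ⟨g, hg⟩ := Option.ne_none_iff_exists'.1 hn
        rw [hg]
        congr 1
        ext t
        rcases h1 _ (hσ t) with h | h
        · simp [ev, hg] at h
        · simpa [ev, hg] using h
    rw [Submodule.mem_bot] at key
    simp only [LinearMap.add_apply, LinearMap.sub_apply, LinearMap.comp_apply, LinearMap.id_apply,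
      hDx0, map_zero, add_zero] at key
    rw [← neg_sub, key, neg_zero]
    exact Submodule.zero_mem _

/-- contractible open sets -/
def CBall (B : Set M) : Prop := IsOpen B ∧ ∀ p ∈ B, ∃ h : M → ℝ → M,
  ContinuousOn (Function.uncurry h) (B ×ˢ Set.Icc 0 1) ∧ (∀ x ∈ B, h x 0 = x) ∧
  (∀ x ∈ B, h x 1 = p) ∧ (∀ u ∈ Set.Icc (0:ℝ) 1, h p u = p) ∧
  (∀ x ∈ B, ∀ u ∈ Set.Icc (0:ℝ) 1, h x u ∈ B)

lemma dl_mem (u : Dl 1) : u.1 1 ∈ Set.Icc (0:ℝ) 1 := by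
  refine ⟨u.2.1 1, ?_⟩
  rw [← u.2.2]
  exact Finset.single_le_sum (f := u.1) (fun i _ => u.2.1 i) (Finset.mem_univ 1)

lemma vt_val (i j : Fin 2) : (vt i : Dl 1).1 j = if i = j then 1 else 0 := by
  have : (vt i : Dl 1).1 = (Pi.single i 1 : Fin 2 → ℝ) := by
    ext k; exact vt_apply i k |>.trans (by simp [Pi.single_apply, eq_comm])
  rw [this]; simp [Pi.single_apply, eq_comm]

variable [Inhabited M]

/-- isolated vertex -/
def Iso (Γ : Set (V × V)) (b : V) : Prop := ∀ a c, (a, c) ∈ Γ → a ≠ b ∧ c ≠ b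

def BInd (b : V) (W : Set (V → M)) : Prop := ∀ f ∈ W, ∀ x, Function.update f b x ∈ W

lemma HI {F : Finset V} {Γ : Set (V × V)} {b : V} (hb : b ∉ F) (hΓ : Iso Γ b)
    {W : Set (V → M)} (hWF : FInd F W) (hWb : BInd b W) {B : Set M} (hB : CBall B) {p : M}
    (hp : p ∈ B) (n : ℤ) :
    Acy F ⊤ (Al (XX F Γ (W ∩ {f | f b ∈ B}))) (Al (XX F Γ (W ∩ {f | f b = p}))) n := by
  obtain ⟨hBo, hBc⟩ := hB
  obtain ⟨h, hc, h0, h1, hpp, hm⟩ := hBc p hp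
  let c : (V → Option M) → Dl 1 → (V → Option M) := fun y u =>
    Function.update y b ((y b).map (fun x => h x (u.1 1)))
  have hcb : ∀ y u x, y b = some x → c y u = Function.update y b (some (h x (u.1 1))) := by
    intro y u x hx
    simp [c, hx]
  have stay : ∀ (S : Set M) y, y ∈ XX F Γ (W ∩ {f | f b ∈ S}) →
      ∀ x (u : Dl 1), y b = some x → ∀ S' : Set M, h x (u.1 1) ∈ S' →
      c y u ∈ XX F Γ (W ∩ {f | f b ∈ S'}) := by
    rintro S y ⟨y1, y2, y3, y4⟩ x u hx S' hS'
    rw [hcb y u x hx]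
    refine ⟨fun v hv => ?_, fun a e hae m hma hme => ?_, ?_, ?_⟩
    · by_cases hvb : v = b
      · subst hvb; simp
      · rw [Function.update_of_ne hvb]; exact y1 v hv
    · obtain ⟨ha, he⟩ := hΓ a e hae
      rw [Function.update_of_ne ha] at hma
      rw [Function.update_of_ne he] at hme
      exact y2 a e hae m hma hme
    · have : fill (Function.update y b (some (h x (u.1 1)))) =
          Function.update (fill y) b (h x (u.1 1)) := by
        funext v
        by_cases hvb : v = b
        · subst hvb; simp [fill]
        · simp [fill, Function.update_of_ne hvb]
      rw [this]
      exact hWb _ y3 _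
    · change fill _ b ∈ S'
      simpa [fill] using hS'
  have val : ∀ (S : Set M) y, y ∈ XX F Γ (W ∩ {f | f b ∈ S}) → ∃ x ∈ S, y b = some x := by
    rintro S y ⟨y1, y2, y3, y4⟩
    obtain ⟨x, hx⟩ := Option.ne_none_iff_exists'.1 (y1 b hb)
    refine ⟨x, ?_, hx⟩
    have : fill y b ∈ S := y4
    simpa [fill, hx] using this
  have hX : Hty F (XX F Γ (W ∩ {f | f b ∈ B})) c := by
    refine ⟨fun y hy u v => ?_, fun y hy s hs hn u => ?_, fun y hy => ?_,
      XX_PkCl F Γ (hWF.inter (FInd_coord hb B)), fun n σ hσ => ?_⟩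
    · obtain ⟨x, hxB, hx⟩ := val B y hy
      rw [hcb y u x hx]
      by_cases hvb : v = b
      · subst hvb; simp [hx]
      · rw [Function.update_of_ne hvb]
    · have hsb : s ≠ b := fun e => hb (by rw [← e]; exact hs)
      have : park s y b = y b := Function.update_of_ne (Ne.symm hsb) _ _
      simp only [c, this]
      exact Function.update_comm hsb _ _ _
    · obtain ⟨x, hxB, hx⟩ := val B y hy
      rw [hcb y _ x hx, vt_val]
      simp only [zero_ne_one, if_false, h0 x hxB]
      rw [← hx, Function.update_eq_self]
    · obtain ⟨g, hg⟩ : ∃ g, σ b = some g := Option.ne_none_iff_exists'.1 (fun hn => by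
        obtain ⟨x, -, hx⟩ := val B _ (hσ (vt 0))
        simp [ev, hn] at hx)
      have hgB : ∀ t, g t ∈ B := by
        intro t
        obtain ⟨x, hxB, hx⟩ := val B _ (hσ t)
        simp only [ev, hg, Option.map_some, Option.some.injEq] at hx
        rw [hx]; exact hxB
      have hcont : Continuous (fun q : Dl n × Dl 1 => h (g q.1) (q.2.1 1)) := by
        have := hc.comp_continuous (f := fun q : Dl n × Dl 1 => (g q.1, q.2.1 1))
          ((g.continuous.comp continuous_fst).prodMk
            ((continuous_apply 1).comp (continuous_subtype_val.comp continuous_snd))) (fun q => ⟨hgB _, dl_mem _⟩)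
        exact this
      refine ⟨Function.update (pb ContinuousMap.fst σ) b (some ⟨_, hcont⟩), fun q => ?_⟩
      rw [hcb _ q.2 (g q.1) (by simp [ev, hg])]
      funext v
      by_cases hvb : v = b
      · subst hvb; simp [ev]
      · simp [ev, pb, Function.update_of_ne hvb, Function.comp_def]
  have e : (W ∩ {f : V → M | f b = p}) = W ∩ {f | f b ∈ ({p} : Set M)} := rfl
  rw [e]
  refine hX.acy (XX_mono _ _ ?_) (fun y hy u => ?_) (fun y hy u => ?_) (fun y hy => ?_) n
  · rintro f ⟨f1, f2⟩
    refine ⟨f1, ?_⟩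
    have f2 : f b = p := f2
    change f b ∈ B
    rw [f2]; exact hp
  · obtain ⟨x, hxB, hx⟩ := val B y hy
    exact stay B y hy x u hx B (hm x hxB _ (dl_mem u))
  · obtain ⟨x, hxB, hx⟩ := val _ y hy
    refine stay _ y hy x u hx _ ?_
    have : x = p := hxB
    rw [this]
    exact hpp _ (dl_mem u)
  · obtain ⟨x, hxB, hx⟩ := val B y hy
    refine stay B y hy x _ hx _ ?_
    rw [vt_val]
    simp [h1 x hxB]

end
end CFS

set_option linter.unusedSectionVars false
set_option linter.unusedSimpArgs false

namespace CFS
noncomputable section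

lemma LTG {α : Type} [TopologicalSpace α] (Φ : Set α → Prop) (𝓑 : Set (Set α))
    (hop : ∀ B ∈ 𝓑, IsOpen B) (hcap : ∀ B ∈ 𝓑, ∀ B' ∈ 𝓑, B ∩ B' ∈ 𝓑) (h0 : Φ ∅)
    (hΦ : ∀ B ∈ 𝓑, Φ B)
    (hmv : ∀ U U', IsOpen U → IsOpen U' → Φ U → Φ U' → Φ (U ∩ U') → Φ (U ∪ U'))
    (hdir : ∀ S : Set (Set α), S.Nonempty → DirectedOn (· ⊆ ·) S → (∀ U ∈ S, IsOpen U) →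
      (∀ U ∈ S, Φ U) → Φ (⋃₀ S))
    (U : Set α) (hU : ∀ x ∈ U, ∃ B ∈ 𝓑, x ∈ B ∧ B ⊆ U) : Φ U := by
  have fin : ∀ n (L : Fin n → Set α), (∀ i, L i ∈ 𝓑) → Φ (⋃ i, L i) := by
    intro n
    induction n with
    | zero => intro L _; simpa using h0
    | succ n ih =>
      intro L hL
      have e : (⋃ i, L i) = (⋃ i : Fin n, L i.castSucc) ∪ L (Fin.last n) := by
        ext x
        simp only [Set.mem_iUnion, Set.mem_union]
        constructor
        · rintro ⟨i, hi⟩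
          induction i using Fin.lastCases with
          | last => exact Or.inr hi
          | cast i => exact Or.inl ⟨i, hi⟩
        · rintro (⟨i, hi⟩ | h)
          · exact ⟨_, hi⟩
          · exact ⟨_, h⟩
      rw [e]
      refine hmv _ _ (isOpen_iUnion (fun i => hop _ (hL _))) (hop _ (hL _)) (ih _ (fun i => hL _))
        (hΦ _ (hL _)) ?_
      rw [Set.iUnion_inter]
      exact ih _ (fun i => hcap _ (hL _) _ (hL _))
  let S : Set (Set α) := {O | ∃ n, ∃ L : Fin n → Set α, (∀ i, L i ∈ 𝓑) ∧ (∀ i, L i ⊆ U) ∧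
    O = ⋃ i, L i}
  have hS : U = ⋃₀ S := by
    apply Set.Subset.antisymm
    · intro x hx
      obtain ⟨B, hB, hxB, hBU⟩ := hU x hx
      exact ⟨B, ⟨1, fun _ => B, fun _ => hB, fun _ => hBU, (Set.iUnion_const B).symm⟩, hxB⟩
    · rintro x ⟨O, ⟨n, L, hL, hLU, rfl⟩, hx⟩
      obtain ⟨i, hi⟩ := Set.mem_iUnion.1 hx
      exact hLU i hi
  rw [hS]
  refine hdir S ⟨∅, 0, fun _ => ∅, fun i => i.elim0, fun i => i.elim0, by simp⟩ ?_ ?_ ?_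
  · rintro _ ⟨n, L, hL, hLU, rfl⟩ _ ⟨n', L', hL', hLU', rfl⟩
    refine ⟨_, ⟨n + n', Fin.append L L', fun i => ?_, fun i => ?_, rfl⟩, ?_, ?_⟩
    · induction i using Fin.addCases with
      | left i => rw [Fin.append_left]; exact hL i
      | right i => rw [Fin.append_right]; exact hL' i
    · induction i using Fin.addCases with
      | left i => rw [Fin.append_left]; exact hLU i
      | right i => rw [Fin.append_right]; exact hLU' i
    · intro x hx
      obtain ⟨i, hi⟩ := Set.mem_iUnion.1 hx
      exact Set.mem_iUnion.2 ⟨Fin.castAdd n' i, by rwa [Fin.append_left]⟩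
    · intro x hx
      obtain ⟨i, hi⟩ := Set.mem_iUnion.1 hx
      exact Set.mem_iUnion.2 ⟨Fin.natAdd n i, by rwa [Fin.append_right]⟩
  · rintro _ ⟨n, L, hL, hLU, rfl⟩
    exact isOpen_iUnion (fun i => hop _ (hL _))
  · rintro _ ⟨n, L, hL, hLU, rfl⟩
    exact fin n L hL

variable {V M : Type} [TopologicalSpace M] [Fintype V] [LinearOrder V] [Inhabited M] [T2Space M]

/-- directed unions of relative acyclicity -/
lemma acy_directed {F : Finset V} {Γ : Set (V × V)} {C : Set (Sim V M)} {n : ℤ}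
    {N : Submodule ℚ (Ch V M)}
    {S : Set (Set (V → M))} (hne : S.Nonempty) (hd : DirectedOn (· ⊆ ·) S) (ho : ∀ U ∈ S, IsOpen U)
    (h : ∀ U ∈ S, Acy F N (Al (XX F Γ U)) C n) : Acy F N (Al (XX F Γ (⋃₀ S))) C n := by
  intro x hxN hx hxn hDx
  rw [XX_sUnion] at hx
  have : Nonempty S := hne.to_subtype
  obtain ⟨⟨U, hU⟩, hxU⟩ := directed_sp (fun W : S => XX F Γ W.1) (fun W => XX_IsOp F Γ (ho W.1 W.2))
    (by
      rintro ⟨U, hU⟩ ⟨U', hU'⟩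
      obtain ⟨U'', hU'', h1, h2⟩ := hd U hU U' hU'
      exact ⟨⟨U'', hU''⟩, XX_mono _ _ h1, XX_mono _ _ h2⟩) hx
  obtain ⟨y, hyN, hy, hyn, hxy⟩ := h U hU x hxN hxU hxn hDx
  exact ⟨y, hyN, Finsupp.supported_mono (Al_mono (XX_mono _ _ (Set.subset_sUnion_of_mem hU))) hy, hyn, hxy⟩

def CBase (M : Type) [TopologicalSpace M] : Prop := ∀ (x : M) (U : Set M), IsOpen U → x ∈ U →
  ∃ B, CBall B ∧ x ∈ B ∧ B ⊆ U

lemma gain (hcb : CBase M) {F : Finset V} {Γ : Set (V × V)} {b : V} (hb : b ∉ F) (hΓ : Iso Γ b)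
    {q : ℤ} (hq : ∀ W : Set (V → M), IsOpen W → FInd F W → ∀ n < q, Acy F ⊤ (Al (XX F Γ W)) ∅ n)
    {E : Set (V → M)} (hE : IsOpen E) (hEF : FInd F E) {p : M} {Bp : Set M} (hBp : CBall Bp)
    (hpB : p ∈ Bp) (G0 : ∀ f ∈ E, ∀ x ∈ Bp, Function.update f b x ∈ E)
    (G2 : ∀ f ∈ E, JoinedIn {x | Function.update f b x ∈ E} p (f b)) :
    ∀ n < q + 1, Acy F ⊤ (Al (XX F Γ E)) (Al (XX F Γ (E ∩ {f | f b = p}))) n := by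
  have hD : StD F (⊤ : Submodule ℚ (Ch V M)) := fun _ _ => trivial
  let S : Set (Set (V → M)) := {O | IsOpen O ∧ FInd F O ∧ O ⊆ E ∧ E ∩ {f | f b ∈ Bp} ⊆ O ∧
    ∀ n < q + 1, Acy F ⊤ (Al (XX F Γ O)) (Al (XX F Γ (E ∩ {f | f b = p}))) n}
  have hbo : ∀ B : Set M, IsOpen B → IsOpen {f : V → M | f b ∈ B} := fun B hB =>
    hB.preimage (continuous_apply b)
  have start : E ∩ {f | f b ∈ Bp} ∈ S := by
    refine ⟨hE.inter (hbo _ hBp.1), hEF.inter (FInd_coord hb _), Set.inter_subset_left, le_rfl, ?_⟩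
    intro n _
    let W' : Set (V → M) := {f | Function.update f b p ∈ E}
    have e1 : E ∩ {f | f b ∈ Bp} = W' ∩ {f | f b ∈ Bp} := by
      ext f
      refine and_congr_left (fun hf => ⟨fun h => G0 f h p hpB, fun h => ?_⟩)
      have := G0 _ h (f b) hf
      simpa using this
    have e2 : E ∩ {f | f b = p} = W' ∩ {f | f b = p} := by
      ext f
      refine and_congr_left (fun hf => ⟨fun h => G0 f h p hpB, fun h => ?_⟩)
      have hf : f b = p := hf
      have := G0 _ h p hpB
      rw [← hf] at this
      simpa using this
    rw [e1, e2]
    refine HI hb hΓ ?_ ?_ hBp hpB n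
    · intro f g hfg hf
      refine hEF _ _ (fun v hv => ?_) hf
      by_cases hvb : v = b
      · subst hvb; simp
      · simp [Function.update_of_ne hvb, hfg v hv]
    · intro f hf x
      change Function.update (Function.update f b x) b p ∈ E
      rw [Function.update_idem]
      exact hf
  obtain ⟨O, hO1, hO2⟩ := zorn_subset_nonempty S (by
    intro c hcS hc hne
    refine ⟨⋃₀ c, ⟨isOpen_sUnion (fun U hU => (hcS hU).1), FInd.sUnion (fun U hU => (hcS hU).2.1),
      Set.sUnion_subset (fun U hU => (hcS hU).2.2.1), ?_, ?_⟩, fun s hs => Set.subset_sUnion_of_mem hs⟩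
    · obtain ⟨U, hU⟩ := hne
      exact (hcS hU).2.2.2.1.trans (Set.subset_sUnion_of_mem hU)
    · intro n hn
      exact acy_directed hne hc.directedOn (fun U hU => (hcS hU).1)
        (fun U hU => (hcS hU).2.2.2.2 n hn)) _ start
  obtain ⟨hOS, hOmax⟩ := hO2
  obtain ⟨hOo, hOF, hOE, hOst, hOacy⟩ := hOS
  suffices h : E ⊆ O by
    have : O = E := Set.Subset.antisymm hOE h
    rw [← this]
    rw [← this] at hOacy
    exact hOacy
  intro f hf
  by_contra hfO
  obtain ⟨γ, hγ⟩ := G2 f hf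
  -- first exit point
  let T : Set unitInterval := {t | Function.update f b (γ t) ∉ O}
  have hupc : Continuous (fun t : unitInterval => Function.update f b (γ t)) :=
    continuous_const.update b γ.continuous
  have hTc : IsClosed T := (hOo.isClosed_compl).preimage hupc
  have hTn : T.Nonempty := ⟨1, by simpa [T] using hfO⟩
  obtain ⟨ts, hts⟩ := hTc.isCompact.exists_isLeast hTn
  have h0T : (0 : unitInterval) ∉ T := by
    intro h
    apply h
    apply hOst
    refine ⟨?_, ?_⟩
    · exact hγ 0
    · simpa using hpB
  have hts0 : 0 < ts := lt_of_le_of_ne (unitInterval.nonneg' ) (fun e => h0T (e ▸ hts.1))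
  have hlt : ∀ t < ts, Function.update f b (γ t) ∈ O := by
    intro t ht
    by_contra h
    exact absurd (hts.2 h) (not_le.2 ht)
  set g := Function.update f b (γ ts) with hg
  have hgE : g ∈ E := hγ ts
  obtain ⟨u, hu, hpu⟩ := isOpen_pi_iff'.1 hE g hgE
  obtain ⟨B', hB', hgB', hB'u⟩ := hcb (γ ts) (u b) (hu b).1 (by simpa [hg] using (hu b).2)
  -- nearby earlier time
  obtain ⟨t', ht's, ht'B⟩ : ∃ t' < ts, γ t' ∈ B' := by
    have hnb : γ ⁻¹' B' ∈ nhds ts := (hB'.1.preimage γ.continuous).mem_nhds hgB'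
    obtain ⟨l, hl, hl2⟩ := exists_Ioc_subset_of_mem_nhds hnb ⟨0, hts0⟩
    obtain ⟨t', h1, h2⟩ := exists_between hl
    exact ⟨t', h2, hl2 ⟨h1, h2.le⟩⟩
  obtain ⟨u', hu', hpu'⟩ := isOpen_pi_iff'.1 hOo _ (hlt t' ht's)
  let W : Set (V → M) := {h | ∀ v, v ∉ F → v ≠ b → h v ∈ u v ∩ u' v}
  have hWo : IsOpen W := by
    have : W = ⋂ v, {h : V → M | v ∉ F → v ≠ b → h v ∈ u v ∩ u' v} := by
      ext h; simp [W]
    rw [this]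
    refine isOpen_iInter_of_finite (fun v => ?_)
    by_cases h1 : v ∈ F
    · simp [h1]
    · by_cases h2 : v = b
      · simp [h2]
      · simp only [h1, h2, not_false_eq_true, ne_eq, forall_true_left]
        exact ((hu v).1.inter (hu' v).1).preimage (continuous_apply v)
  have hWF : FInd F W := fun h h' e hh v hv hvb => by rw [← e v hv]; exact hh v hv hvb
  have hWb : BInd b W := fun h hh x v hv hvb => by
    rw [Function.update_of_ne hvb]; exact hh v hv hvb
  let O' := W ∩ {h | h b ∈ B'}
  have hO'o : IsOpen O' := hWo.inter (hbo _ hB'.1)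
  have hO'F : FInd F O' := hWF.inter (FInd_coord hb _)
  have hO'E : O' ⊆ E := by
    rintro h ⟨h1, h2⟩
    refine hEF (fun v => if v ∈ F then g v else h v) h (fun v hv => by simp [hv]) (hpu ?_)
    intro v _
    by_cases hv : v ∈ F
    · simpa [hv] using (hu v).2
    · simp only [hv, if_false]
      by_cases hvb : v = b
      · subst hvb; exact hB'u h2
      · exact (h1 v hv hvb).1
  let C : Set (V → M) := W ∩ {h | h b = γ t'}
  have hCO : C ⊆ O := by
    rintro h ⟨h1, h2⟩
    have h2 : h b = γ t' := h2
    refine hOF (fun v => if v ∈ F then (Function.update f b (γ t')) v else h v) h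
      (fun v hv => by simp [hv]) (hpu' ?_)
    intro v _
    by_cases hv : v ∈ F
    · simpa only [hv, if_true] using (hu' v).2
    · simp only [hv, if_false]
      by_cases hvb : v = b
      · subst hvb
        have := (hu' v).2
        rw [Function.update_self] at this
        rw [h2]; exact this
      · exact (h1 v hv hvb).2
  have hCO' : C ⊆ O' := by
    rintro h ⟨h1, h2⟩
    refine ⟨h1, ?_⟩
    have h2 : h b = γ t' := h2
    change h b ∈ B'
    rw [h2]; exact ht'B
  have a0 : ∀ n, Acy F ⊤ (Al (XX F Γ O')) (Al (XX F Γ C)) n := fun n => HI hb hΓ hWF hWb hB' ht'B n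
  have s1 : Al (XX F Γ C) ⊆ Al (XX F Γ O') := Al_mono (XX_mono _ _ hCO')
  have s2 : Al (XX F Γ C) ⊆ Al (XX F Γ (O' ∩ O)) := Al_mono (XX_mono _ _ (Set.subset_inter hCO' hCO))
  have s3 : Al (XX F Γ (O' ∩ O)) ⊆ Al (XX F Γ O') := Al_mono (XX_mono _ _ Set.inter_subset_left)
  have a1 : ∀ n < q, Acy F ⊤ (Al (XX F Γ C)) ∅ n := fun n hn =>
    acy3 hD s1 (Set.empty_subset _) (hq O' hO'o hO'F n hn) (a0 _)
  have a2 : ∀ n < q, Acy F ⊤ (Al (XX F Γ (O' ∩ O))) (Al (XX F Γ C)) n := fun n hn =>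
    acy2 hD s2 (Set.empty_subset _) (hq _ (hO'o.inter hOo) (hO'F.inter hOF) n hn) (a1 _ (by lia))
  have a3 : ∀ n < q + 1, Acy F ⊤ (Al (XX F Γ O')) (Al (XX F Γ (O' ∩ O))) n := fun n hn =>
    acy2 hD s3 s2 (a0 n) (a2 _ (by lia))
  have a4 : ∀ n < q + 1, Acy F ⊤ (Al (XX F Γ (O' ∪ O))) (Al (XX F Γ O)) n := by
    intro n hn
    rw [← XX_union]
    refine excise_up (Sta_top F) (XX_IsOp F Γ hO'o) (XX_IsOp F Γ hOo) (XX_PkCl F Γ hO'F)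
      (XX_PkCl F Γ hOF) (Restr_top _) ?_
    rw [XX_inter]
    exact a3 n hn
  have hnew : O' ∪ O ∈ S := by
    refine ⟨hO'o.union hOo, hO'F.union hOF, Set.union_subset hO'E hOE,
      hOst.trans Set.subset_union_right, fun n hn => ?_⟩
    refine acy1 hD (Al_mono (XX_mono _ _ Set.subset_union_right)) (Al_mono (XX_mono _ _ ?_))
      (a4 n hn) (hOacy n hn)
    refine Set.Subset.trans ?_ hOst
    rintro h ⟨h1, h2⟩
    refine ⟨h1, ?_⟩
    have h2 : h b = p := h2
    change h b ∈ Bp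
    rw [h2]; exact hpB
  have hle := hOmax hnew Set.subset_union_right
  apply hts.1
  refine hle (Or.inl ⟨fun v hv hvb => ⟨(hu v).2, ?_⟩, ?_⟩)
  · have := (hu' v).2
    rw [Function.update_of_ne hvb] at this ⊢
    exact this
  · change Function.update f b (γ ts) b ∈ B'
    simpa using hgB'

end
end CFS

set_option linter.unusedSectionVars false
set_option linter.unusedSimpArgs false

namespace CFS
noncomputable section

variable {V M : Type} [TopologicalSpace M] [Fintype V] [LinearOrder V]

lemma PkCl.inter {F : Finset V} {X Y : Set (V → Option M)} (h : PkCl F X) (h' : PkCl F Y) :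
    PkCl F (X ∩ Y) := fun y hy s hs => ⟨h y hy.1 s hs, h' y hy.2 s hs⟩

lemma excise_both {F : Finset V} {N : Submodule ℚ (Ch V M)} (hN : Sta F N)
    {X₁ X₂ Z : Set (V → Option M)} (h1 : IsOp X₁) (h2 : IsOp X₂) (hZ : IsOp Z)
    (p1 : PkCl F X₁) (p2 : PkCl F X₂) (pZ : PkCl F Z) (hR : Restr N (Al (X₁ ∩ X₂)))
    (e12 : ∀ y, y ∉ Z → (y ∈ X₁ ↔ y ∈ X₂)) {n : ℤ}
    (h : Acy F N (Al X₂) (Al (X₂ ∩ Z)) n) : Acy F N (Al X₁) (Al (X₁ ∩ Z)) n := by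
  have a : X₂ = (X₁ ∩ X₂) ∪ (X₂ ∩ Z) := by
    ext y; have := e12 y; simp only [Set.mem_union, Set.mem_inter_iff]; tauto
  have b : X₁ = (X₁ ∩ X₂) ∪ (X₁ ∩ Z) := by
    ext y; have := e12 y; simp only [Set.mem_union, Set.mem_inter_iff]; tauto
  have c : (X₁ ∩ X₂) ∩ (X₂ ∩ Z) = (X₁ ∩ X₂) ∩ (X₁ ∩ Z) := by
    ext y; simp only [Set.mem_inter_iff]; tauto
  have h3 : Acy F N (Al ((X₁ ∩ X₂) ∪ (X₂ ∩ Z))) (Al (X₂ ∩ Z)) n := by rw [← a]; exact h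
  have h4 := excise_down hN (h1.inter h2) (h2.inter hZ) (p1.inter p2) (p2.inter pZ) hR h3
  rw [c] at h4
  have h5 := excise_up hN (h1.inter h2) (h1.inter hZ) (p1.inter p2) (p1.inter pZ) hR h4
  rw [← b] at h5
  exact h5

variable [Inhabited M] [T2Space M]

lemma acy_neg (Γ : Set (V × V)) (W : Set (V → M)) {n : ℤ} (hn : n < 0) :
    Acy ∅ ⊤ (Al (XX ∅ Γ W)) ∅ n := by
  intro x _ hx hxn _
  have h0 : x = 0 := by
    have := sp_inter hx hxn
    have e : Al (XX ∅ Γ W) ∩ {σ | deg σ = n} = ∅ := by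
      ext ⟨k, σ⟩
      simp only [Set.mem_inter_iff, Set.mem_empty_iff_false, iff_false, not_and]
      intro h1 h2
      have h2 : deg _ = n := h2
      have : nopark σ = 0 := by
        rw [nopark, Finset.card_eq_zero, Finset.filter_eq_empty_iff]
        intro v _
        rw [← ev_none σ (vt 0)]
        exact (h1 (vt 0)).1 v (by simp)
      rw [deg, this] at h2
      simp at h2
      lia
    rw [e] at this
    simpa [sp] using this
  subst h0
  exact ⟨0, trivial, Submodule.zero_mem _, Submodule.zero_mem _, by simp⟩

lemma XX_some {F : Finset V} {Γ : Set (V × V)} {W : Set (V → M)} {y : V → Option M}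
    (hy : y ∈ XX F Γ W) {b : V} (hb : b ∉ F) : y b = some (fill y b) := by
  obtain ⟨x, hx⟩ := Option.ne_none_iff_exists'.1 (hy.1 b hb)
  simp [fill, hx]

theorem acyV0 [PathConnectedSpace M] (hcb : CBase M) : ∀ (k : ℕ) (F : Finset V), F.card = k →
    ∀ W : Set (V → M), IsOpen W → FInd F W → ∀ n : ℤ, n < k → Acy F ⊤ (Al (XX F ∅ W)) ∅ n := by
  intro k
  induction k with
  | zero =>
    intro F hF W _ _ n hn
    rw [Finset.card_eq_zero] at hF
    subst hF
    exact acy_neg ∅ W (by simpa using hn)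
  | succ k ih =>
    intro F hF W hWo hWF n hn
    obtain ⟨s, hs⟩ : F.Nonempty := by rw [← Finset.card_pos]; lia
    have hF1 : (F.erase s).card = k := by rw [Finset.card_erase_of_mem hs]; lia
    have hsub : F.erase s ⊆ F := Finset.erase_subset _ _
    have hs1 : s ∉ F.erase s := Finset.notMem_erase _ _
    obtain ⟨Bp, hBp, hpB, -⟩ := hcb (default : M) Set.univ isOpen_univ trivial
    have hup : ∀ f ∈ W, ∀ x, Function.update f s x ∈ W := fun f hf x =>
      hWF f _ (fun v hv => by
        rw [Function.update_of_ne]; rintro rfl; exact hv hs) hf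
    have g := gain hcb hs1 (Γ := ∅) (fun a c h => absurd h (Set.notMem_empty _)) (q := k)
      (fun W hW hWF n hn => ih _ hF1 W hW hWF n hn) hWo (hWF.mono hsub) hBp hpB
      (fun f hf x _ => hup f hf x)
      (fun f hf => by
        have : {x | Function.update f s x ∈ W} = Set.univ := by
          ext x; simpa using hup f hf x
        rw [this]
        exact joinedIn_univ.2 (PathConnectedSpace.joined _ _)) n (by push_cast at hn; lia)
    let C : Set (V → Option M) := {y ∈ XX F ∅ W | y s = none ∨ y s = some default}
    have hCA : C ⊆ XX F ∅ W := fun y hy => hy.1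
    have h1 : Acy F ⊤ (Al (XX F ∅ W)) (Al C) n := by
      refine transfer hsub (A' := XX (F.erase s) ∅ W) ?_ ?_ (XX_PkCl _ _ (hWF.mono hsub)) ?_ ?_ ?_ ?_ g
      · rintro y ⟨y1, y2, y3⟩
        exact ⟨fun v hv => y1 v (fun h => hv (hsub h)), y2, y3⟩
      · rintro y ⟨hy, hys⟩ t ht
        refine ⟨XX_PkCl F ∅ hWF y hy t ht, ?_⟩
        by_cases hts : s = t
        · subst hts; left; simp [park]
        · rw [park, Function.update_of_ne hts]; exact hys
      · intro y hy hy'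
        refine ⟨hy, Or.inl ?_⟩
        by_contra h
        apply hy'
        refine ⟨fun v hv => ?_, hy.2.1, hy.2.2⟩
        by_cases hvs : v = s
        · subst hvs; exact h
        · exact hy.1 v (fun h => hv (Finset.mem_erase.2 ⟨hvs, h⟩))
      · intro y hy z hz hyz hy'
        exact ⟨fun v hv => by rw [Ne, ← hyz]; exact hy'.1 v hv, hz.2.1, hz.2.2⟩
      · intro y hy t ht ht'
        have : t = s := by
          by_contra h
          exact ht' (Finset.mem_erase.2 ⟨h, ht⟩)
        subst this
        refine ⟨XX_PkCl F ∅ hWF y ⟨fun v hv => hy.1 v (fun h => hv (hsub h)), hy.2.1, hy.2.2⟩ t ht, ?_⟩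
        left; simp [park]
      · ext y
        constructor
        · intro hy
          have hys := XX_some hy hs1
          obtain ⟨y1, y2, y3, y4⟩ := hy
          have y4 : fill y s = default := y4
          rw [y4] at hys
          exact ⟨⟨⟨fun v hv => y1 v (fun h => hv (hsub h)), y2, y3⟩, Or.inr hys⟩, y1, y2, y3⟩
        · rintro ⟨⟨-, h⟩, y1, y2, y3⟩
          have h := h.resolve_left (y1 s hs1)
          refine ⟨y1, y2, y3, ?_⟩
          change fill y s = default
          simp [fill, h]
    have h2 : Acy F ⊤ (Al C) ∅ n := by
      refine unpark_acy hs default (fun y hy => hy.2) (fun y hy => ?_) n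
      refine ⟨⟨fun v hv => ?_, fun a b h => absurd h (Set.notMem_empty _), ?_⟩, ?_⟩
      · rw [Function.update_of_ne (by rintro rfl; exact hv hs)]
        exact hy.1.1 v hv
      · refine hWF _ _ (fun v hv => ?_) hy.1.2.2
        rw [fill, fill, Function.update_of_ne (by rintro rfl; exact hv hs)]
      · right; simp
    exact acy1 (fun _ _ => trivial) (Al_mono hCA) (Set.empty_subset _) h1 h2

def PBase (M : Type) [TopologicalSpace M] : Prop := ∀ (x : M) (U : Set M), IsOpen U → x ∈ U →
  ∃ B, CBall B ∧ (∀ u, IsPathConnected (B \ {u})) ∧ x ∈ B ∧ B ⊆ U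

lemma XX_ne (F : Finset V) (Γ : Set (V × V)) (W : Set (V → M)) (a b : V) :
    XX F Γ W ∩ XX F ∅ {f | f a ≠ f b} = XX F Γ (W ∩ {f | f a ≠ f b}) := by
  ext y
  exact ⟨fun h => ⟨h.1.1, h.1.2.1, h.1.2.2, h.2.2.2⟩, fun h => ⟨⟨h.1, h.2.1, h.2.2.1⟩,
    ⟨h.1, fun _ _ h => absurd h (Set.notMem_empty _), h.2.2.2⟩⟩⟩

lemma ne_open (a b : V) : IsOpen {f : V → M | f a ≠ f b} :=
  isOpen_ne_fun (continuous_apply a) (continuous_apply b)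

lemma ne_FInd {F : Finset V} {a b : V} (ha : a ∉ F) (hb : b ∉ F) :
    FInd F {f : V → M | f a ≠ f b} := fun f g e hf => by
  change g a ≠ g b
  rw [← e a ha, ← e b hb]; exact hf

/-- relative acyclicity around a diagonal, `b` isolated -/
lemma diag_acy (hcb : CBase M) (hpb : PBase M) {F : Finset V} {Γ : Set (V × V)} {a b : V}
    (ha : a ∉ F) (hb : b ∉ F) (hab : a ≠ b) (hΓ : Iso Γ b)
    {q : ℤ} (hq : ∀ W : Set (V → M), IsOpen W → FInd F W → ∀ n < q, Acy F ⊤ (Al (XX F Γ W)) ∅ n)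
    {W : Set (V → M)} (hWo : IsOpen W) (hWF : FInd F W) :
    ∀ n < q + 2, Acy F ⊤ (Al (XX F Γ W)) (Al (XX F Γ (W ∩ {f | f a ≠ f b}))) n := by
  have zo : IsOp (XX F ∅ {f : V → M | f a ≠ f b}) := XX_IsOp _ _ (ne_open a b)
  have zp : PkCl F (XX F ∅ {f : V → M | f a ≠ f b}) := XX_PkCl _ _ (ne_FInd ha hb)
  -- general excision
  have ex : ∀ W₁ W₂ : Set (V → M), IsOpen W₁ → IsOpen W₂ → FInd F W₁ → FInd F W₂ →
      (∀ f : V → M, f a = f b → (f ∈ W₁ ↔ f ∈ W₂)) → ∀ n,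
      Acy F ⊤ (Al (XX F Γ W₂)) (Al (XX F Γ (W₂ ∩ {f | f a ≠ f b}))) n →
      Acy F ⊤ (Al (XX F Γ W₁)) (Al (XX F Γ (W₁ ∩ {f | f a ≠ f b}))) n := by
    intro W₁ W₂ o1 o2 f1 f2 h n hn
    rw [← XX_ne] at hn ⊢
    refine excise_both (Sta_top F) (XX_IsOp _ _ o1) (XX_IsOp _ _ o2) zo (XX_PkCl _ _ f1)
      (XX_PkCl _ _ f2) zp (Restr_top _) (fun y hy => ?_) hn
    have : (∀ v, v ∉ F → y v ≠ none) → fill y a = fill y b := by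
      intro h1
      by_contra h2
      exact hy ⟨h1, fun _ _ h => absurd h (Set.notMem_empty _), h2⟩
    constructor
    · rintro ⟨y1, y2, y3⟩
      exact ⟨y1, y2, (h _ (this y1)).1 y3⟩
    · rintro ⟨y1, y2, y3⟩
      exact ⟨y1, y2, (h _ (this y1)).2 y3⟩
  have hao : ∀ U : Set M, IsOpen U → IsOpen {f : V → M | f a ∈ U} := fun U hU =>
    hU.preimage (continuous_apply a)
  have hbo : ∀ U : Set M, IsOpen U → IsOpen {f : V → M | f b ∈ U} := fun U hU =>
    hU.preimage (continuous_apply b)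
  let Wt : Set (V → M) := {f | Function.update f b (f a) ∈ W}
  have hWt : IsOpen Wt := hWo.preimage (continuous_id.update b (continuous_apply a))
  have hWtF : FInd F Wt := by
    intro f g e hf
    refine hWF _ _ (fun v hv => ?_) hf
    by_cases hvb : v = b
    · subst hvb; simp [e a ha]
    · simp [Function.update_of_ne hvb, e v hv]
  have hWtb : BInd b Wt := by
    intro f hf x
    change Function.update (Function.update f b x) b ((Function.update f b x) a) ∈ W
    rw [Function.update_idem, Function.update_of_ne hab]
    exact hf
  intro n hn
  refine ex W Wt hWo hWt hWF hWtF (fun f hf => ?_) n ?_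
  · change f ∈ W ↔ Function.update f b (f a) ∈ W
    rw [hf, Function.update_eq_self]
  -- localization
  suffices key : ∀ n < q + 2, Acy F ⊤ (Al (XX F Γ (Wt ∩ {f | f a ∈ (Set.univ : Set M)})))
      (Al (XX F Γ (Wt ∩ {f | f a ∈ (Set.univ : Set M)} ∩ {f | f a ≠ f b}))) n by
    have e : Wt ∩ {f | f a ∈ (Set.univ : Set M)} = Wt := by ext; simp
    have := key n hn
    rwa [e] at this
  let 𝓑 : Set (Set M) := {U | IsOpen U ∧ ∃ B, CBall B ∧ (∀ u, IsPathConnected (B \ {u})) ∧ U ⊆ B ∧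
    ∃ c Bc, CBall Bc ∧ c ∈ Bc ∧ Bc ⊆ B \ U}
  refine LTG (fun U => ∀ n < q + 2, Acy F ⊤ (Al (XX F Γ (Wt ∩ {f | f a ∈ U})))
      (Al (XX F Γ (Wt ∩ {f | f a ∈ U} ∩ {f | f a ≠ f b}))) n) 𝓑 (fun B hB => hB.1) ?_ ?_ ?_ ?_ ?_
      Set.univ ?_
  · rintro U ⟨hU, B, h1, h2, h3, c, Bc, h4, h5, h6⟩ U' ⟨hU', -⟩
    exact ⟨hU.inter hU', B, h1, h2, fun x hx => h3 hx.1, c, Bc, h4, h5,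
      fun x hx => ⟨(h6 hx).1, fun h => (h6 hx).2 h.1⟩⟩
  · intro n _ x _ hx _ _
    have : Al (XX F Γ (Wt ∩ {f : V → M | f a ∈ (∅ : Set M)})) = ∅ := by
      ext σ
      simp only [Set.mem_empty_iff_false, iff_false]
      intro h
      exact (h (vt 0)).2.2.2
    rw [this] at hx
    have h0 : x = 0 := by simpa [sp] using hx
    subst h0
    exact ⟨0, trivial, Submodule.zero_mem _, Submodule.zero_mem _, by simp⟩
  · -- local case
    rintro U ⟨hU, B, hB, hBp, hUB, c, Bc, hBc, hcBc, hBcB⟩ n hn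
    have hcB : c ∈ B := (hBcB hcBc).1
    have w1o : IsOpen (Wt ∩ {f | f a ∈ U}) := hWt.inter (hao U hU)
    have w1F : FInd F (Wt ∩ {f | f a ∈ U}) := hWtF.inter (FInd_coord ha U)
    have w1b : BInd b (Wt ∩ {f | f a ∈ U}) := by
      rintro f ⟨f1, f2⟩ x
      refine ⟨hWtb f f1 x, ?_⟩
      change Function.update f b x a ∈ U
      rw [Function.update_of_ne hab]; exact f2
    refine ex _ ((Wt ∩ {f | f a ∈ U}) ∩ {f | f b ∈ B}) w1o (w1o.inter (hbo B hB.1)) w1F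
      (w1F.inter (FInd_coord hb B)) ?_ n ?_
    · intro f hf
      refine ⟨fun h => ⟨h, ?_⟩, fun h => h.1⟩
      change f b ∈ B
      rw [← hf]; exact hUB h.2
    set W₁ := Wt ∩ {f | f a ∈ U} with hW₁
    set E := W₁ ∩ {f | f b ∈ B} ∩ {f | f a ≠ f b} with hE
    have hEo : IsOpen E := (w1o.inter (hbo B hB.1)).inter (ne_open a b)
    have hEF : FInd F E := (w1F.inter (FInd_coord hb B)).inter (ne_FInd ha hb)
    have eC : E ∩ {f | f b = c} = W₁ ∩ {f | f b = c} := by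
      ext f
      constructor
      · rintro ⟨⟨⟨h1, h2⟩, h3⟩, h4⟩
        exact ⟨h1, h4⟩
      · rintro ⟨h1, h4⟩
        have h4' : f b = c := h4
        refine ⟨⟨⟨h1, ?_⟩, ?_⟩, h4⟩
        · change f b ∈ B
          rw [h4']; exact hcB
        · intro h
          have h : f a = f b := h
          apply (hBcB hcBc).2
          rw [← h4', ← h]
          exact h1.2
    refine acy2 (C := Al (XX F Γ (E ∩ {f | f b = c}))) (fun _ _ => trivial)
      (Al_mono (XX_mono _ _ Set.inter_subset_left)) (Al_mono (XX_mono _ _ Set.inter_subset_left)) ?_ ?_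
    · rw [eC]
      exact HI hb hΓ w1F w1b hB hcB n
    · refine gain hcb hb hΓ hq hEo hEF hBc hcBc ?_ ?_ _ (by lia)
      · rintro f ⟨⟨f1, f2⟩, f3⟩ x hx
        refine ⟨⟨w1b f f1 x, ?_⟩, ?_⟩
        · change Function.update f b x b ∈ B
          rw [Function.update_self]; exact (hBcB hx).1
        · change Function.update f b x a ≠ Function.update f b x b
          rw [Function.update_self, Function.update_of_ne hab]
          intro h
          apply (hBcB hx).2
          rw [← h]; exact f1.2
      · rintro f ⟨⟨f1, f2⟩, f3⟩
        have : {x | Function.update f b x ∈ E} = B \ {f a} := by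
          ext x
          constructor
          · rintro ⟨⟨g1, g2⟩, g3⟩
            have g2 : Function.update f b x b ∈ B := g2
            have g3 : Function.update f b x a ≠ Function.update f b x b := g3
            rw [Function.update_self] at g2 g3
            rw [Function.update_of_ne hab] at g3
            exact ⟨g2, fun h => g3 (Set.mem_singleton_iff.1 h).symm⟩
          · rintro ⟨g2, g3⟩
            refine ⟨⟨w1b f f1 x, ?_⟩, ?_⟩
            · change Function.update f b x b ∈ B
              rw [Function.update_self]; exact g2
            · change Function.update f b x a ≠ Function.update f b x b
              rw [Function.update_self, Function.update_of_ne hab]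
              exact fun h => g3 h.symm
        rw [this]
        refine (hBp (f a)).joinedIn _ ⟨hcB, ?_⟩ _ ⟨f2, fun h => f3 (Set.mem_singleton_iff.1 h).symm⟩
        rintro h
        have h : c = f a := h
        apply (hBcB hcBc).2
        rw [h]; exact f1.2
  · intro U U' hU hU' h1 h2 h3 n hn
    have e1 : Wt ∩ {f : V → M | f a ∈ U ∪ U'} = (Wt ∩ {f | f a ∈ U}) ∪ (Wt ∩ {f | f a ∈ U'}) := by
      ext f
      simp only [Set.mem_inter_iff, Set.mem_union, Set.mem_ofPred_eq]; tauto
    have e2 : Wt ∩ {f : V → M | f a ∈ U ∩ U'} = (Wt ∩ {f | f a ∈ U}) ∩ (Wt ∩ {f | f a ∈ U'}) := by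
      ext f
      simp only [Set.mem_inter_iff, Set.mem_ofPred_eq]; tauto
    rw [e2] at h3
    rw [e1, ← XX_ne, ← XX_union]
    have g1 := h1 n hn
    have g2 := h2 n hn
    have g3 := h3 (n-1) (by lia)
    rw [← XX_ne] at g1 g2 g3
    rw [← XX_inter] at g3
    exact mv (Sta_top F) (XX_IsOp _ _ (hWt.inter (hao U hU))) (XX_IsOp _ _ (hWt.inter (hao U' hU')))
      (XX_PkCl _ _ (hWtF.inter (FInd_coord ha U))) (XX_PkCl _ _ (hWtF.inter (FInd_coord ha U')))
      zp (Restr_top _) g1 g2 g3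
  · intro S hne hd ho hS n hn x hxN hx hxn hDx
    let S' : Set (Set (V → M)) := (fun U : Set M => Wt ∩ {f | f a ∈ U}) '' S
    have e : Wt ∩ {f : V → M | f a ∈ ⋃₀ S} = ⋃₀ S' := by
      ext f
      simp only [S', Set.mem_inter_iff, Set.mem_ofPred_eq, Set.mem_sUnion, Set.mem_image,
        exists_exists_and_eq_and]
      constructor
      · rintro ⟨h1, U, hU, h2⟩; exact ⟨U, hU, h1, h2⟩
      · rintro ⟨U, hU, h1, h2⟩; exact ⟨h1, U, hU, h2⟩
    have hne' : Nonempty S := hne.to_subtype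
    have hdir : Directed (· ⊆ ·) (fun U : S => XX F Γ (Wt ∩ {f | f a ∈ U.1})) := by
      rintro ⟨U, hU⟩ ⟨U', hU'⟩
      obtain ⟨U'', hU'', h1, h2⟩ := hd U hU U' hU'
      exact ⟨⟨U'', hU''⟩, XX_mono _ _ (fun f hf => ⟨hf.1, h1 hf.2⟩),
        XX_mono _ _ (fun f hf => ⟨hf.1, h2 hf.2⟩)⟩
    have eU : XX F Γ (Wt ∩ {f : V → M | f a ∈ ⋃₀ S}) = ⋃ U : S, XX F Γ (Wt ∩ {f | f a ∈ U.1}) := by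
      ext y
      simp only [Set.mem_iUnion]
      constructor
      · rintro ⟨y1, y2, y3, U, hU, y4⟩
        exact ⟨⟨U, hU⟩, y1, y2, y3, y4⟩
      · rintro ⟨⟨U, hU⟩, y1, y2, y3, y4⟩
        exact ⟨y1, y2, y3, U, hU, y4⟩
    rw [eU] at hx
    obtain ⟨⟨U, hU⟩, hxU⟩ := directed_sp _ (fun U : S => XX_IsOp F Γ (hWt.inter (hao U.1 (ho U.1 U.2)))) hdir hx
    have hsub : Wt ∩ {f : V → M | f a ∈ U} ⊆ Wt ∩ {f : V → M | f a ∈ ⋃₀ S} :=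
      fun f hf => ⟨hf.1, U, hU, hf.2⟩
    obtain ⟨y, hyN, hy, hyn, hxy⟩ := hS U hU n hn x hxN hxU hxn (by
      rw [← XX_ne] at hDx ⊢
      refine sp_Al_inter (DD_Al F (XX_PkCl _ _ (hWtF.inter (FInd_coord ha U))) hxU) ?_
      exact Finsupp.supported_mono (Al_mono Set.inter_subset_right) hDx)
    exact ⟨y, hyN, Finsupp.supported_mono (Al_mono (XX_mono _ _ hsub)) hy, hyn,
      Finsupp.supported_mono (Al_mono (XX_mono _ _ (Set.inter_subset_inter_left _ hsub))) hxy⟩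
  · intro x _
    obtain ⟨B, hB, hBp, hxB, -⟩ := hpb x Set.univ isOpen_univ trivial
    obtain ⟨c, hcB, hcx⟩ := (hBp x).nonempty
    obtain ⟨U₁, U₂, o1, o2, hx1, hc2, hdis⟩ := t2_separation (Ne.symm hcx : x ≠ c)
    obtain ⟨Bc, hBc, hcBc, hBcs⟩ := hcb c (U₂ ∩ B) (o2.inter hB.1) ⟨hc2, hcB⟩
    refine ⟨U₁ ∩ B, ⟨o1.inter hB.1, B, hB, hBp, Set.inter_subset_right, c, Bc, hBc, hcBc, ?_⟩,
      ⟨hx1, hxB⟩, Set.subset_univ _⟩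
    intro z hz
    exact ⟨(hBcs hz).2, fun h => Set.disjoint_left.1 hdis h.1 (hBcs hz).1⟩

end
end CFS

set_option linter.unusedSectionVars false
set_option linter.unusedSimpArgs false

namespace CFS
noncomputable section

variable {V M : Type} [TopologicalSpace M] [Fintype V] [LinearOrder V] [Inhabited M] [T2Space M]

theorem acyV1 [PathConnectedSpace M] (hcb : CBase M) (hpb : PBase M) : ∀ (k : ℕ) (Γ : Finset (V × V)),
    Γ.card = k → (∀ p ∈ Γ, p.1 ≠ p.2) → ∀ (F : Finset V)
    (W : Set (V → M)), IsOpen W → FInd F W → ∀ n : ℤ, n < ((F.card + 1) / 2 : ℕ) →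
      Acy F ⊤ (Al (XX F (Γ : Set (V × V)) W)) ∅ n := by
  intro k
  induction k using Nat.strong_induction_on with
  | _ k ih =>
  intro Γ hk hl F W hWo hWF n hn
  rcases Γ.eq_empty_or_nonempty with rfl | ⟨⟨a, b⟩, hab⟩
  · rw [Finset.coe_empty]
    exact acyV0 hcb _ F rfl W hWo hWF n (by lia)
  have hne : a ≠ b := hl _ hab
  set Γ0 : Finset (V × V) := (Γ.erase (a, b)).erase (b, a) with hΓ0
  have hlt : Γ0.card < Γ.card :=
    lt_of_le_of_lt (Finset.card_le_card (Finset.erase_subset _ _)) (Finset.card_erase_lt_of_mem hab)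
  have hsub : Γ0 ⊆ Γ := (Finset.erase_subset _ _).trans (Finset.erase_subset _ _)
  have h0 : Acy F ⊤ (Al (XX F (Γ0 : Set (V × V)) W)) ∅ n :=
    ih _ (hk ▸ hlt) Γ0 rfl (fun p hp => hl p (hsub hp)) F W hWo hWF n hn
  refine acy3 (fun _ _ => trivial) (Al_mono (XX_anti _ _ (Finset.coe_subset.2 hsub)))
    (Set.empty_subset _) h0 ?_
  set F' : Finset V := (F.erase a).erase b with hF'
  have hF'F : F' ⊆ F := (Finset.erase_subset _ _).trans (Finset.erase_subset _ _)
  have haF : a ∉ F' := by simp [hF']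
  have hbF : b ∉ F' := by simp [hF']
  have hcard : F.card ≤ F'.card + 2 := by
    have h1 := Finset.pred_card_le_card_erase (s := F) (a := a)
    have h2 := Finset.pred_card_le_card_erase (s := F.erase a) (a := b)
    lia
  have hWF' : FInd F' W := hWF.mono hF'F
  have mem0 : ∀ c e, (c, e) ∈ Γ → (c, e) ∈ Γ0 ∨ (c, e) = (a, b) ∨ (c, e) = (b, a) := by
    intro c e h
    simp only [hΓ0, Finset.mem_erase]
    tauto
  have hpkd : ∀ y : V → Option M, (y a = none ∨ y b = none) → y ∈ XX F (Γ0 : Set (V × V)) W →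
      y ∈ XX F (Γ : Set (V × V)) W := by
    rintro y hy ⟨h1, h2, h3⟩
    refine ⟨h1, fun c e hce m hm hm' => ?_, h3⟩
    rcases mem0 c e hce with h | h | h
    · exact h2 c e h m hm hm'
    · rw [Prod.mk.injEq] at h
      obtain ⟨rfl, rfl⟩ := h
      rcases hy with hy | hy <;> simp [hy] at hm hm'
    · rw [Prod.mk.injEq] at h
      obtain ⟨rfl, rfl⟩ := h
      rcases hy with hy | hy <;> simp [hy] at hm hm'
  have hA'A : XX F' (Γ0 : Set (V × V)) W ⊆ XX F (Γ0 : Set (V × V)) W :=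
    fun y hy => ⟨fun v hv => hy.1 v (fun h => hv (hF'F h)), hy.2⟩
  have hmF : ∀ v, v ∈ F → v ∉ F' → v = a ∨ v = b := by
    intro v hv hv'
    simp only [hF', Finset.mem_erase] at hv'
    tauto
  refine transfer hF'F (A' := XX F' (Γ0 : Set (V × V)) W)
    (B' := XX F' (Γ0 : Set (V × V)) W ∩ XX F' ∅ {f | f a ≠ f b}) hA'A (XX_PkCl _ _ hWF)
    (XX_PkCl _ _ hWF') ?_ ?_ ?_ ?_ ?_
  · intro y hy hy'
    refine hpkd y ?_ hy
    by_contra hcon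
    push Not at hcon
    refine hy' ⟨fun v hv => ?_, hy.2⟩
    by_cases hvF : v ∈ F
    · rcases hmF v hvF hv with rfl | rfl
      · exact hcon.1
      · exact hcon.2
    · exact hy.1 v hvF
  · intro y _ z hz hyz hy'
    exact ⟨fun v hv h => hy'.1 v hv ((hyz v).2 h), hz.2⟩
  · intro y hy s hs hs'
    refine hpkd _ ?_ (XX_PkCl _ _ hWF _ (hA'A hy) s hs)
    rcases hmF s hs hs' with rfl | rfl
    · left; simp [park]
    · right; simp [park]
  · ext y
    constructor
    · rintro ⟨h1, h2⟩
      refine ⟨⟨(hA'A h1).1, fun c e hce m hm hm' => ?_, h1.2.2⟩, h1⟩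
      have e1 := XX_some h1 haF
      have e2 := XX_some h1 hbF
      have e3 : fill y a ≠ fill y b := h2.2.2
      rcases mem0 c e hce with h | h | h
      · exact h1.2.1 c e h m hm hm'
      · rw [Prod.mk.injEq] at h
        obtain ⟨rfl, rfl⟩ := h
        rw [hm] at e1
        rw [hm'] at e2
        exact e3 (by rw [← Option.some.inj e1, ← Option.some.inj e2])
      · rw [Prod.mk.injEq] at h
        obtain ⟨rfl, rfl⟩ := h
        rw [hm] at e2
        rw [hm'] at e1
        exact e3 (by rw [← Option.some.inj e1, ← Option.some.inj e2])
    · rintro ⟨h1, h2⟩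
      refine ⟨h2, h2.1, fun _ _ h => absurd h (Set.notMem_empty _), fun h => ?_⟩
      refine h1.2.1 a b hab _ (XX_some h2 haF) ?_
      rw [h]
      exact XX_some h2 hbF
  -- collapse b to a
  let r : V → V := fun v => if v = b then a else v
  set Γ' : Finset (V × V) := Γ0.image (Prod.map r r) with hΓ'
  have hrb : ∀ v, r v ≠ b := by
    intro v
    simp only [r]
    split_ifs with h
    · exact hne
    · exact h
  have hl' : ∀ p ∈ Γ', p.1 ≠ p.2 := by
    intro p hp
    obtain ⟨⟨c, e⟩, hce, rfl⟩ := Finset.mem_image.1 hp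
    have hce1 := hl _ (hsub hce)
    have hce2 : (c, e) ≠ (b, a) := (Finset.mem_erase.1 hce).1
    have hce3 : (c, e) ≠ (a, b) := (Finset.mem_erase.1 (Finset.mem_erase.1 hce).2).1
    simp only [ne_eq, Prod.mk.injEq] at hce1 hce2 hce3
    simp only [Prod.map, r]
    split_ifs with u1 u2 u2
    · subst u1; subst u2; exact absurd rfl hce1
    · intro h; exact hce2 ⟨u1, h.symm⟩
    · intro h; exact hce3 ⟨h, u2⟩
    · exact hce1
  have hiso : Iso (Γ' : Set (V × V)) b := by
    intro p1 p2 hp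
    obtain ⟨⟨c, e⟩, hce, he⟩ := Finset.mem_image.1 (Finset.mem_coe.1 hp)
    simp only [Prod.map, Prod.mk.injEq] at he
    rw [← he.1, ← he.2]
    exact ⟨hrb c, hrb e⟩
  have hΓ'c : Γ'.card < k := by
    rw [← hk]; exact lt_of_le_of_lt Finset.card_image_le hlt
  refine excise_both (Sta_top F') (X₂ := XX F' (Γ' : Set (V × V)) W) (XX_IsOp _ _ hWo) (XX_IsOp _ _ hWo)
    (XX_IsOp _ _ (ne_open a b)) (XX_PkCl _ _ hWF') (XX_PkCl _ _ hWF') (XX_PkCl _ _ (ne_FInd haF hbF))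
    (Restr_top _) ?_ ?_
  · intro y hy
    have key : ∀ hp : (∀ v, v ∉ F' → y v ≠ none), ∀ v, y (r v) = y v := by
      intro hp v
      simp only [r]
      split_ifs with h
      · subst h
        by_contra hcon
        refine hy ⟨hp, fun _ _ h => absurd h (Set.notMem_empty _), fun h => hcon ?_⟩
        obtain ⟨m1, h1⟩ := Option.ne_none_iff_exists'.1 (hp a haF)
        obtain ⟨m2, h2⟩ := Option.ne_none_iff_exists'.1 (hp v hbF)
        simp [fill, h1, h2] at h
        rw [h1, h2, h]
      · rfl
    constructor
    · rintro ⟨h1, h2, h3⟩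
      refine ⟨h1, fun c e hce m hm hm' => ?_, h3⟩
      obtain ⟨⟨c', e'⟩, hce', he⟩ := Finset.mem_image.1 (Finset.mem_coe.1 hce)
      simp only [Prod.map, Prod.mk.injEq] at he
      rw [← he.1, key h1] at hm
      rw [← he.2, key h1] at hm'
      exact h2 c' e' hce' m hm hm'
    · rintro ⟨h1, h2, h3⟩
      refine ⟨h1, fun c e hce m hm hm' => ?_, h3⟩
      rw [← key h1] at hm hm'
      exact h2 (r c) (r e) (Finset.mem_coe.2 (Finset.mem_image.2 ⟨(c, e), hce, rfl⟩)) m hm hm'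
  · rw [XX_ne]
    refine diag_acy hcb hpb haF hbF hne hiso
      (fun W' hW'o hW'F n' hn' => ih _ hΓ'c Γ' rfl hl' F' W' hW'o hW'F n' hn') hWo hWF' (n+1) ?_
    push_cast at hn ⊢
    lia

end
end CFS

set_option linter.unusedSectionVars false
set_option linter.unusedSimpArgs false

namespace CFS
noncomputable section

section rei
variable {V V' V'' M : Type} [TopologicalSpace M]

/-- reindexing along partial maps -/
def ri {α : Type} (f : V' → Option V) (σ : V → Option α) : V' → Option α := fun v => (f v).bind σ

def rei (f : V' → Option V) : Ch V M →ₗ[ℚ] Ch V' M :=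
  Finsupp.linearCombination ℚ (fun σ : Sim V M => bs (⟨σ.1, ri f σ.2⟩ : Sim V' M))

lemma rei_bs (f : V' → Option V) (σ : Sim V M) : rei f (bs σ) = bs (⟨σ.1, ri f σ.2⟩ : Sim V' M) := by
  simp [rei, bs]

lemma ri_pb {Q R : Type} [TopologicalSpace Q] [TopologicalSpace R] (f : V' → Option V) (g : C(Q, R))
    (σ : V → Option C(R, M)) : ri f (pb g σ) = pb g (ri f σ) := by
  funext v
  simp only [ri, pb]
  cases f v <;> rfl

lemma ri_ev {Q : Type} [TopologicalSpace Q] (f : V' → Option V) (σ : V → Option C(Q, M)) (t : Q) :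
    ri f (ev σ t) = ev (ri f σ) t := by
  funext v
  simp only [ri, ev]
  cases f v <;> rfl

lemma rei_ps (f : V' → Option V) {Q : Type} [TopologicalSpace Q] [Afn Q] (σ : V → Option C(Q, M))
    (m : ℕ) (x : LC m Q) : rei f (ps σ m x) = ps (ri f σ) m x := by
  cases m with
  | zero => simp [ps]
  | succ m =>
    refine lin_ext_apply (f := (rei f).comp (ps σ (m+1))) (g := ps (ri f σ) (m+1)) (fun p => ?_) x
    rw [LinearMap.comp_apply, ps_bs, ps_bs, rei_bs, ri_pb]

lemma rei_nop (f : V' → Option V) (e : ℕ → ℕ) (c : ∀ n, LC (e n) (Dl n)) (x : Ch V M) :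
    rei f (nop e c x) = nop e c (rei f x) := by
  refine lin_ext_apply (f := (rei f).comp (nop e c)) (g := (nop e c).comp (rei f)) ?_ x
  rintro ⟨n, σ⟩
  rw [LinearMap.comp_apply, LinearMap.comp_apply, nop_bs, rei_bs, nop_bs, rei_ps]

lemma rei_dd (f : V' → Option V) (x : Ch V M) : rei f (dd x) = dd (rei f x) := rei_nop _ _ _ _
lemma rei_SD (f : V' → Option V) (x : Ch V M) : rei f (SD x) = SD (rei f x) := rei_nop _ _ _ _
lemma rei_TT (f : V' → Option V) (x : Ch V M) : rei f (TT x) = TT (rei f x) := rei_nop _ _ _ _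

lemma rei_rei (g : V'' → Option V') (f : V' → Option V) (x : Ch V M) :
    rei g (rei f x) = rei (fun v => (g v).bind f) x := by
  refine lin_ext_apply (f := (rei g).comp (rei f)) (g := rei (fun v => (g v).bind f)) ?_ x
  intro σ
  rw [LinearMap.comp_apply, rei_bs, rei_bs, rei_bs]
  congr 2
  funext v
  simp only [ri]
  cases g v <;> rfl

lemma rei_some (x : Ch V M) : rei some x = x := by
  refine lin_ext_apply (f := rei some) (g := LinearMap.id) ?_ x
  intro σ
  rw [rei_bs]
  rfl

lemma rei_sp (f : V' → Option V) {𝒜 : Set (Sim V M)} {ℬ : Set (Sim V' M)}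
    (h : ∀ σ ∈ 𝒜, (⟨σ.1, ri f σ.2⟩ : Sim V' M) ∈ ℬ) {x : Ch V M} (hx : x ∈ sp 𝒜) : rei f x ∈ sp ℬ := by
  refine supp_map _ _ _ (fun σ hσ => ?_) hx
  rw [rei_bs]
  exact supp_bs (h σ hσ)

lemma rei_Al (f : V' → Option V) {X : Set (V → Option M)} {Y : Set (V' → Option M)}
    (h : ∀ y ∈ X, ri f y ∈ Y) {x : Ch V M} (hx : x ∈ sp (Al X)) : rei f x ∈ sp (Al Y) := by
  refine rei_sp f (𝒜 := Al X) (ℬ := Al Y) (fun σ hσ => ?_) hx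
  intro t
  change ev (ri f σ.2) t ∈ Y
  rw [← ri_ev]
  exact h _ (hσ t)

/-- dimension grading -/
def Di (n : ℕ) : Submodule ℚ (Ch V M) := sp {σ | σ.1 = n}

lemma rei_Di (f : V' → Option V) {n : ℕ} {x : Ch V M} (hx : x ∈ Di n) : rei f x ∈ (Di n : Submodule ℚ (Ch V' M)) :=
  rei_sp f (fun _ hσ => hσ) hx

/-- permutations -/
def act (g : Equiv.Perm V) : Ch V M →ₗ[ℚ] Ch V M := rei (fun v => some (g v))

lemma act_act (g h : Equiv.Perm V) (x : Ch V M) : act h (act g x) = act (g * h) x := rei_rei _ _ _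

end rei

section key
variable {M : Type} [TopologicalSpace M]

def pks {V : Type} [DecidableEq V] (s : V) : V → Option V := Function.update some s none

lemma ri_pks {V α : Type} [DecidableEq V] (s : V) (σ : V → Option α) :
    ri (pks s) σ = Function.update σ s none := by
  funext v
  unfold ri pks
  by_cases h : v = s
  · subst h; simp
  · simp [h]

variable {V : Type} [Fintype V] [LinearOrder V]

lemma PP_unp {x : Ch V M} (hx : x ∈ sp {σ | ∀ v, σ.2 v ≠ none}) :
    PP Finset.univ x = ∑ s, rei (pks s) x := by
  have : PP Finset.univ x - (∑ s, rei (pks s)) x ∈ (⊥ : Submodule ℚ (Ch V M)) := by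
    refine supp_map (PP Finset.univ - ∑ s, rei (pks s)) _ _ ?_ hx
    intro σ hσ
    rw [Submodule.mem_bot, LinearMap.sub_apply, PP_bs, LinearMap.sum_apply, sub_eq_zero]
    refine Finset.sum_congr rfl (fun s _ => ?_)
    rw [if_neg (hσ s), rei_bs, ri_pks, sgn, Finset.prod_eq_one (fun t _ => chi_some (hσ t)), one_smul]
    rfl
  rw [Submodule.mem_bot, sub_eq_zero, LinearMap.sum_apply] at this
  exact this

lemma PP_one {s : V} {x : Ch V M} (hx : x ∈ sp {σ | ∀ v, σ.2 v = none ↔ v = s}) :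
    PP Finset.univ x = ∑ t, (if t = s then (0:ℚ) else if s < t then -1 else 1) • rei (pks t) x := by
  set L : Ch V M →ₗ[ℚ] Ch V M :=
    ∑ t, (if t = s then (0:ℚ) else if s < t then -1 else 1) • rei (pks t) with hL
  have : PP Finset.univ x - L x ∈ (⊥ : Submodule ℚ (Ch V M)) := by
    refine supp_map (PP Finset.univ - L) _ _ ?_ hx
    intro σ hσ
    rw [Submodule.mem_bot, LinearMap.sub_apply, PP_bs, hL, LinearMap.sum_apply, sub_eq_zero]
    refine Finset.sum_congr rfl (fun t _ => ?_)
    rw [LinearMap.smul_apply, rei_bs, ri_pks]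
    by_cases h : t = s
    · rw [if_pos ((hσ t).2 h), if_pos h, zero_smul]
    · rw [if_neg (fun h' => h ((hσ t).1 h')), if_neg h]
      congr 1
      rw [sgn]
      split_ifs with hst
      · rw [Finset.prod_eq_single s]
        · rw [(hσ s).2 rfl, chi_none]
        · intro b _ hb
          exact chi_some (fun h' => hb ((hσ b).1 h'))
        · intro h'
          simp [hst] at h'
      · refine Finset.prod_eq_one (fun b hb => chi_some (fun h' => ?_))
        rw [(hσ b).1 h'] at hb
        simp at hb
        exact hst hb
  rw [Submodule.mem_bot, sub_eq_zero, hL, LinearMap.sum_apply] at this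
  exact this

lemma Ep_unp {x : Ch V M} (hx : x ∈ sp {σ | ∀ v, σ.2 v ≠ none}) : Ep x = x := by
  have : Ep x - x ∈ (⊥ : Submodule ℚ (Ch V M)) := by
    refine supp_map (Ep - LinearMap.id) _ _ ?_ hx
    intro σ hσ
    rw [Submodule.mem_bot, LinearMap.sub_apply, Ep_bs, eps, Finset.prod_eq_one (fun t _ => chi_some (hσ t)),
      one_smul]
    exact sub_self _
  rw [Submodule.mem_bot, sub_eq_zero] at this
  exact this

lemma Ep_one {s : V} {x : Ch V M} (hx : x ∈ sp {σ | ∀ v, σ.2 v = none ↔ v = s}) : Ep x = -x := by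
  have : Ep x - (-x) ∈ (⊥ : Submodule ℚ (Ch V M)) := by
    refine supp_map (Ep - (-LinearMap.id)) _ _ ?_ hx
    intro σ hσ
    rw [Submodule.mem_bot, LinearMap.sub_apply, Ep_bs, eps, Finset.prod_eq_single s]
    · rw [(hσ s).2 rfl, chi_none]; simp
    · intro b _ hb
      exact chi_some (fun h' => hb ((hσ b).1 h'))
    · intro h'
      simp at h'
  rw [Submodule.mem_bot, sub_eq_zero] at this
  exact this

lemma dd_sp_pat (P : (V → Prop) → Prop) {x : Ch V M} (hx : x ∈ sp {σ | P (fun v => σ.2 v = none)}) :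
    dd x ∈ sp {σ : Sim V M | P (fun v => σ.2 v = none)} := by
  have e : {σ : Sim V M | P (fun v => σ.2 v = none)} = Al {y : V → Option M | P (fun v => y v = none)} := by
    ext σ
    constructor
    · intro h t
      change P _
      simp only [ev_none]
      exact h
    · intro h
      have : P _ := h (vt 0)
      simp only [ev_none] at this
      exact this
  rw [e] at hx ⊢
  exact nop_Al _ _ _ _ hx

def offd (V : Type) : Set (V × V) := {p | p.1 ≠ p.2}

def inl {m : ℕ} (s : Fin (m+1)) : Fin (m+1) → Option (Fin m) := s.insertNth (α := fun _ => Option (Fin m)) none some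

lemma inl_same {m : ℕ} (s : Fin (m+1)) : inl s s = none := by simp [inl]
lemma inl_above {m : ℕ} (s : Fin (m+1)) (j : Fin m) : inl s (s.succAbove j) = some j := by simp [inl]

lemma exists_perm_above {m : ℕ} (s : Fin (m+1)) (t : Fin (m+1)) (g : Equiv.Perm (Fin (m+1))) (hg : g t = s) :
    ∃ h : Equiv.Perm (Fin m), ∀ j, s.succAbove (h j) = g (t.succAbove j) := by
  have : ∀ j, ∃ k, s.succAbove k = g (t.succAbove j) := by
    intro j
    apply Fin.exists_succAbove_eq
    intro h
    rw [← hg] at h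
    exact Fin.succAbove_ne t j (g.injective h)
  choose h hh using this
  have hinj : Function.Injective h := by
    intro j k hjk
    have := hh j
    rw [hjk, hh k] at this
    exact Fin.succAbove_right_injective (g.injective this.symm)
  exact ⟨Equiv.ofBijective h (Finite.injective_iff_bijective.1 hinj), hh⟩

variable [Inhabited M]

theorem key_of_acy {m i : ℕ} {Γ : Set (Fin (m+1) × Fin (m+1))} (hΓ : Γ ⊆ offd (Fin (m+1)))
    (hA : Acy (M := M) Finset.univ ⊤ (Al (XX Finset.univ Γ Set.univ)) ∅ (i : ℤ))
    {z : Ch (Fin (m+1)) M} (hz : z ∈ sp (Al (XX ∅ (offd _) Set.univ))) (hzi : z ∈ Di i)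
    (hzg : ∀ g, act g z = z) (hdz : dd z = 0) {w : Ch (Fin m) M}
    (hw : w ∈ sp (Al (XX ∅ (offd _) Set.univ))) (hwi : w ∈ Di (i+1)) (hwg : ∀ g, act g w = w)
    (hzw : rei (fun j => some j.castSucc) z = dd w) :
    ∃ u ∈ sp (Al (XX ∅ Γ Set.univ)), u ∈ Di (i+1) ∧ z = dd u := by
  have hz0 : z ∈ sp {σ : Sim (Fin (m+1)) M | ∀ v, σ.2 v ≠ none} := by
    refine Finsupp.supported_mono (fun σ hσ v => ?_) hz
    rw [ne_eq, ← ev_none σ.2 (vt 0)]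
    exact (hσ (vt 0)).1 v (Finset.notMem_empty _)
  -- the pieces
  let ww : Fin (m+1) → Ch (Fin (m+1)) M := fun s => rei (inl s) w
  have hw1 : ∀ s, ww s ∈ sp {σ : Sim (Fin (m+1)) M | ∀ v, σ.2 v = none ↔ v = s} := by
    intro s
    refine rei_sp _ (fun σ hσ v => ?_) hw
    simp only [ri]
    rcases Fin.eq_self_or_eq_succAbove s v with rfl | ⟨j, rfl⟩
    · simp [inl_same]
    · simp only [inl_above, Option.bind_some, Fin.succAbove_ne, iff_false]
      rw [← ev_none σ.2 (vt 0)]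
      exact (hσ (vt 0)).1 j (Finset.notMem_empty _)
  have hpz : ∀ s, rei (pks s) z = dd (ww s) := by
    intro s
    have h1 : rei (fun j => some (s.succAbove j)) z = dd w := by
      obtain ⟨h, hh⟩ := exists_perm_above s (Fin.last m) (Equiv.swap s (Fin.last m)) (by simp)
      have h2 := congrArg (act (M := M) h.symm) hzw
      rw [act, rei_rei, ← act, ← hzg (Equiv.swap s (Fin.last m)), act, rei_rei, act, rei_dd, ← act, hwg] at h2
      rw [← h2]
      congr 2
      funext j
      have := hh (h.symm j)
      simp only [Equiv.apply_symm_apply, Fin.succAbove_last] at this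
      simp [this]
    change _ = dd (rei (inl s) w)
    rw [← rei_dd, ← h1, rei_rei]
    congr 2
    funext v
    rcases Fin.eq_self_or_eq_succAbove s v with rfl | ⟨j, rfl⟩
    · simp [inl_same, pks]
    · simp [inl_above, pks]
  have hsym : ∀ s t, s ≠ t → rei (pks t) (ww s) = rei (pks s) (ww t) := by
    intro s t hst
    obtain ⟨h, hh⟩ := exists_perm_above s t (Equiv.swap s t) (by simp)
    change rei (pks t) (rei (inl s) w) = rei (pks s) (rei (inl t) w)
    nth_rw 2 [← hwg h]
    rw [act, rei_rei, rei_rei, rei_rei]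
    congr 2
    funext v
    by_cases h1 : v = t
    · subst h1
      simp [pks, inl_same, Ne.symm hst]
    · by_cases h2 : v = s
      · subst h2
        simp [pks, inl_same, h1]
      · obtain ⟨j, rfl⟩ := Fin.exists_succAbove_eq h1
        have h3 := hh j
        rw [Equiv.swap_apply_of_ne_of_ne h2 h1] at h3
        simp only [pks, Function.update_of_ne h1, Function.update_of_ne h2, Option.bind_some, inl_above]
        rw [← h3, inl_above]
  set x : Ch (Fin (m+1)) M := z + ∑ s, ww s with hx
  have hDx : DD Finset.univ x = 0 := by
    rw [DD_apply, hx, map_add, hdz, zero_add, map_add, map_sum, map_sum, map_sum, PP_unp hz0]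
    have e1 : ∀ s, Ep (dd (ww s)) = - rei (pks s) z := by
      intro s
      rw [Ep_one (s := s) (dd_sp_pat (fun p => ∀ v, p v ↔ v = s) (hw1 s)), hpz]
    have e2 : ∑ s, PP Finset.univ (ww s) = 0 := by
      have : ∀ s, PP Finset.univ (ww s) =
          ∑ t, (if t = s then (0:ℚ) else if s < t then -1 else 1) • rei (pks t) (ww s) :=
        fun s => PP_one (hw1 s)
      simp only [this]
      have h2 : ∑ s, ∑ t, (if t = s then (0:ℚ) else if s < t then -1 else 1) • rei (pks t) (ww s)
          = - ∑ s, ∑ t, (if t = s then (0:ℚ) else if s < t then -1 else 1) • rei (pks t) (ww s) := by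
        conv_lhs => rw [Finset.sum_comm]
        rw [← Finset.sum_neg_distrib]
        refine Finset.sum_congr rfl (fun s _ => ?_)
        rw [← Finset.sum_neg_distrib]
        refine Finset.sum_congr rfl (fun t _ => ?_)
        by_cases hst : s = t
        · subst hst; simp
        · rw [hsym t s (Ne.symm hst), if_neg hst, if_neg (Ne.symm hst), ← neg_smul]
          congr 1
          rcases lt_or_gt_of_ne hst with h | h
          · rw [if_pos h, if_neg (not_lt.2 h.le)]; norm_num
          · rw [if_pos h, if_neg (not_lt.2 h.le)]
      exact self_eq_neg.1 h2
    rw [Finset.sum_congr rfl (fun s _ => e1 s), e2, Finset.sum_neg_distrib]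
    simp
  have hxA : x ∈ sp (Al (XX Finset.univ Γ Set.univ)) := by
    refine Submodule.add_mem _ (Finsupp.supported_mono (Al_mono ?_) hz) (Submodule.sum_mem _ (fun s _ => ?_))
    · intro y hy
      exact ⟨fun v h => absurd (Finset.mem_univ v) h, fun a b hab => hy.2.1 a b (hΓ hab), trivial⟩
    · refine rei_Al _ (fun y hy => ?_) hw
      refine ⟨fun v h => absurd (Finset.mem_univ v) h, fun a b hab p hp hp' => ?_, trivial⟩
      simp only [ri] at hp hp'
      rcases Fin.eq_self_or_eq_succAbove s a with rfl | ⟨j, rfl⟩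
      · simp [inl_same] at hp
      rcases Fin.eq_self_or_eq_succAbove s b with rfl | ⟨k, rfl⟩
      · simp [inl_same] at hp'
      rw [inl_above] at hp hp'
      have hjk : (j, k) ∈ offd (Fin m) := fun h => hΓ hab (by simp only at h ⊢; rw [h])
      exact hy.2.1 j k hjk p hp hp'
  have hxG : x ∈ Gr (i : ℤ) := by
    refine Submodule.add_mem _ ?_ (Submodule.sum_mem _ (fun s _ => ?_))
    · refine Finsupp.supported_mono ?_ (sp_inter hz0 hzi)
      rintro ⟨n, σ⟩ ⟨h1, h2⟩
      have h2 : n = i := h2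
      have : nopark σ = 0 := by
        rw [nopark, Finset.card_eq_zero, Finset.filter_eq_empty_iff]
        exact fun v _ => h1 v
      simp [deg, this, h2]
    · refine Finsupp.supported_mono ?_ (sp_inter (hw1 s) (rei_Di _ hwi))
      rintro ⟨n, σ⟩ ⟨h1, h2⟩
      have h2 : n = i+1 := h2
      have h1 : ∀ v, σ v = none ↔ v = s := h1
      have : nopark σ = 1 := by
        rw [nopark, Finset.card_eq_one]
        exact ⟨s, by ext v; simp [h1]⟩
      simp [deg, this, h2]
  obtain ⟨e, -, heA, hen, hxe⟩ := hA x trivial hxA hxG (by rw [hDx]; exact Submodule.zero_mem _)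
  have hxe : x = DD Finset.univ e := by
    rw [sp, Finsupp.supported_empty, Submodule.mem_bot, sub_eq_zero] at hxe
    exact hxe
  -- split
  have hsub : Al (XX Finset.univ Γ Set.univ) ⊆ {σ : Sim (Fin (m+1)) M | ∀ v, σ.2 v ≠ none} ∪
      {σ : Sim (Fin (m+1)) M | ¬ ∀ v, σ.2 v ≠ none} := fun σ _ => em _
  obtain ⟨e1, -, e2, -, hee, he1, he2, heD⟩ := split_sp hsub heA (Restr_top _) trivial
  refine ⟨e1, ?_, ?_, ?_⟩
  · refine Finsupp.supported_mono ?_ (sp_inter he1 (heD _ heA).1)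
    rintro σ ⟨h1, h2⟩ t
    exact ⟨fun v _ => by rw [ne_eq, ev_none]; exact h1 v, (h2 t).2⟩
  · refine Finsupp.supported_mono ?_ (sp_inter he1 (heD _ hen).1)
    rintro ⟨n, σ⟩ ⟨h1, h2⟩
    have h2 : deg _ = _ := h2
    have : nopark σ = 0 := by
      rw [nopark, Finset.card_eq_zero, Finset.filter_eq_empty_iff]
      exact fun v _ => h1 v
    simp [deg, this] at h2
    change n = i+1
    exact_mod_cast h2
  · have hA0 : z - dd e1 ∈ sp {σ : Sim (Fin (m+1)) M | ∀ v, σ.2 v ≠ none} :=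
      Submodule.sub_mem _ hz0 (dd_sp_pat (fun p => ∀ v, ¬ p v) he1)
    have hPk : ∀ y : Ch (Fin (m+1)) M, PP Finset.univ y ∈ sp {σ : Sim (Fin (m+1)) M | ¬ ∀ v, σ.2 v ≠ none} := by
      intro y
      have hy : y ∈ sp Set.univ := by simp [sp]
      refine supp_map _ _ _ (fun σ _ => ?_) hy
      rw [PP_bs]
      refine Submodule.sum_mem _ (fun s _ => ?_)
      split_ifs
      · exact Submodule.zero_mem _
      · refine Submodule.smul_mem _ _ (supp_bs (fun h => h s ?_))
        simp [park]
    have hA1 : z - dd e1 ∈ sp {σ : Sim (Fin (m+1)) M | ¬ ∀ v, σ.2 v ≠ none} := by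
      have : z - dd e1 = Ep (dd e2) + PP Finset.univ e - ∑ s, ww s := by
        have h1 : Ep (dd e1) = dd e1 := Ep_unp (dd_sp_pat (fun p => ∀ v, ¬ p v) he1)
        have h2 : z + ∑ s, ww s = Ep (dd e) + PP Finset.univ e := by rw [← hx, hxe, DD_apply]
        rw [eq_sub_iff_add_eq, sub_add_eq_add_sub, h2]
        rw [hee, map_add, map_add, h1]
        abel
      rw [this]
      refine Submodule.sub_mem _ (Submodule.add_mem _ (Ep_sp _ _ ?_) (hPk e)) (Submodule.sum_mem _ (fun s _ => ?_))
      · exact dd_sp_pat (fun p => ¬ ∀ v, ¬ p v) he2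
      · refine Finsupp.supported_mono ?_ (hw1 s)
        intro σ hσ h
        exact h s ((hσ s).2 rfl)
    have := sp_inter hA0 hA1
    have e0 : {σ : Sim (Fin (m+1)) M | ∀ v, σ.2 v ≠ none} ∩ {σ : Sim (Fin (m+1)) M | ¬ ∀ v, σ.2 v ≠ none} = ∅ := by
      ext σ; simp
    rw [e0, sp, Finsupp.supported_empty, Submodule.mem_bot, sub_eq_zero] at this
    exact this

/-- The key statement, independent of the dimension. -/
def KEY (M : Type) [TopologicalSpace M] [Inhabited M] (i m : ℕ) : Prop :=
  ∀ z : Ch (Fin (m+1)) M, z ∈ sp (Al (XX ∅ (offd _) Set.univ)) → z ∈ Di i → (∀ g, act g z = z) → dd z = 0 →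
  ∀ w : Ch (Fin m) M, w ∈ sp (Al (XX ∅ (offd _) Set.univ)) → w ∈ Di (i+1) → (∀ g, act g w = w) →
  rei (fun j => some j.castSucc) z = dd w →
  ∃ u ∈ sp (Al (XX ∅ (offd (Fin (m+1))) Set.univ)), u ∈ Di (i+1) ∧ z = dd u

theorem KEY_two [T2Space M] [PathConnectedSpace M] (hcb : CBase M) (hpb : PBase M) {i m : ℕ} (h : 2 * i + 1 ≤ m) :
    KEY M i m := by
  intro z hz hzi hzg hdz w hw hwi hwg hzw
  refine key_of_acy (Γ := offd _) subset_rfl ?_ hz hzi hzg hdz hw hwi hwg hzw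
  have := acyV1 hcb hpb _ (Finset.univ.filter (fun p : Fin (m+1) × Fin (m+1) => p.1 ≠ p.2)) rfl
    (fun p hp => (Finset.mem_filter.1 hp).2) Finset.univ Set.univ isOpen_univ (fun _ _ _ _ => trivial) i
    (by simp; lia)
  have e : offd (Fin (m+1)) = ((Finset.univ.filter (fun p : Fin (m+1) × Fin (m+1) => p.1 ≠ p.2) : Finset _) : Set _) := by
    ext p; simp [offd]
  rw [e]
  exact this

end key

end
end CFS

set_option linter.unusedSectionVars false
set_option linter.unusedSimpArgs false

namespace CFS
noncomputable section

variable {V M : Type} [TopologicalSpace M] [Fintype V] [LinearOrder V]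

/-- invariants under a permutation -/
def Inv (s : Equiv.Perm V) : Submodule ℚ (Ch V M) := LinearMap.eqLocus (act s) LinearMap.id

lemma mem_Inv {s : Equiv.Perm V} {x : Ch V M} : x ∈ Inv s ↔ act s x = x := Iff.rfl

/-- action on points -/
def pa {α : Type} (s : Equiv.Perm V) (y : V → α) : V → α := fun v => y (s v)

lemma act_bs (s : Equiv.Perm V) {n : ℕ} (σ : V → Option C(Dl n, M)) :
    act s (bs ⟨n, σ⟩) = bs (⟨n, pa s σ⟩ : Sim V M) := rei_bs _ _

lemma act_ps (s : Equiv.Perm V) {Q : Type} [TopologicalSpace Q] [Afn Q] (σ : V → Option C(Q, M))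
    (m : ℕ) (x : LC m Q) : act s (ps σ m x) = ps (pa s σ) m x := rei_ps _ _ _ _

lemma ev_pa (s : Equiv.Perm V) {Q : Type} [TopologicalSpace Q] (σ : V → Option C(Q, M)) (t : Q) :
    ev (pa s σ) t = pa s (ev σ t) := rfl

lemma eps_pa (s : Equiv.Perm V) {α : Type} (σ : V → Option α) : eps (pa s σ) = eps σ := by
  unfold eps pa
  exact Equiv.prod_comp s (fun v => chi (σ v))

lemma Ep_act (s : Equiv.Perm V) (x : Ch V M) : Ep (act s x) = act s (Ep x) := by
  refine lin_ext_apply (f := Ep.comp (act s)) (g := (act s).comp Ep) ?_ x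
  rintro ⟨n, σ⟩
  rw [LinearMap.comp_apply, LinearMap.comp_apply, act_bs, Ep_bs, Ep_bs, map_smul, act_bs]
  dsimp only
  rw [eps_pa]

lemma DD_act (s : Equiv.Perm V) (x : Ch V M) : DD ∅ (act s x) = act s (DD ∅ x) := by
  rw [DD_apply, DD_apply, map_add]
  have h : ∀ z : Ch V M, PP ∅ z = 0 := fun z => by
    refine lin_ext_apply (f := PP ∅) (g := 0) (fun σ => ?_) z
    rw [PP_bs]; simp
  rw [h, h, map_zero, add_zero, add_zero, ← Ep_act]
  congr 1
  exact (rei_dd _ _).symm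

lemma Sta_Inv (s : Equiv.Perm V) : Sta ∅ (Inv s : Submodule ℚ (Ch V M)) := by
  refine ⟨fun x hx => ?_, fun x hx => ?_, fun x hx => ?_⟩
  · rw [mem_Inv, ← DD_act, mem_Inv.1 hx]
  · rw [mem_Inv]
    exact (rei_SD _ _).trans (congrArg SD (mem_Inv.1 hx))
  · rw [mem_Inv]
    change act s (Ep (TT x)) = Ep (TT x)
    rw [← Ep_act]
    congr 1
    exact (rei_TT _ _).trans (congrArg TT (mem_Inv.1 hx))

open Classical in
lemma Restr_Inv {s : Equiv.Perm V} {Y : Set (V → Option M)} (h : ∀ y, pa s y ∈ Y ↔ y ∈ Y) :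
    Restr (Inv s) (Al Y : Set (Sim V M)) := by
  intro x hx
  have hA : ∀ σ : Sim V M, (⟨σ.1, pa s σ.2⟩ : Sim V M) ∈ Al Y ↔ σ ∈ Al Y := by
    rintro ⟨n, σ⟩
    exact forall_congr' (fun t => h (ev σ t))
  rw [mem_Inv]
  have key : ∀ z : Ch V M, act s (z.filter (· ∈ Al Y)) = (act s z).filter (· ∈ Al Y) := by
    intro z
    induction z using Finsupp.induction_linear with
    | zero => rw [show (Finsupp.filter (fun x => x ∈ Al Y) (0 : Ch V M)) = 0 from Finsupp.filter_zero _, map_zero]; exact (Finsupp.filter_zero _).symm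
    | add f g hf hg => rw [Finsupp.filter_add, map_add, hf, hg, map_add, Finsupp.filter_add]
    | single σ r =>
      have hs : (Finsupp.single σ r : Ch V M) = r • bs σ := by simp [bs]
      have hb : ∀ σ : Sim V M, ((bs σ).filter (· ∈ Al Y) : Ch V M) = if σ ∈ Al Y then bs σ else 0 := by
        intro σ
        split_ifs with h
        · exact Finsupp.filter_single_of_pos _ h
        · exact Finsupp.filter_single_of_neg _ h
      rw [hs, Finsupp.filter_smul, map_smul, map_smul, Finsupp.filter_smul, hb]
      congr 1
      obtain ⟨n, σ⟩ := σ
      rw [act_bs, hb]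
      have := hA ⟨n, σ⟩
      dsimp only at this
      split_ifs with h1 h2 h2
      · rw [act_bs]
      · exact absurd (this.2 h1) h2
      · exact absurd (this.1 h2) h1
      · simp
  rw [key, mem_Inv.1 hx]

lemma Hty.nat {s : Equiv.Perm V} {F F' : Finset V} {X X' : Set (V → Option M)}
    {c c' : (V → Option M) → Dl 1 → (V → Option M)} (h : Hty F X c) (h' : Hty F' X' c')
    (hX : ∀ y ∈ X', pa s y ∈ X) (hc : ∀ y ∈ X', ∀ u, c (pa s y) u = pa s (c' y u))
    {x : Ch V M} (hx : x ∈ sp (Al X')) :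
    HH c (act s x) = act s (HH c' x) ∧ PE c (act s x) = act s (PE c' x) := by
  have hh : ∀ (n : ℕ) (σ : V → Option C(Dl n, M)), (∀ t, ev σ t ∈ X') →
      hat c (pa s σ) = pa s (hat c' σ) := by
    intro n σ hσ
    refine ev_ext (fun t => ?_)
    have h1 : ∀ t, ev (pa s σ) t ∈ X := fun t => hX _ (hσ t)
    rw [h.ev_hat h1, ev_pa, ev_pa, h'.ev_hat hσ, hc _ (hσ _)]
  constructor
  · have : ((HH c).comp (act s) - (act s).comp (HH c') : Ch V M →ₗ[ℚ] Ch V M) x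
        ∈ (⊥ : Submodule ℚ (Ch V M)) := by
      refine supp_map _ _ _ ?_ hx
      rintro ⟨n, σ⟩ hσ
      rw [Submodule.mem_bot, LinearMap.sub_apply, LinearMap.comp_apply, LinearMap.comp_apply, act_bs,
        HH_bs, HH_bs, map_smul, act_ps, eps_pa, hh n σ hσ, sub_self]
    rw [Submodule.mem_bot, LinearMap.sub_apply, sub_eq_zero] at this
    exact this
  · have : ((PE c).comp (act s) - (act s).comp (PE c') : Ch V M →ₗ[ℚ] Ch V M) x
        ∈ (⊥ : Submodule ℚ (Ch V M)) := by
      refine supp_map _ _ _ ?_ hx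
      rintro ⟨n, σ⟩ hσ
      rw [Submodule.mem_bot, LinearMap.sub_apply, LinearMap.comp_apply, LinearMap.comp_apply, act_bs,
        PE_bs, PE_bs, act_bs, hh n σ hσ, sub_eq_zero]
      rfl
    rw [Submodule.mem_bot, LinearMap.sub_apply, sub_eq_zero] at this
    exact this

/-- abstract form of the local computation -/
lemma local_inv {s : Equiv.Perm V} (hs : s * s = 1) {X Y : Set (V → Option M)}
    {c₁ c₂ c₃ : (V → Option M) → Dl 1 → (V → Option M)}
    (h₁ : Hty ∅ X c₁) (h₂ : Hty ∅ X c₂) (h₃ : Hty ∅ Y c₃) (hYX : Y ⊆ X)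
    (sX : ∀ y ∈ X, pa s y ∈ X) (sY : ∀ y ∈ Y, pa s y ∈ Y)
    (n12 : ∀ y ∈ X, ∀ u, c₁ (pa s y) u = pa s (c₂ y u))
    (n3 : ∀ y ∈ Y, ∀ u, c₃ (pa s y) u = pa s (c₃ y u))
    (x1 : ∀ y ∈ X, ∀ u, c₁ y u ∈ X) (x2 : ∀ y ∈ X, ∀ u, c₂ y u ∈ X)
    (y3 : ∀ y ∈ Y, ∀ u, c₃ y u ∈ Y)
    (e1 : ∀ y ∈ X, c₁ y (vt 1) ∈ Y) (e2 : ∀ y ∈ X, c₂ y (vt 1) ∈ Y)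
    (k3 : ∀ (n : ℕ) (σ : V → Option C(Dl n, M)), (∀ t, ev σ t ∈ Y) →
      (∀ t, c₃ (ev σ t) (vt 1) = c₁ (ev σ t) (vt 1) ∧
        c₃ (pa s (ev σ t)) (vt 1) = c₂ (ev σ t) (vt 1)) ∨
      (∀ t, c₃ (ev σ t) (vt 1) = c₂ (ev σ t) (vt 1) ∧
        c₃ (pa s (ev σ t)) (vt 1) = c₁ (ev σ t) (vt 1))) (n : ℤ) :
    Acy ∅ (Inv s) (Al X) (Al Y) n := by
  have ss : ∀ {α : Type} (y : V → α), pa s (pa s y) = y := fun y => by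
    funext v
    have := congrArg (fun g : Equiv.Perm V => g v) hs
    exact congrArg y this
  have n21 : ∀ y ∈ X, ∀ u, c₂ (pa s y) u = pa s (c₁ y u) := fun y hy u => by
    have := n12 _ (sX y hy) u
    rw [ss] at this
    rw [this, ss]
  set H₁ : Ch V M →ₗ[ℚ] Ch V M := (1/2 : ℚ) • (HH c₁ + HH c₂) with hH1
  set P : Ch V M →ₗ[ℚ] Ch V M := (1/2 : ℚ) • (PE c₁ + PE c₂) with hP
  have main1 : ∀ x ∈ sp (Al X), DD ∅ (H₁ x) + H₁ (DD ∅ x) = P x - x := by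
    intro x hx
    have a1 := h₁.main hx
    have a2 := h₂.main hx
    have : DD ∅ (H₁ x) + H₁ (DD ∅ x) = (1/2 : ℚ) • ((DD ∅ (HH c₁ x) + HH c₁ (DD ∅ x)) +
        (DD ∅ (HH c₂ x) + HH c₂ (DD ∅ x))) := by
      simp only [hH1, LinearMap.smul_apply, LinearMap.add_apply, map_smul, map_add]
      module
    rw [this, a1, a2, hP, LinearMap.smul_apply, LinearMap.add_apply]
    module
  have HX : ∀ x ∈ sp (Al X), H₁ x ∈ sp (Al X) := fun x hx =>
    Submodule.smul_mem _ _ (Submodule.add_mem _ (h₁.HH_Al le_rfl x1 hx) (h₂.HH_Al le_rfl x2 hx))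
  have PY : ∀ x ∈ sp (Al X), P x ∈ sp (Al Y) := fun x hx =>
    Submodule.smul_mem _ _ (Submodule.add_mem _ (h₁.PE_Al le_rfl e1 hx) (h₂.PE_Al le_rfl e2 hx))
  have HN : ∀ x ∈ sp (Al X), x ∈ Inv s → H₁ x ∈ Inv s := fun x hx hN => by
    rw [mem_Inv] at *
    simp only [hH1, LinearMap.smul_apply, LinearMap.add_apply, map_smul, map_add]
    rw [← (h₁.nat h₂ sX n12 hx).1, ← (h₂.nat h₁ sX n21 hx).1, hN, add_comm]
  have PN : ∀ x ∈ sp (Al X), x ∈ Inv s → P x ∈ Inv s := fun x hx hN => by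
    rw [mem_Inv] at *
    simp only [hP, LinearMap.smul_apply, LinearMap.add_apply, map_smul, map_add]
    rw [← (h₁.nat h₂ sX n12 hx).2, ← (h₂.nat h₁ sX n21 hx).2, hN, add_comm]
  have cl : ∀ x, x ∈ sp (Al X) → DD ∅ x ∈ sp (Al X) := fun x hx => DD_Al _ h₁.cl hx
  have P3 : ∀ w ∈ sp (Al Y), w ∈ Inv s → PE c₃ w = P w := by
    intro w hw hN
    have key : ((PE c₃ + (PE c₃).comp (act s)) - (PE c₁ + PE c₂) : Ch V M →ₗ[ℚ] Ch V M) w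
        ∈ (⊥ : Submodule ℚ (Ch V M)) := by
      refine supp_map _ _ _ ?_ hw
      rintro ⟨k, σ⟩ hσ
      have hσ : ∀ t, ev σ t ∈ Y := hσ
      have hσX : ∀ t, ev σ t ∈ X := fun t => hYX (hσ t)
      have hσ' : ∀ t, ev (pa s σ) t ∈ Y := fun t => sY _ (hσ t)
      simp only [Submodule.mem_bot, LinearMap.sub_apply, LinearMap.comp_apply, LinearMap.add_apply,
        act_bs, PE_bs]
      rcases k3 k σ hσ with h | h
      · have a : pb (atE (vt 1)) (hat c₃ σ) = pb (atE (vt 1)) (hat c₁ σ) := ev_ext (fun t => by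
          rw [h₃.PE_ev hσ, h₁.PE_ev hσX, (h t).1])
        have b : pb (atE (vt 1)) (hat c₃ (pa s σ)) = pb (atE (vt 1)) (hat c₂ σ) := ev_ext (fun t => by
          rw [h₃.PE_ev hσ', h₂.PE_ev hσX, ev_pa, (h t).2])
        rw [a, b, sub_self]
      · have a : pb (atE (vt 1)) (hat c₃ σ) = pb (atE (vt 1)) (hat c₂ σ) := ev_ext (fun t => by
          rw [h₃.PE_ev hσ, h₂.PE_ev hσX, (h t).1])
        have b : pb (atE (vt 1)) (hat c₃ (pa s σ)) = pb (atE (vt 1)) (hat c₁ σ) := ev_ext (fun t => by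
          rw [h₃.PE_ev hσ', h₁.PE_ev hσX, ev_pa, (h t).2])
        rw [a, b, add_comm, sub_self]
    rw [Submodule.mem_bot, LinearMap.sub_apply, sub_eq_zero] at key
    simp only [LinearMap.comp_apply, LinearMap.add_apply, mem_Inv.1 hN] at key
    rw [hP, LinearMap.smul_apply, LinearMap.add_apply, ← key]
    module
  intro x hxN hx hxn hDx
  have hw0 : DD ∅ (DD ∅ x) = 0 := DD_DD _ _
  have hwN : DD ∅ x ∈ Inv s := (Sta_Inv s).hD _ hxN
  have m3 := h₃.main hDx
  rw [hw0, map_zero, add_zero, P3 _ hDx hwN] at m3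
  have m1 := main1 x hx
  have DP : DD ∅ (P x) = P (DD ∅ x) := by
    have m2 := main1 _ (cl x hx)
    rw [hw0, map_zero, add_zero] at m2
    have := congrArg (DD ∅) m1
    rw [map_add, DD_DD, zero_add, m2, map_sub] at this
    exact (sub_left_inj.1 this).symm
  have hH3 : HH c₃ (DD ∅ x) ∈ sp (Al Y) := h₃.HH_Al le_rfl y3 hDx
  have hmono : ∀ {z : Ch V M}, z ∈ sp (Al Y) → z ∈ sp (Al X) := fun hz =>
    Finsupp.supported_mono (Al_mono hYX) hz
  have hH3N : HH c₃ (DD ∅ x) ∈ Inv s := by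
    rw [mem_Inv, ← (h₃.nat h₃ sY n3 hDx).1, mem_Inv.1 hwN]
  set e := x + HH c₃ (DD ∅ x) - P x with he
  have heX : e ∈ sp (Al X) := Submodule.sub_mem _ (Submodule.add_mem _ hx (hmono hH3)) (hmono (PY x hx))
  have heN : e ∈ Inv s := Submodule.sub_mem _ (Submodule.add_mem _ hxN hH3N) (PN x hx hxN)
  have hDe : DD ∅ e = 0 := by
    rw [he, map_sub, map_add, m3, DP]; abel
  have hegr : e ∈ Gr n := by
    refine Submodule.sub_mem _ (Submodule.add_mem _ hxn ?_) ?_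
    · have := h₃.HH_Gr hDx (DD_Gr ∅ hxn)
      rwa [sub_add_cancel] at this
    · have : P x = x + (DD ∅ (H₁ x) + H₁ (DD ∅ x)) := by rw [m1]; abel
      rw [this]
      refine Submodule.add_mem _ hxn (Submodule.add_mem _ ?_ ?_)
      · have := DD_Gr ∅ (Submodule.smul_mem _ (1/2:ℚ) (Submodule.add_mem _ (h₁.HH_Gr hx hxn) (h₂.HH_Gr hx hxn)))
        rwa [add_sub_cancel_right] at this
      · have := (Submodule.smul_mem _ (1/2:ℚ) (Submodule.add_mem _ (h₁.HH_Gr (cl x hx) (DD_Gr ∅ hxn))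
          (h₂.HH_Gr (cl x hx) (DD_Gr ∅ hxn))))
        rwa [sub_add_cancel] at this
  refine ⟨- H₁ e, Submodule.neg_mem _ (HN e heX heN), Submodule.neg_mem _ (HX e heX),
    Submodule.neg_mem _ (Submodule.smul_mem _ (1/2:ℚ) (Submodule.add_mem _ (h₁.HH_Gr heX hegr)
      (h₂.HH_Gr heX hegr))), ?_⟩
  have m4 := main1 e heX
  rw [hDe, map_zero, add_zero] at m4
  have : x - DD ∅ (-H₁ e) = P e + P x - HH c₃ (DD ∅ x) := by
    rw [map_neg, sub_neg_eq_add, m4, he]; abel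
  rw [this]
  exact Submodule.sub_mem _ (Submodule.add_mem _ (PY e heX) (PY x hx)) hH3

end
end CFS

set_option linter.unusedSectionVars false
set_option linter.unusedSimpArgs false

namespace CFS
noncomputable section

variable {V M : Type} [TopologicalSpace M] [Fintype V] [LinearOrder V] [Inhabited M] [T2Space M]

structure LD (J : Set M) (e : M → ℝ) (e' : ℝ → M) : Prop where
  op : IsOpen J
  ce : ContinuousOn e J
  ce' : ContinuousOn e' (e '' J)
  inv : ∀ x ∈ J, e' (e x) = x
  cvx : Convex ℝ (e '' J)

def mix (e : M → ℝ) (e' : ℝ → M) (x p : M) (u : Dl 1) : M := e' ((1 - u.1 1) * e x + u.1 1 * e p)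

lemma mix_im {J : Set M} {e : M → ℝ} {e' : ℝ → M} (h : LD J e e') {x p : M} (hx : x ∈ J) (hp : p ∈ J)
    (u : Dl 1) : (1 - u.1 1) * e x + u.1 1 * e p ∈ e '' J := by
  have hu := dl_mem u
  have := h.cvx (Set.mem_image_of_mem e hx) (Set.mem_image_of_mem e hp) (a := 1 - u.1 1) (b := u.1 1)
    (by linarith [hu.2]) hu.1 (by ring)
  simpa using this

lemma mix_mem {J : Set M} {e : M → ℝ} {e' : ℝ → M} (h : LD J e e') {x p : M} (hx : x ∈ J) (hp : p ∈ J)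
    (u : Dl 1) : mix e e' x p u ∈ J := by
  obtain ⟨z, hz, hz'⟩ := mix_im h hx hp u
  rw [mix, ← hz', h.inv z hz]; exact hz

lemma e_mix {J : Set M} {e : M → ℝ} {e' : ℝ → M} (h : LD J e e') {x p : M} (hx : x ∈ J) (hp : p ∈ J)
    (u : Dl 1) : e (mix e e' x p u) = (1 - u.1 1) * e x + u.1 1 * e p := by
  obtain ⟨z, hz, hz'⟩ := mix_im h hx hp u
  rw [mix, ← hz', h.inv z hz]

lemma mix_0 {J : Set M} {e : M → ℝ} {e' : ℝ → M} (h : LD J e e') {x p : M} (hx : x ∈ J) :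
    mix e e' x p (vt 0) = x := by
  rw [mix, vt_val]; simp [h.inv x hx]

lemma mix_1 {J : Set M} {e : M → ℝ} {e' : ℝ → M} (h : LD J e e') {x p : M} (hp : p ∈ J) :
    mix e e' x p (vt 1) = p := by
  rw [mix, vt_val]; simp [h.inv p hp]

lemma mix_cont {J : Set M} {e : M → ℝ} {e' : ℝ → M} (h : LD J e e') {p : M} (hp : p ∈ J) {n : ℕ}
    {f : Dl n → M} (hf : Continuous f) (hfJ : ∀ t, f t ∈ J) :
    Continuous (fun q : Dl n × Dl 1 => mix e e' (f q.1) p q.2) := by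
  unfold mix
  refine h.ce'.comp_continuous ?_ (fun q => mix_im h (hfJ q.1) hp q.2)
  have h1 : Continuous (fun q : Dl n × Dl 1 => e (f q.1)) :=
    h.ce.comp_continuous (hf.comp continuous_fst) (fun q => hfJ q.1)
  have h2 : Continuous (fun q : Dl n × Dl 1 => q.2.1 1) :=
    (continuous_apply (1 : Fin 2)).comp (continuous_subtype_val.comp continuous_snd)
  exact ((continuous_const.sub h2).mul h1).add (h2.mul continuous_const)

def set2 (a b : V) (y : V → Option M) (p q : M) : V → Option M :=
  Function.update (Function.update y a (some p)) b (some q)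

lemma set2_a {a b : V} (hab : a ≠ b) (y : V → Option M) (p q : M) : set2 a b y p q a = some p := by
  simp [set2, hab]
lemma set2_b (a b : V) (y : V → Option M) (p q : M) : set2 a b y p q b = some q := by
  simp [set2]
lemma set2_v {a b v : V} (ha : v ≠ a) (hb : v ≠ b) (y : V → Option M) (p q : M) :
    set2 a b y p q v = y v := by
  simp [set2, ha, hb]

lemma mk_tau {Q : Type} [TopologicalSpace Q] (G : Q → V → Option M) (h : ∀ q v, G q v ≠ none)
    (hc : ∀ v, Continuous (fun q => (G q v).getD default)) :
    ∃ τ : V → Option C(Q, M), ∀ q, ev τ q = G q := by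
  refine ⟨fun v => some ⟨fun q => (G q v).getD default, hc v⟩, fun q => ?_⟩
  funext v
  obtain ⟨x, hx⟩ := Option.ne_none_iff_exists'.1 (h q v)
  simp [ev, hx]

/-- data for the local computation -/
structure Loc (Γ : Set (V × V)) (a b : V) (J : Set M) (Z : Set (V → M)) : Prop where
  ind : ∀ f g : V → M, (∀ v, v ≠ a → v ≠ b → f v = g v) → f ∈ Z → g ∈ Z
  adj : ∀ f ∈ Z, ∀ c, c ≠ a → c ≠ b → ((a, c) ∈ Γ ∨ (c, a) ∈ Γ ∨ (b, c) ∈ Γ ∨ (c, b) ∈ Γ) → f c ∉ J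

def OO (a b : V) (J : Set M) (Z : Set (V → M)) : Set (V → M) := {f | f a ∈ J ∧ f b ∈ J ∧ f ∈ Z}

lemma memX {Γ : Set (V × V)} (hΓ : Γ ⊆ offd V) {a b : V} (hab : a ≠ b) (h1 : (a, b) ∉ Γ)
    (h2 : (b, a) ∉ Γ)
    {J : Set M} {Z : Set (V → M)} (hL : Loc Γ a b J Z) {y : V → Option M} (hy : y ∈ XX ∅ Γ (OO a b J Z))
    {p q : M} (hp : p ∈ J) (hq : q ∈ J) : set2 a b y p q ∈ XX ∅ Γ (OO a b J Z) := by
  have fv : ∀ v, v ≠ a → v ≠ b → fill y v = fill (set2 a b y p q) v := fun v ha hb => by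
    rw [fill, fill, set2_v ha hb]
  have hab2 : ∀ v, v = a ∨ v = b → ∀ m, set2 a b y p q v = some m → m ∈ J := by
    rintro v (rfl | rfl) m hm
    · rw [set2_a hab] at hm; cases hm; exact hp
    · rw [set2_b] at hm; cases hm; exact hq
  have out : ∀ v, v ≠ a → v ≠ b →
      ((a, v) ∈ Γ ∨ (v, a) ∈ Γ ∨ (b, v) ∈ Γ ∨ (v, b) ∈ Γ) → ∀ m, set2 a b y p q v = some m → m ∉ J := by
    intro v ha hb hv m hm
    have := hL.adj _ hy.2.2.2.2 v ha hb hv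
    rw [set2_v ha hb] at hm
    rwa [fill, hm] at this
  refine ⟨fun v _ => ?_, fun c d hcd m hc hd => ?_, ?_, ?_, ?_⟩
  · by_cases ha : v = a
    · subst ha; rw [set2_a hab]; simp
    by_cases hb : v = b
    · subst hb; rw [set2_b]; simp
    rw [set2_v ha hb]; exact hy.1 v (Finset.notMem_empty _)
  · have hne : c ≠ d := hΓ hcd
    by_cases ca : c = a ∨ c = b
    · by_cases da : d = a ∨ d = b
      · rcases ca with rfl | rfl <;> rcases da with rfl | rfl
        · exact hne rfl
        · exact h1 hcd
        · exact h2 hcd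
        · exact hne rfl
      · push Not at da
        refine out d da.1 da.2 ?_ m hd (hab2 c ca m hc)
        rcases ca with rfl | rfl <;> tauto
    · push Not at ca
      by_cases da : d = a ∨ d = b
      · refine out c ca.1 ca.2 ?_ m hc (hab2 d da m hd)
        rcases da with rfl | rfl <;> tauto
      · push Not at da
        rw [set2_v ca.1 ca.2] at hc
        rw [set2_v da.1 da.2] at hd
        exact hy.2.1 c d hcd m hc hd
  · rw [fill, set2_a hab]; exact hp
  · rw [fill, set2_b]; exact hq
  · exact hL.ind _ _ fv hy.2.2.2.2

def cpq (a b : V) (e : M → ℝ) (e' : ℝ → M) (p q : M) (y : V → Option M) (u : Dl 1) : V → Option M :=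
  set2 a b y (mix e e' (fill y a) p u) (mix e e' (fill y b) q u)

lemma cpq_cont {Γ : Set (V × V)} {a b : V} (hab : a ≠ b) {J : Set M} {Z : Set (V → M)}
    {e : M → ℝ} {e' : ℝ → M} (h : LD J e e') {p q : M} (hp : p ∈ J) (hq : q ∈ J)
    {n : ℕ} {σ : V → Option C(Dl n, M)} (hσ : ∀ t, ev σ t ∈ XX ∅ Γ (OO a b J Z)) :
    ∃ τ : V → Option C(Dl n × Dl 1, M), ∀ r, ev τ r = cpq a b e e' p q (ev σ r.1) r.2 := by
  have fc : ∀ v, Continuous (fun t => fill (ev σ t) v) := fun v =>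
    (continuous_apply v).comp (fill_cont σ)
  refine mk_tau _ (fun r v => ?_) (fun v => ?_)
  · rw [cpq]
    by_cases ha : v = a
    · subst ha; rw [set2_a hab]; simp
    by_cases hb : v = b
    · subst hb; rw [set2_b]; simp
    rw [set2_v ha hb]; exact (hσ _).1 v (Finset.notMem_empty _)
  · simp only [cpq]
    by_cases ha : v = a
    · subst ha
      simp only [set2_a hab, Option.getD_some]
      exact mix_cont h hp (fc _) (fun t => (hσ t).2.2.1)
    by_cases hb : v = b
    · subst hb
      simp only [set2_b, Option.getD_some]
      exact mix_cont h hq (fc _) (fun t => (hσ t).2.2.2.1)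
    simp only [set2_v ha hb]
    exact (fc v).comp continuous_fst

lemma set2_self {Γ : Set (V × V)} {W : Set (V → M)} {a b : V} {y : V → Option M}
    (hy : y ∈ XX ∅ Γ W) : set2 a b y (fill y a) (fill y b) = y := by
  rw [set2, ← XX_some hy (Finset.notMem_empty _), ← XX_some hy (Finset.notMem_empty _)]
  simp

lemma cpq_pat {Γ : Set (V × V)} {W : Set (V → M)} {a b : V} (hab : a ≠ b) (e : M → ℝ) (e' : ℝ → M)
    (p q : M) {y : V → Option M} (hy : y ∈ XX ∅ Γ W) (u : Dl 1) (v : V) :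
    cpq a b e e' p q y u v = none ↔ y v = none := by
  have h1 := hy.1 v (Finset.notMem_empty _)
  by_cases ha : v = a
  · subst ha; rw [cpq, set2_a hab]; simp [h1]
  by_cases hb : v = b
  · subst hb; rw [cpq, set2_b]; simp [h1]
  rw [cpq, set2_v ha hb]

lemma cpq_ini {Γ : Set (V × V)} {a b : V} {J : Set M} {Z : Set (V → M)} {e : M → ℝ} {e' : ℝ → M}
    (h : LD J e e') (p q : M) {y : V → Option M} (hy : y ∈ XX ∅ Γ (OO a b J Z)) :
    cpq a b e e' p q y (vt 0) = y := by
  rw [cpq, mix_0 h hy.2.2.1, mix_0 h hy.2.2.2.1, set2_self hy]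

lemma FInd_empty (W : Set (V → M)) : FInd ∅ W := fun f g h hf => by
  rwa [← funext (fun v => h v (Finset.notMem_empty v))]

lemma pa_set2 {a b : V} (hab : a ≠ b) (y : V → Option M) (p q : M) :
    set2 a b (pa (Equiv.swap a b) y) q p = pa (Equiv.swap a b) (set2 a b y p q) := by
  funext v
  by_cases ha : v = a
  · subst ha; rw [set2_a hab, pa, Equiv.swap_apply_left, set2_b]
  by_cases hb : v = b
  · subst hb; rw [set2_b, pa, Equiv.swap_apply_right, set2_a hab]
  rw [set2_v ha hb, pa, pa, Equiv.swap_apply_of_ne_of_ne ha hb, set2_v ha hb]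

lemma pa_XX {s : Equiv.Perm V} {Γ : Set (V × V)} (hΓ : ∀ c d, (c, d) ∈ Γ → (s c, s d) ∈ Γ)
    {W : Set (V → M)} (hW : ∀ f ∈ W, pa s f ∈ W) {y : V → Option M} (hy : y ∈ XX ∅ Γ W) :
    pa s y ∈ XX ∅ Γ W :=
  ⟨fun v _ => hy.1 _ (Finset.notMem_empty _), fun c d hcd m hc hd => hy.2.1 _ _ (hΓ c d hcd) m hc hd,
    hW _ hy.2.2⟩

lemma OO_inv {Γ : Set (V × V)} {a b : V} {J : Set M} {Z : Set (V → M)} (hL : Loc Γ a b J Z) :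
    ∀ f ∈ OO a b J Z, pa (Equiv.swap a b) f ∈ OO a b J Z := by
  rintro f ⟨h1, h2, h3⟩
  refine ⟨?_, ?_, hL.ind f _ (fun v ha hb => ?_) h3⟩
  · rw [pa, Equiv.swap_apply_left]; exact h2
  · rw [pa, Equiv.swap_apply_right]; exact h1
  · rw [pa, Equiv.swap_apply_of_ne_of_ne ha hb]

lemma local_acy {Γ : Set (V × V)} (hΓ : Γ ⊆ offd V) {a b : V} (hab : a ≠ b) (g1 : (a, b) ∉ Γ)
    (g2 : (b, a) ∉ Γ) (hΓs : ∀ c d, (c, d) ∈ Γ → (Equiv.swap a b c, Equiv.swap a b d) ∈ Γ)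
    {J : Set M} {Z : Set (V → M)} (hL : Loc Γ a b J Z) {e : M → ℝ} {e' : ℝ → M} (h : LD J e e')
    (hJ : J.Nontrivial) (n : ℤ) :
    Acy ∅ (Inv (Equiv.swap a b)) (Al (XX ∅ Γ (OO a b J Z)))
      (Al (XX ∅ Γ (OO a b J Z ∩ {f | f a ≠ f b}))) n := by
  have einj : ∀ x ∈ J, ∀ y ∈ J, e x = e y → x = y := fun x hx y hy hxy => by
    rw [← h.inv x hx, hxy, h.inv y hy]
  obtain ⟨p, hp, q, hq, hpq⟩ : ∃ p ∈ J, ∃ q ∈ J, e p < e q := by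
    obtain ⟨p, hp, q, hq, hne⟩ := hJ
    rcases lt_trichotomy (e p) (e q) with h' | h' | h'
    · exact ⟨p, hp, q, hq, h'⟩
    · exact absurd (einj _ hp _ hq h') hne
    · exact ⟨q, hq, p, hp, h'⟩
  have hpqne : p ≠ q := fun h' => by rw [h'] at hpq; exact lt_irrefl _ hpq
  set X := XX ∅ Γ (OO a b J Z) with hX
  set Y := XX ∅ Γ (OO a b J Z ∩ {f | f a ≠ f b}) with hY
  have hYX : Y ⊆ X := XX_mono _ _ Set.inter_subset_left
  have hty : ∀ p ∈ J, ∀ q ∈ J, Hty ∅ X (cpq a b e e' p q) := fun p hp q hq =>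
    ⟨fun y hy u v => cpq_pat hab e e' p q hy u v, fun y _ s hs => absurd hs (Finset.notMem_empty _),
      fun y hy => cpq_ini h p q hy, XX_PkCl _ _ (FInd_empty _), fun n σ hσ => cpq_cont hab h hp hq hσ⟩
  have mem : ∀ p ∈ J, ∀ q ∈ J, ∀ y ∈ X, ∀ u, cpq a b e e' p q y u ∈ X := fun p hp q hq y hy u =>
    memX hΓ hab g1 g2 hL hy (mix_mem h hy.2.2.1 hp u) (mix_mem h hy.2.2.2.1 hq u)
  have memY : ∀ p ∈ J, ∀ q ∈ J, ∀ y ∈ X, ∀ u, mix e e' (fill y a) p u ≠ mix e e' (fill y b) q u →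
      cpq a b e e' p q y u ∈ Y := fun p hp q hq y hy u hne => by
    have := mem p hp q hq y hy u
    refine ⟨this.1, this.2.1, this.2.2, ?_⟩
    change fill _ a ≠ fill _ b
    rw [fill, fill, cpq, set2_a hab, set2_b]
    exact hne
  have memY1 : ∀ p ∈ J, ∀ q ∈ J, p ≠ q → ∀ y ∈ X, cpq a b e e' p q y (vt 1) ∈ Y :=
    fun p hp q hq hne y hy => memY p hp q hq y hy _ (by rwa [mix_1 h hp, mix_1 h hq])
  have nat : ∀ p q y u, cpq a b e e' p q (pa (Equiv.swap a b) y) u =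
      pa (Equiv.swap a b) (cpq a b e e' q p y u) := by
    intro p q y u
    rw [cpq, cpq, ← pa_set2 hab]
    congr 2
    · simp [fill, pa]
    · simp [fill, pa]
  let lt (y : V → Option M) : Prop := e (fill y a) < e (fill y b)
  classical
  let c₃ : (V → Option M) → Dl 1 → (V → Option M) := fun y u =>
    if lt y then cpq a b e e' p q y u else cpq a b e e' q p y u
  have c3p : ∀ y u, lt y → c₃ y u = cpq a b e e' p q y u := fun y u hy => if_pos hy
  have c3n : ∀ y u, ¬ lt y → c₃ y u = cpq a b e e' q p y u := fun y u hy => if_neg hy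
  have ltY : ∀ y ∈ Y, ¬ lt y → e (fill y b) < e (fill y a) := by
    intro y hy hlt
    refine lt_of_le_of_ne (not_lt.1 hlt) (fun h' => hy.2.2.2 ?_)
    exact (einj _ hy.2.2.1.2.1 _ hy.2.2.1.1 h').symm
  have ltpa : ∀ y ∈ Y, lt (pa (Equiv.swap a b) y) ↔ ¬ lt y := by
    intro y hy
    have : lt (pa (Equiv.swap a b) y) ↔ e (fill y b) < e (fill y a) := by simp [lt, fill, pa]
    rw [this]
    exact ⟨fun h1 h2 => lt_asymm h1 h2, ltY y hy⟩
  have dich : ∀ (n : ℕ) (σ : V → Option C(Dl n, M)), (∀ t, ev σ t ∈ Y) →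
      (∀ t, lt (ev σ t)) ∨ (∀ t, ¬ lt (ev σ t)) := by
    intro n σ hσ
    have fc : ∀ v, Continuous (fun t => fill (ev σ t) v) := fun v =>
      (continuous_apply v).comp (fill_cont σ)
    have ca : Continuous (fun t => e (fill (ev σ t) a)) :=
      h.ce.comp_continuous (fc a) (fun t => (hσ t).2.2.1.1)
    have cb : Continuous (fun t => e (fill (ev σ t) b)) :=
      h.ce.comp_continuous (fc b) (fun t => (hσ t).2.2.1.2.1)
    have o1 : IsOpen {t | lt (ev σ t)} := isOpen_lt ca cb
    have o2 : IsOpen {t | lt (ev σ t)}ᶜ := by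
      have : {t | lt (ev σ t)}ᶜ = {t | e (fill (ev σ t) b) < e (fill (ev σ t) a)} := by
        ext t
        exact ⟨ltY _ (hσ t), fun h1 (h2 : lt (ev σ t)) => lt_asymm (show e (fill (ev σ t) b) < e (fill (ev σ t) a) from h1) h2⟩
      rw [this]; exact isOpen_lt cb ca
    have : PreconnectedSpace (Dl n) := by
      refine Subtype.preconnectedSpace (Convex.isPreconnected (convex_stdSimplex ℝ _))
    rcases isClopen_iff.1 ⟨⟨o2⟩, o1⟩ with h1 | h1
    · right
      intro t ht
      have : t ∈ {t | lt (ev σ t)} := ht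
      rw [h1] at this; exact this
    · left
      intro t
      have : t ∈ {t | lt (ev σ t)} := by rw [h1]; trivial
      exact this
  have hne_of : ∀ x ∈ J, ∀ y ∈ J, ∀ p ∈ J, ∀ q ∈ J, e x < e y → e p < e q → ∀ u,
      e (mix e e' x p u) < e (mix e e' y q u) := by
    intro x hx y hy p hp q hq h1 h2 u
    rw [e_mix h hx hp, e_mix h hy hq]
    have hu := dl_mem u
    rcases eq_or_lt_of_le hu.1 with h0 | h0
    · rw [← h0]; simpa using h1
    · nlinarith [hu.2, mul_pos h0 (sub_pos.2 h2), mul_nonneg (sub_nonneg.2 hu.2) (sub_pos.2 h1).le]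
  have y3 : ∀ y ∈ Y, ∀ u, c₃ y u ∈ Y := by
    intro y hy u
    by_cases hlt : lt y
    · rw [c3p y u hlt]
      refine memY p hp q hq y (hYX hy) u (fun h' => ?_)
      have := hne_of _ hy.2.2.1.1 _ hy.2.2.1.2.1 p hp q hq hlt hpq u
      rw [h'] at this; exact lt_irrefl _ this
    · rw [c3n y u hlt]
      refine memY q hq p hp y (hYX hy) u (fun h' => ?_)
      have := hne_of _ hy.2.2.1.2.1 _ hy.2.2.1.1 p hp q hq (ltY y hy hlt) hpq u
      rw [h'] at this; exact lt_irrefl _ this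
  have hty3 : Hty ∅ Y c₃ := by
    refine ⟨fun y hy u v => ?_, fun y _ s hs => absurd hs (Finset.notMem_empty _),
      fun y hy => ?_, XX_PkCl _ _ (FInd_empty _), fun n σ hσ => ?_⟩
    · by_cases hlt : lt y
      · rw [c3p y u hlt]; exact cpq_pat hab e e' p q hy u v
      · rw [c3n y u hlt]; exact cpq_pat hab e e' q p hy u v
    · by_cases hlt : lt y
      · rw [c3p y _ hlt]; exact cpq_ini h p q (hYX hy)
      · rw [c3n y _ hlt]; exact cpq_ini h q p (hYX hy)
    · rcases dich n σ hσ with hd | hd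
      · obtain ⟨τ, hτ⟩ := cpq_cont hab h hp hq (fun t => hYX (hσ t))
        exact ⟨τ, fun r => by rw [hτ, c3p _ _ (hd _)]⟩
      · obtain ⟨τ, hτ⟩ := cpq_cont hab h hq hp (fun t => hYX (hσ t))
        exact ⟨τ, fun r => by rw [hτ, c3n _ _ (hd _)]⟩
  have sY : ∀ y ∈ Y, pa (Equiv.swap a b) y ∈ Y := by
    intro y hy
    refine pa_XX hΓs (fun f hf => ?_) hy
    refine ⟨OO_inv hL f hf.1, ?_⟩
    have : f a ≠ f b := hf.2
    simpa [pa] using Ne.symm this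
  have ind1 : ∀ p ∈ J, ∀ q ∈ J, ∀ y : V → Option M, cpq a b e e' p q (pa (Equiv.swap a b) y) (vt 1)
      = cpq a b e e' p q y (vt 1) := by
    intro p hp q hq y
    rw [cpq, cpq, mix_1 h hp, mix_1 h hq, mix_1 h hp, mix_1 h hq]
    funext v
    by_cases ha : v = a
    · subst ha; rw [set2_a hab, set2_a hab]
    by_cases hb : v = b
    · subst hb; rw [set2_b, set2_b]
    rw [set2_v ha hb, set2_v ha hb, pa, Equiv.swap_apply_of_ne_of_ne ha hb]
  refine local_inv (by simp) (hty p hp q hq) (hty q hq p hp) hty3 hYX (fun y hy => pa_XX hΓs (OO_inv hL) hy)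
    sY (fun y _ u => nat p q y u) (fun y hy u => ?_) (mem p hp q hq) (mem q hq p hp) y3
    (memY1 p hp q hq hpqne) (memY1 q hq p hp hpqne.symm) (fun n σ hσ => ?_) n
  · by_cases hlt : lt y
    · rw [c3n _ _ (fun h' => (ltpa y hy).1 h' hlt), c3p y u hlt, nat]
    · rw [c3p _ _ ((ltpa y hy).2 hlt), c3n y u hlt, nat]
  · rcases dich n σ hσ with hd | hd
    · left
      intro t
      refine ⟨c3p _ _ (hd t), ?_⟩
      rw [c3n _ _ (fun h' => (ltpa _ (hσ t)).1 h' (hd t)), ind1 q hq p hp]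
    · right
      intro t
      refine ⟨c3n _ _ (hd t), ?_⟩
      rw [c3p _ _ ((ltpa _ (hσ t)).2 (hd t)), ind1 p hp q hq]

end
end CFS

set_option linter.unusedSectionVars false
set_option linter.unusedSimpArgs false

namespace CFS
noncomputable section

variable {V M : Type} [TopologicalSpace M] [Fintype V] [LinearOrder V] [Inhabited M] [T2Space M]

def LBase (M : Type) [TopologicalSpace M] : Prop := ∀ (x : M) (U : Set M), IsOpen U → x ∈ U →
  ∃ B e e', LD B e e' ∧ x ∈ B ∧ B ⊆ U

/-- both coordinates `a`, `b` set to `x` -/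
def dset (a b : V) (f : V → M) (x : M) : V → M := Function.update (Function.update f a x) b x

lemma dset_ab {a b v : V} (h : v = a ∨ v = b) (f : V → M) (x : M) : dset a b f x v = x := by
  unfold dset
  by_cases hb : v = b
  · subst hb; simp
  · have ha : v = a := by tauto
    subst ha; simp [hb]

lemma dset_v {a b v : V} (ha : v ≠ a) (hb : v ≠ b) (f : V → M) (x : M) : dset a b f x v = f v := by
  simp [dset, ha, hb]

lemma dset_cont (a b c : V) : Continuous (fun f : V → M => dset a b f (f c)) :=
  (continuous_id.update a (continuous_apply c)).update b (continuous_apply c)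

lemma dset_self {a b : V} {f : V → M} (h : f a = f b) : dset a b f (f a) = f := by
  funext v
  by_cases hv : v = a ∨ v = b
  · rw [dset_ab hv]; rcases hv with rfl | rfl
    · rfl
    · exact h
  · push Not at hv; rw [dset_v hv.1 hv.2]

lemma dset_congr {a b : V} {f g : V → M} (h : ∀ v, v ≠ a → v ≠ b → f v = g v) (x : M) :
    dset a b f x = dset a b g x := by
  funext v
  by_cases hv : v = a ∨ v = b
  · rw [dset_ab hv, dset_ab hv]
  · push Not at hv; rw [dset_v hv.1 hv.2, dset_v hv.1 hv.2, h v hv.1 hv.2]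

lemma dset_dset {a b : V} (f : V → M) (x y : M) : dset a b (dset a b f x) y = dset a b f y :=
  dset_congr (fun _ ha hb => dset_v ha hb _ _) _

/-- symmetric thickening -/
def WW (a b : V) (U : Set (V → M)) : Set (V → M) :=
  {f | dset a b f (f a) ∈ U ∧ dset a b f (f b) ∈ U}

lemma WW_open (a b : V) {U : Set (V → M)} (hU : IsOpen U) : IsOpen (WW a b U) :=
  (hU.preimage (dset_cont a b a)).inter (hU.preimage (dset_cont a b b))

lemma WW_inv {a b : V} {U : Set (V → M)} (f : V → M) :
    pa (Equiv.swap a b) f ∈ WW a b U ↔ f ∈ WW a b U := by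
  have h : ∀ x, dset a b (pa (Equiv.swap a b) f) x = dset a b f x := fun x =>
    dset_congr (fun v ha hb => by rw [pa, Equiv.swap_apply_of_ne_of_ne ha hb]) x
  simp only [WW, Set.mem_ofPred_eq, h]
  rw [and_comm]
  simp [pa]

lemma WW_diag {a b : V} {U : Set (V → M)} {f : V → M} (h : f a = f b) : f ∈ WW a b U ↔ f ∈ U := by
  simp only [WW, Set.mem_ofPred_eq]
  rw [← h, dset_self h, and_self]

lemma pa_XX_iff {a b : V} {Γ : Set (V × V)}
    (hΓs : ∀ c d, (c, d) ∈ Γ → (Equiv.swap a b c, Equiv.swap a b d) ∈ Γ)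
    {W : Set (V → M)} (hW : ∀ f, pa (Equiv.swap a b) f ∈ W ↔ f ∈ W) (y : V → Option M) :
    pa (Equiv.swap a b) y ∈ XX ∅ Γ W ↔ y ∈ XX ∅ Γ W := by
  refine ⟨fun h => ?_, fun h => pa_XX hΓs (fun f hf => (hW f).2 hf) h⟩
  have := pa_XX hΓs (fun f hf => (hW f).2 hf) h
  have e : pa (Equiv.swap a b) (pa (Equiv.swap a b) y) = y := by funext v; simp [pa]
  rwa [e] at this

lemma sub_J {B : Set M} {e : M → ℝ} {e' : ℝ → M} (h : LD B e e') {x : M} (hx : x ∈ B) {G : Set M}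
    (hG : IsOpen G) (hxG : x ∈ G) : ∃ J, J ⊆ B ∧ IsOpen J ∧ x ∈ J ∧ J ⊆ G ∧ Convex ℝ (e '' J) := by
  have h1 : e' ⁻¹' G ∈ nhdsWithin (e x) (e '' B) := by
    have := h.ce' (e x) (Set.mem_image_of_mem e hx)
    exact this (hG.mem_nhds (by rw [h.inv x hx]; exact hxG))
  rw [Metric.mem_nhdsWithin_iff] at h1
  obtain ⟨ε, hε, h2⟩ := h1
  refine ⟨B ∩ e ⁻¹' (Metric.ball (e x) ε), Set.inter_subset_left,
    h.ce.isOpen_inter_preimage h.op Metric.isOpen_ball, ⟨hx, Metric.mem_ball_self hε⟩, ?_, ?_⟩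
  · rintro z ⟨hz, hz'⟩
    have := h2 ⟨hz', Set.mem_image_of_mem e hz⟩
    rwa [Set.mem_preimage, h.inv z hz] at this
  · have : e '' (B ∩ e ⁻¹' (Metric.ball (e x) ε)) = e '' B ∩ Metric.ball (e x) ε :=
      Set.image_inter_preimage _ _ _
    rw [this]
    exact h.cvx.inter (convex_ball _ _)

section
variable {Γ : Set (V × V)} {a b : V}

/-- relative acyclicity along the diagonal -/
def Rel (Γ : Set (V × V)) (a b : V) (W : Set (V → M)) : Prop :=
  ∀ n, Acy ∅ (Inv (Equiv.swap a b)) (Al (XX ∅ Γ W)) (Al (XX ∅ Γ (W ∩ {f | f a ≠ f b}))) n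

lemma Rel.ex (hΓs : ∀ c d, (c, d) ∈ Γ → (Equiv.swap a b c, Equiv.swap a b d) ∈ Γ)
    {W₁ W₂ : Set (V → M)} (o1 : IsOpen W₁) (o2 : IsOpen W₂)
    (i1 : ∀ f, pa (Equiv.swap a b) f ∈ W₁ ↔ f ∈ W₁) (i2 : ∀ f, pa (Equiv.swap a b) f ∈ W₂ ↔ f ∈ W₂)
    (h : ∀ f : V → M, f a = f b → (∀ c d, (c, d) ∈ Γ → f c ≠ f d) → (f ∈ W₁ ↔ f ∈ W₂))
    (h2 : Rel Γ a b W₂) : Rel Γ a b W₁ := by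
  intro n
  have hn := h2 n
  rw [← XX_ne] at hn ⊢
  refine excise_both (Sta_Inv _) (XX_IsOp _ _ o1) (XX_IsOp _ _ o2) (XX_IsOp _ _ (ne_open a b))
    (XX_PkCl _ _ (FInd_empty _))
    (XX_PkCl _ _ (FInd_empty _)) (XX_PkCl _ _ (FInd_empty _)) (Restr_Inv (fun y => ?_)) (fun y hy => ?_) hn
  · rw [Set.mem_inter_iff, Set.mem_inter_iff, pa_XX_iff hΓs i1, pa_XX_iff hΓs i2]
  · have : (∀ v, v ∉ (∅ : Finset V) → y v ≠ none) → fill y a = fill y b := by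
      intro h1
      by_contra h2
      exact hy ⟨h1, fun _ _ h => absurd h (Set.notMem_empty _), h2⟩
    have hv : (∀ v, v ∉ (∅ : Finset V) → y v ≠ none) →
        (∀ a b, (a, b) ∈ Γ → ∀ m, y a = some m → y b ≠ some m) → ∀ c d, (c, d) ∈ Γ → fill y c ≠ fill y d := by
      intro h1 h2 c d hcd he
      obtain ⟨x, hx⟩ := Option.ne_none_iff_exists'.1 (h1 c (Finset.notMem_empty _))
      obtain ⟨x', hx'⟩ := Option.ne_none_iff_exists'.1 (h1 d (Finset.notMem_empty _))
      refine h2 c d hcd x hx ?_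
      rw [hx']
      simp only [fill, hx, hx', Option.getD_some] at he
      rw [he]
    constructor
    · rintro ⟨y1, y2, y3⟩
      exact ⟨y1, y2, (h _ (this y1) (hv y1 y2)).1 y3⟩
    · rintro ⟨y1, y2, y3⟩
      exact ⟨y1, y2, (h _ (this y1) (hv y1 y2)).2 y3⟩

lemma Rel.empty : Rel Γ a b (∅ : Set (V → M)) := by
  intro n x _ hx _ _
  have : Al (XX ∅ Γ (∅ : Set (V → M))) = ∅ := by
    ext σ
    simp only [Set.mem_empty_iff_false, iff_false]
    intro h
    exact (h (vt 0)).2.2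
  rw [this] at hx
  have h0 : x = 0 := by simpa [sp] using hx
  subst h0
  exact ⟨0, Submodule.zero_mem _, Submodule.zero_mem _, Submodule.zero_mem _, by simp⟩

lemma Rel.union (hΓs : ∀ c d, (c, d) ∈ Γ → (Equiv.swap a b c, Equiv.swap a b d) ∈ Γ)
    {W₁ W₂ : Set (V → M)} (o1 : IsOpen W₁) (o2 : IsOpen W₂)
    (i1 : ∀ f, pa (Equiv.swap a b) f ∈ W₁ ↔ f ∈ W₁)
    (h1 : Rel Γ a b W₁) (h2 : Rel Γ a b W₂) (h3 : Rel Γ a b (W₁ ∩ W₂)) : Rel Γ a b (W₁ ∪ W₂) := by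
  intro n
  rw [← XX_ne, ← XX_union]
  have g1 := h1 n
  have g2 := h2 n
  have g3 := h3 (n-1)
  rw [← XX_ne] at g1 g2 g3
  rw [← XX_inter] at g3
  exact mv (Sta_Inv _) (XX_IsOp _ _ o1) (XX_IsOp _ _ o2) (XX_PkCl _ _ (FInd_empty _))
    (XX_PkCl _ _ (FInd_empty _)) (XX_PkCl _ _ (FInd_empty _)) (Restr_Inv (fun y => pa_XX_iff hΓs i1 y)) g1 g2 g3

lemma Rel.dir {S : Set (Set (V → M))} (hne : S.Nonempty) (hd : DirectedOn (· ⊆ ·) S)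
    (ho : ∀ U ∈ S, IsOpen U) (h : ∀ U ∈ S, Rel Γ a b U) : Rel Γ a b (⋃₀ S) := by
  intro n x hxN hx hxn hDx
  have : Nonempty S := hne.to_subtype
  rw [XX_sUnion] at hx
  obtain ⟨⟨U, hU⟩, hxU⟩ := directed_sp (fun W : S => XX ∅ Γ W.1) (fun W => XX_IsOp ∅ Γ (ho W.1 W.2))
    (by
      rintro ⟨U, hU⟩ ⟨U', hU'⟩
      obtain ⟨U'', hU'', h1, h2⟩ := hd U hU U' hU'
      exact ⟨⟨U'', hU''⟩, XX_mono _ _ h1, XX_mono _ _ h2⟩) hx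
  have hDU : DD ∅ x ∈ sp (Al (XX ∅ Γ (U ∩ {f | f a ≠ f b}))) := by
    have h1 : DD ∅ x ∈ sp (Al (XX ∅ Γ U)) := DD_Al _ (XX_PkCl _ _ (FInd_empty _)) hxU
    have := sp_Al_inter h1 hDx
    rw [XX_inter] at this
    have hsub : U ∩ (⋃₀ S ∩ {f | f a ≠ f b}) ⊆ U ∩ {f | f a ≠ f b} := fun f hf => ⟨hf.1, hf.2.2⟩
    exact Finsupp.supported_mono (Al_mono (XX_mono _ _ hsub)) this
  obtain ⟨y, hyN, hy, hyn, hxy⟩ := h U hU n x hxN hxU hxn hDU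
  exact ⟨y, hyN, Finsupp.supported_mono (Al_mono (XX_mono _ _ (Set.subset_sUnion_of_mem hU))) hy, hyn,
    Finsupp.supported_mono (Al_mono (XX_mono _ _
      (Set.inter_subset_inter_left _ (Set.subset_sUnion_of_mem hU)))) hxy⟩

theorem Rel.univ (hΓ : Γ ⊆ offd V) (hab : a ≠ b) (g1 : (a, b) ∉ Γ) (g2 : (b, a) ∉ Γ)
    (hΓs : ∀ c d, (c, d) ∈ Γ → (Equiv.swap a b c, Equiv.swap a b d) ∈ Γ)
    (hlb : LBase M) (hni : ∀ J : Set M, IsOpen J → J.Nonempty → J.Nontrivial) :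
    Rel Γ a b (Set.univ : Set (V → M)) := by
  let Φ : Set (V → M) → Prop := fun U => Rel Γ a b (WW a b U)
  have h0 : Φ ∅ := by
    have : WW a b (∅ : Set (V → M)) = ∅ := by ext; simp [WW]
    change Rel Γ a b _
    rw [this]; exact Rel.empty
  have hmv : ∀ U U', IsOpen U → IsOpen U' → Φ U → Φ U' → Φ (U ∩ U') → Φ (U ∪ U') := by
    intro U U' hU hU' h1 h2 h3
    have e : WW a b (U ∩ U') = WW a b U ∩ WW a b U' := by
      ext f; simp only [WW, Set.mem_inter_iff, Set.mem_ofPred_eq]; tauto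
    have h3 : Rel Γ a b (WW a b (U ∩ U')) := h3
    rw [e] at h3
    refine Rel.ex hΓs (WW_open a b (hU.union hU')) ((WW_open a b hU).union (WW_open a b hU')) WW_inv
      (fun f => or_congr (WW_inv f) (WW_inv f)) (fun f hf _ => ?_)
      (Rel.union hΓs (WW_open a b hU) (WW_open a b hU') WW_inv h1 h2 h3)
    rw [WW_diag hf, Set.mem_union, Set.mem_union, WW_diag hf, WW_diag hf]
  have hdir : ∀ S : Set (Set (V → M)), S.Nonempty → DirectedOn (· ⊆ ·) S → (∀ U ∈ S, IsOpen U) →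
      (∀ U ∈ S, Φ U) → Φ (⋃₀ S) := by
    intro S hne hd ho hS
    have op : ∀ U ∈ WW a b '' S, IsOpen U := by rintro _ ⟨U, hU, rfl⟩; exact WW_open a b (ho U hU)
    refine Rel.ex hΓs (WW_open a b (isOpen_sUnion ho)) (isOpen_sUnion op) WW_inv (fun f => ?_)
      (fun f hf _ => ?_) (Rel.dir (S := WW a b '' S) (hne.image _) ?_ op ?_)
    · simp only [Set.mem_sUnion, Set.exists_mem_image, WW_inv]
    · rw [WW_diag hf]
      simp only [Set.mem_sUnion, Set.exists_mem_image, WW_diag hf]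
    · rintro _ ⟨U, hU, rfl⟩ _ ⟨U', hU', rfl⟩
      obtain ⟨U'', hU'', k1, k2⟩ := hd U hU U' hU'
      exact ⟨_, ⟨U'', hU'', rfl⟩, fun f hf => ⟨k1 hf.1, k1 hf.2⟩, fun f hf => ⟨k2 hf.1, k2 hf.2⟩⟩
    · rintro _ ⟨U, hU, rfl⟩; exact hS U hU
  have inner : ∀ (B : Set M) (e : M → ℝ) (e' : ℝ → M), LD B e e' → ∀ U : Set (V → M), IsOpen U →
      U ⊆ {f | f a ∈ B} → Φ U := by
    intro B e e' hB U hU hUB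
    let adj (c : V) : Prop := c ≠ a ∧ c ≠ b ∧ ((a, c) ∈ Γ ∨ (c, a) ∈ Γ ∨ (b, c) ∈ Γ ∨ (c, b) ∈ Γ)
    let U₁ : Set (V → M) := {f | dset a b f (f a) ∈ U ∧ ∀ c, adj c → f c ≠ f a}
    have hU₁ : IsOpen U₁ := by
      have : U₁ = {f | dset a b f (f a) ∈ U} ∩ ⋂ c : V, {f | adj c → f c ≠ f a} := by
        ext f; simp [U₁]
      rw [this]
      refine (hU.preimage (dset_cont a b a)).inter (isOpen_iInter_of_finite (fun c => ?_))
      by_cases hc : adj c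
      · simp only [hc, forall_true_left]; exact ne_open c a
      · simp [hc]
    have red : Φ U₁ → Φ U := by
      refine Rel.ex hΓs (WW_open a b hU) (WW_open a b hU₁) WW_inv WW_inv (fun f hf hv => ?_)
      rw [WW_diag hf, WW_diag hf]
      simp only [U₁, Set.mem_ofPred_eq, dset_self hf]
      refine ⟨fun h => ⟨h, ?_⟩, fun h => h.1⟩
      rintro c ⟨-, -, hc | hc | hc | hc⟩
      · exact (hv _ _ hc).symm
      · exact hv _ _ hc
      · rw [hf]; exact (hv _ _ hc).symm
      · rw [hf]; exact hv _ _ hc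
    apply red
    let 𝓑 : Set (Set (V → M)) := {O | ∃ J Z, J ⊆ B ∧ IsOpen J ∧ Convex ℝ (e '' J) ∧ IsOpen Z ∧
      Loc Γ a b J Z ∧ O = {f | f a ∈ J ∧ f ∈ Z}}
    refine LTG Φ 𝓑 ?_ ?_ h0 ?_ hmv hdir U₁ ?_
    · rintro _ ⟨J, Z, -, hJ, -, hZ, -, rfl⟩
      exact (hJ.preimage (continuous_apply a)).inter hZ
    · rintro _ ⟨J, Z, hJB, hJ, hJc, hZ, hL, rfl⟩ _ ⟨J', Z', hJB', hJ', hJc', hZ', hL', rfl⟩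
      refine ⟨J ∩ J', Z ∩ Z', fun x hx => hJB hx.1, hJ.inter hJ', ?_, hZ.inter hZ', ⟨?_, ?_⟩, ?_⟩
      · have : e '' (J ∩ J') = e '' J ∩ e '' J' := by
          refine Set.image_inter_on (fun x hx y hy hxy => ?_)
          rw [← hB.inv x (hJB' hx), hxy, hB.inv y (hJB hy)]
        rw [this]; exact hJc.inter hJc'
      · exact fun f g h hf => ⟨hL.ind f g h hf.1, hL'.ind f g h hf.2⟩
      · exact fun f hf c ha hb hc h => hL.adj f hf.1 c ha hb hc h.1
      · ext f; simp only [Set.mem_inter_iff, Set.mem_ofPred_eq]; tauto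
    · rintro _ ⟨J, Z, hJB, hJ, hJc, hZ, hL, rfl⟩
      have e1 : WW a b {f | f a ∈ J ∧ f ∈ Z} = OO a b J Z := by
        ext f
        have hz : ∀ x, dset a b f x ∈ Z ↔ f ∈ Z := fun x =>
          ⟨fun h => hL.ind _ _ (fun v ha hb => dset_v ha hb _ _) h,
            fun h => hL.ind _ _ (fun v ha hb => (dset_v ha hb _ _).symm) h⟩
        simp only [WW, OO, Set.mem_ofPred_eq, hz, dset_ab (Or.inl rfl)]
        tauto
      change Rel Γ a b _
      rw [e1]
      rcases J.eq_empty_or_nonempty with h | h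
      · subst h
        have : OO a b (∅ : Set M) Z = ∅ := by ext; simp [OO]
        rw [this]; exact Rel.empty
      · exact fun n => local_acy hΓ hab g1 g2 hΓs hL (e := e) (e' := e') ⟨hJ, hB.ce.mono hJB,
          hB.ce'.mono (Set.image_mono hJB), fun x hx => hB.inv x (hJB hx), hJc⟩ (hni J hJ h) n
    · rintro x ⟨hx1, hx2⟩
      have hxB : x a ∈ B := by
        have := hUB hx1
        simpa [dset_ab] using this
      obtain ⟨I, G, hG, hGU⟩ := isOpen_pi_iff.1 hU _ hx1
      have sep : ∀ c, ∃ S T : Set M, IsOpen S ∧ IsOpen T ∧ x c ∈ S ∧ x a ∈ T ∧ (adj c → Disjoint S T) := by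
        intro c
        by_cases hc : adj c
        · obtain ⟨S, T, h1, h2, h3, h4, h5⟩ := t2_separation (hx2 c hc)
          exact ⟨S, T, h1, h2, h3, h4, fun _ => h5⟩
        · exact ⟨Set.univ, Set.univ, isOpen_univ, isOpen_univ, trivial, trivial, fun h => absurd h hc⟩
      choose S T hS hT hxS hxT hST using sep
      let G' : V → Set M := fun v => if v ∈ I then G v else Set.univ
      have hG'o : ∀ v, IsOpen (G' v) := fun v => by
        simp only [G']; split_ifs with h
        · exact (hG v h).1
        · exact isOpen_univ
      have hG'm : ∀ v, dset a b x (x a) v ∈ G' v := fun v => by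
        simp only [G']; split_ifs with h
        · exact (hG v h).2
        · trivial
      have hG'U : ∀ f : V → M, (∀ v, f v ∈ G' v) → f ∈ U := by
        intro f hf
        refine hGU (fun v hv => ?_)
        have := hf v
        simp only [G'] at this
        rwa [if_pos (Finset.mem_coe.1 hv)] at this
      have hxa : x a ∈ (G' a ∩ G' b) ∩ ⋂ c, T c := by
        refine ⟨⟨?_, ?_⟩, Set.mem_iInter.2 hxT⟩
        · simpa [dset_ab] using hG'm a
        · simpa [dset_ab] using hG'm b
      obtain ⟨J, hJB, hJ, hxJ, hJG, hJc⟩ := sub_J hB hxB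
        (((hG'o a).inter (hG'o b)).inter (isOpen_iInter_of_finite hT)) hxa
      let Z : Set (V → M) := {f | ∀ v, v ≠ a → v ≠ b → f v ∈ G' v ∩ S v}
      have hZo : IsOpen Z := by
        have : Z = ⋂ v : V, {f | v ≠ a → v ≠ b → f v ∈ G' v ∩ S v} := by ext f; simp [Z]
        rw [this]
        refine isOpen_iInter_of_finite (fun v => ?_)
        by_cases ha : v = a
        · simp [ha]
        by_cases hb : v = b
        · simp [hb]
        simp only [ne_eq, ha, hb, not_false_eq_true, forall_true_left]
        exact ((hG'o v).inter (hS v)).preimage (continuous_apply v)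
      have hL : Loc Γ a b J Z := by
        refine ⟨fun f g h hf v ha hb => ?_, fun f hf c ha hb hc hcJ => ?_⟩
        · rw [← h v ha hb]; exact hf v ha hb
        · exact Set.disjoint_left.1 (hST c ⟨ha, hb, hc⟩) (hf c ha hb).2 (Set.mem_iInter.1 (hJG hcJ).2 c)
      refine ⟨_, ⟨J, Z, hJB, hJ, hJc, hZo, hL, rfl⟩, ⟨hxJ, fun v ha hb => ⟨?_, hxS v⟩⟩, ?_⟩
      · have := hG'm v
        rwa [dset_v ha hb] at this
      · rintro f ⟨hfJ, hfZ⟩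
        refine ⟨hG'U _ (fun v => ?_), ?_⟩
        · by_cases ha : v = a
          · rw [dset_ab (Or.inl ha), ha]; exact (hJG hfJ).1.1
          by_cases hb : v = b
          · rw [dset_ab (Or.inr hb), hb]; exact (hJG hfJ).1.2
          rw [dset_v ha hb]; exact (hfZ v ha hb).1
        · rintro c ⟨ha, hb, hc⟩ he
          exact hL.adj f hfZ c ha hb hc (by rw [he]; exact hfJ)
  have hu : WW a b (Set.univ : Set (V → M)) = Set.univ := by ext; simp [WW]
  rw [← hu]
  refine LTG Φ {U | IsOpen U ∧ ∃ B e e', LD B e e' ∧ U ⊆ {f | f a ∈ B}} (fun U hU => hU.1) ?_ h0 ?_ hmv hdir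
    Set.univ ?_
  · rintro U ⟨hU, B, e, e', h1, h2⟩ U' ⟨hU', -⟩
    exact ⟨hU.inter hU', B, e, e', h1, fun f hf => h2 hf.1⟩
  · rintro U ⟨hU, B, e, e', h1, h2⟩
    exact inner B e e' h1 U hU h2
  · intro x _
    obtain ⟨B, e, e', h1, h2, -⟩ := hlb (x a) Set.univ isOpen_univ trivial
    exact ⟨{f | f a ∈ B}, ⟨h1.op.preimage (continuous_apply a), B, e, e', h1, le_rfl⟩, h2, Set.subset_univ _⟩

end
end
end CFS

set_option linter.unusedSectionVars false
set_option linter.unusedSimpArgs false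

namespace CFS
noncomputable section

variable {V M : Type} [TopologicalSpace M] [Fintype V] [LinearOrder V] [Inhabited M] [T2Space M]

def clq (C : Finset V) : Set (V × V) := {p | p.1 ≠ p.2 ∧ p.1 ∈ C ∧ p.2 ∈ C}

def gst (A : Finset V) (r : V) (B : Finset V) : Set (V × V) :=
  clq A ∪ {p | (p.1 = r ∧ p.2 ∈ B) ∨ (p.2 = r ∧ p.1 ∈ B)}

/-- permutations preserving a finset -/
def PG (C : Finset V) : Finset (Equiv.Perm V) := Finset.univ.filter (fun g => ∀ v, g v ∈ C ↔ v ∈ C)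

lemma act_Al {s : Equiv.Perm V} {Γ : Set (V × V)} (hΓ : ∀ c d, (c, d) ∈ Γ → (s c, s d) ∈ Γ)
    {x : Ch V M} (hx : x ∈ sp (Al (XX ∅ Γ Set.univ))) : act s x ∈ sp (Al (XX ∅ Γ Set.univ)) :=
  rei_Al _ (fun _ hy => pa_XX (W := Set.univ) hΓ (fun _ _ => trivial) hy) hx

lemma act_Gr (s : Equiv.Perm V) {n : ℤ} {x : Ch V M} (hx : x ∈ Gr n) : act s x ∈ Gr n := by
  refine rei_sp _ (fun σ hσ => ?_) hx
  have hσ : deg σ = n := hσ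
  change deg _ = n
  rw [← hσ]
  unfold deg nopark
  congr 2
  refine Finset.card_bij (fun v _ => s v) ?_ ?_ ?_
  · intro v hv; rw [Finset.mem_filter] at hv ⊢; exact ⟨Finset.mem_univ _, hv.2⟩
  · intro v _ w _ h; exact s.injective h
  · intro v hv; rw [Finset.mem_filter] at hv
    exact ⟨s.symm v, Finset.mem_filter.2 ⟨Finset.mem_univ _, by simpa [ri] using hv.2⟩, by simp⟩

lemma SDi_act (s : Equiv.Perm V) (k : ℕ) (x : Ch V M) : SD^[k] (act s x) = act s (SD^[k] x) := by
  induction k generalizing x with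
  | zero => rfl
  | succ k ih => rw [Function.iterate_succ_apply, Function.iterate_succ_apply, ← ih]; congr 1; exact (rei_SD _ _).symm

lemma SDi_add (k : ℕ) (x y : Ch V M) : SD^[k] (x + y) = SD^[k] x + SD^[k] y := by
  induction k generalizing x y with
  | zero => rfl
  | succ k ih => simp only [Function.iterate_succ_apply, map_add, ih]

/-- sum over the group -/
def av (C : Finset V) : Ch V M →ₗ[ℚ] Ch V M := ∑ g ∈ PG C, act g

lemma av_apply (C : Finset V) (x : Ch V M) : av C x = ∑ g ∈ PG C, act g x := by
  simp [av]

lemma PG_clq {C : Finset V} {g : Equiv.Perm V} (hg : g ∈ PG C) :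
    ∀ c d, (c, d) ∈ clq C → (g c, g d) ∈ clq C := by
  intro c d h
  have hg := (Finset.mem_filter.1 hg).2
  exact ⟨fun h' => h.1 (g.injective h'), (hg c).2 h.2.1, (hg d).2 h.2.2⟩

lemma swap_PG {C : Finset V} {a b : V} (ha : a ∈ C) (hb : b ∈ C) : Equiv.swap a b ∈ PG C := by
  refine Finset.mem_filter.2 ⟨Finset.mem_univ _, fun v => ?_⟩
  rw [Equiv.swap_apply_def]
  split_ifs with h1 h2
  · subst h1; simp [ha, hb]
  · subst h2; simp [ha, hb]
  · rfl

lemma av_act {C : Finset V} {s : Equiv.Perm V} (hs : s ∈ PG C) (x : Ch V M) : av C (act s x) = av C x := by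
  rw [av_apply, av_apply]
  have hs' := (Finset.mem_filter.1 hs).2
  refine Finset.sum_bij (fun g _ => s * g) ?_ ?_ ?_ ?_
  · intro g hg
    have hg' := (Finset.mem_filter.1 hg).2
    refine Finset.mem_filter.2 ⟨Finset.mem_univ _, fun v => ?_⟩
    rw [Equiv.Perm.mul_apply, hs', hg']
  · intro g _ g' _ h; exact mul_left_cancel h
  · intro g hg
    have hg' := (Finset.mem_filter.1 hg).2
    refine ⟨s⁻¹ * g, Finset.mem_filter.2 ⟨Finset.mem_univ _, fun v => ?_⟩, by simp⟩
    rw [← hs', ← Equiv.Perm.mul_apply, mul_inv_cancel_left, hg']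
  · intro g _; rw [act_act]

lemma av_Al {C : Finset V} {x : Ch V M} (hx : x ∈ sp (Al (XX ∅ (clq C) Set.univ))) :
    av C x ∈ sp (Al (XX ∅ (clq C) Set.univ)) := by
  rw [av_apply]
  exact Submodule.sum_mem _ (fun g hg => act_Al (PG_clq hg) hx)

lemma av_Gr {C : Finset V} {n : ℤ} {x : Ch V M} (hx : x ∈ Gr n) : av C x ∈ Gr n := by
  rw [av_apply]
  exact Submodule.sum_mem _ (fun g _ => act_Gr g hx)

lemma av_DD (C : Finset V) (x : Ch V M) : DD ∅ (av C x) = av C (DD ∅ x) := by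
  rw [av_apply, av_apply, map_sum]
  simp only [DD_act]

lemma av_SD (C : Finset V) (k : ℕ) (x : Ch V M) : SD^[k] (av C x) = av C (SD^[k] x) := by
  rw [av_apply, av_apply]
  rw [← Finset.sum_congr rfl (fun g _ => SDi_act g k x)]
  induction (PG C) using Finset.induction_on with
  | empty =>
    simp only [Finset.sum_empty]
    induction k with
    | zero => rfl
    | succ k ih => rw [Function.iterate_succ_apply, map_zero, ih]
  | insert a s ha ih => rw [Finset.sum_insert ha, Finset.sum_insert ha, SDi_add, ih]

lemma gst_full {A : Finset V} {r : V} (hr : r ∉ A) : gst A r A = clq (insert r A) := by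
  ext ⟨a, b⟩
  simp only [gst, clq, Set.mem_union, Set.mem_ofPred_eq, Finset.mem_insert]
  constructor
  · rintro (⟨h1, h2, h3⟩ | ⟨rfl, h⟩ | ⟨rfl, h⟩)
    · tauto
    · exact ⟨fun h' => hr (h' ▸ h), by tauto, by tauto⟩
    · exact ⟨fun h' => hr (h' ▸ h), by tauto, by tauto⟩
  · rintro ⟨h1, rfl | h2, rfl | h3⟩ <;> tauto

/-- boundaries after averaging -/
def BdA (C : Finset V) (n : ℤ) (b : Ch V M) : Prop :=
  b ∈ sp (Al (XX ∅ (clq C) Set.univ)) ∧ b ∈ Gr n ∧ DD ∅ b = 0 ∧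
    ∃ v ∈ sp (Al (XX ∅ (clq C) Set.univ)), v ∈ Gr (n+1) ∧ av C b = DD ∅ v

def SG (A : Finset V) (r : V) (B : Finset V) (n : ℤ) (x : Ch V M) : Prop :=
  ∃ y ∈ sp (Al (XX (M := M) ∅ (gst A r B) Set.univ)), y ∈ Gr (n+1) ∧ ∃ b, BdA (insert r A) n b ∧ x = DD ∅ y + b

lemma clq_offd (C : Finset V) : clq C ⊆ offd V := fun _ h => h.1

lemma SG_step (hlb : LBase M) (hni : ∀ J : Set M, IsOpen J → J.Nonempty → J.Nontrivial)
    {A : Finset V} {r : V} (hr : r ∉ A) {B : Finset V} (hB : B ⊆ A) {j : V} (hj : j ∈ A) {n : ℤ} {x : Ch V M}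
    (hx : x ∈ sp (Al (XX ∅ (offd V) Set.univ))) (hxn : x ∈ Gr n) (hdx : DD ∅ x = 0)
    (h : SG A r B n x) : SG A r (insert j B) n x := by
  obtain ⟨y, hy, hyn, b, hb, e⟩ := h
  have hjr : j ≠ r := fun h => hr (h ▸ hj)
  set C := insert r A with hC
  set Γ : Set (V × V) := clq C \ {(j, r), (r, j)} with hΓ
  have hjC : j ∈ C := Finset.mem_insert_of_mem hj
  have hrC : r ∈ C := Finset.mem_insert_self _ _
  have hcov : XX (M := M) ∅ (gst A r B) Set.univ ⊆ XX ∅ (gst A r (insert j B)) Set.univ ∪ XX ∅ Γ Set.univ := by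
    intro f hf
    by_cases hfj : f j = f r
    · right
      refine ⟨hf.1, ?_, trivial⟩
      rintro a b ⟨⟨h1, h2, h3⟩, h4⟩ p ha hb₁
      simp only [Set.mem_insert_iff, Set.mem_singleton_iff, Prod.mk.injEq, not_or, not_and] at h4
      simp only [hC, Finset.mem_insert] at h2 h3 h1
      have key : ∀ c ∈ A, c ≠ j → f c = some p → f r = some p → False := by
        intro c hc hcj h5 h6
        exact hf.2.1 c j (Or.inl ⟨hcj, hc, hj⟩) p h5 (hfj.trans h6)
      rcases h2 with rfl | h2
      · rcases h3 with rfl | h3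
        · exact h1 rfl
        · exact key b h3 (fun h => h4.2 rfl h) hb₁ ha
      · rcases h3 with rfl | h3
        · exact key a h2 (fun h => h4.1 h rfl) ha hb₁
        · exact hf.2.1 a b (Or.inl ⟨h1, h2, h3⟩) p ha hb₁
    · left
      refine ⟨hf.1, ?_, trivial⟩
      rintro a b (h | ⟨h1, h2⟩ | ⟨h1, h2⟩) p ha hb₁
      · exact hf.2.1 a b (Or.inl h) p ha hb₁
      · simp only [] at h1 h2; subst h1
        rcases Finset.mem_insert.1 h2 with rfl | h2
        · exact hfj (hb₁.trans ha.symm)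
        · exact hf.2.1 a b (Or.inr (Or.inl ⟨rfl, h2⟩)) p ha hb₁
      · simp only [] at h1 h2; subst h1
        rcases Finset.mem_insert.1 h2 with rfl | h2
        · exact hfj (ha.trans hb₁.symm)
        · exact hf.2.1 a b (Or.inr (Or.inr ⟨rfl, h2⟩)) p ha hb₁
  have hh_sub : XX (M := M) ∅ (gst A r (insert j B)) Set.univ ∩ XX ∅ Γ Set.univ ⊆ XX ∅ (clq C) Set.univ := by
    rintro f ⟨hf, hf'⟩
    refine ⟨hf.1, ?_, trivial⟩
    rintro a b hab p ha hb
    by_cases h4 : (a, b) ∈ ({(j, r), (r, j)} : Set (V × V))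
    · rcases h4 with h4 | h4
      · cases h4; exact hf.2.1 j r (Or.inr (Or.inr ⟨rfl, by simp⟩)) p ha hb
      · cases h4; exact hf.2.1 r j (Or.inr (Or.inl ⟨rfl, by simp⟩)) p ha hb
    · exact hf'.2.1 a b ⟨hab, h4⟩ p ha hb
  obtain ⟨k, hk⟩ := small (XX_IsOp ∅ (gst A r (insert j B)) isOpen_univ) (XX_IsOp ∅ Γ isOpen_univ) y
    (Finsupp.supported_mono (Al_mono hcov) hy)
  obtain ⟨y1, -, y2, -, hyy, hy1, hy2, hyD⟩ := split_sp subset_rfl hk (Restr_top _) trivial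
  have hyn1 := (hyD _ (SDi_Gr k hyn)).1
  have hyn2 := (hyD _ (SDi_Gr k hyn)).2
  obtain ⟨L, hL, hLA, hLG, -⟩ := iterT (V := V) (M := M) ∅ k
  have hLx := hL x
  rw [hdx, map_zero, sub_zero] at hLx
  have off_sub : ∀ {Γ' : Set (V × V)}, Γ' ⊆ offd V →
      XX (M := M) ∅ (offd V) Set.univ ⊆ XX ∅ Γ' Set.univ := fun h => XX_anti _ _ h
  have hgoff : gst A r (insert j B) ⊆ offd V := by
    refine subset_trans ?_ (clq_offd C)
    rw [← gst_full hr]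
    refine Set.union_subset_union_right _ ?_
    have : insert j B ⊆ A := Finset.insert_subset hj hB
    rintro p (⟨h1, h2⟩ | ⟨h1, h2⟩)
    · exact Or.inl ⟨h1, this h2⟩
    · exact Or.inr ⟨h1, this h2⟩
  have hgC : gst A r (insert j B) ⊆ clq C := by
    rw [hC, ← gst_full hr]
    refine Set.union_subset_union_right _ ?_
    have : insert j B ⊆ A := Finset.insert_subset hj hB
    rintro p (⟨h1, h2⟩ | ⟨h1, h2⟩)
    · exact Or.inl ⟨h1, this h2⟩
    · exact Or.inr ⟨h1, this h2⟩
  have eSD : SD^[k] x = DD ∅ y1 + DD ∅ y2 + SD^[k] b := by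
    rw [e, SDi_add, SDi_DD, hyy, map_add]
  have hd2 : DD ∅ y2 ∈ sp (Al (XX ∅ (clq C) Set.univ)) := by
    refine Finsupp.supported_mono (Al_mono hh_sub) (sp_Al_inter ?_ (DD_Al _ (XX_PkCl _ _ (FInd_empty _)) hy2))
    have : DD ∅ y2 = SD^[k] x - DD ∅ y1 - SD^[k] b := by rw [eSD]; abel
    rw [this]
    refine Submodule.sub_mem _ (Submodule.sub_mem _ ?_ ?_) ?_
    · exact Finsupp.supported_mono (Al_mono (off_sub hgoff)) (SDi_Al k hx)
    · exact DD_Al _ (XX_PkCl _ _ (FInd_empty _)) hy1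
    · exact Finsupp.supported_mono (Al_mono (XX_anti _ _ hgC)) (SDi_Al k hb.1)
  set s := Equiv.swap j r with hs
  have hsG : s ∈ PG C := swap_PG hjC hrC
  have hΓs : ∀ c d, (c, d) ∈ Γ → (s c, s d) ∈ Γ := by
    rintro c d ⟨h1, h2⟩
    refine ⟨PG_clq hsG c d h1, fun h3 => h2 ?_⟩
    have hss : ∀ v w, s v = w → v = s w := fun v w h => by rw [← h]; simp [hs]
    simp only [Set.mem_insert_iff, Set.mem_singleton_iff, Prod.mk.injEq] at h3 ⊢
    rcases h3 with ⟨h3, h4⟩ | ⟨h3, h4⟩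
    · right; exact ⟨by rw [hss _ _ h3]; simp [hs], by rw [hss _ _ h4]; simp [hs]⟩
    · left; exact ⟨by rw [hss _ _ h3]; simp [hs], by rw [hss _ _ h4]; simp [hs]⟩
  have hrel := Rel.univ (M := M) (Γ := Γ) (a := j) (b := r) (fun p hp => clq_offd C hp.1) hjr
    (fun h => h.2 (by simp)) (fun h => h.2 (by simp)) hΓs hlb hni
  have hh_sub2 : XX (M := M) ∅ Γ (Set.univ ∩ {f | f j ≠ f r}) = XX ∅ (clq C) Set.univ := by
    ext f
    constructor
    · intro hf
      refine ⟨hf.1, ?_, trivial⟩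
      rintro a b hab p ha hb
      have hfr : f j ≠ f r := by
        intro h
        apply hf.2.2.2
        simp only [fill, h]
      by_cases h4 : (a, b) ∈ ({(j, r), (r, j)} : Set (V × V))
      · rcases h4 with h4 | h4
        · cases h4; exact hfr (ha.trans hb.symm)
        · cases h4; exact hfr (hb.trans ha.symm)
      · exact hf.2.1 a b ⟨hab, h4⟩ p ha hb
    · intro hf
      refine ⟨hf.1, fun a b hab => hf.2.1 a b hab.1, trivial, ?_⟩
      intro h
      have h1 := XX_some hf (Finset.notMem_empty j)
      have h2 := XX_some hf (Finset.notMem_empty r)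
      have h : fill f j = fill f r := h
      exact hf.2.1 j r ⟨hjr, hjC, hrC⟩ _ h1 (by rw [h2, h])
  obtain ⟨e', -, he', hen', hee⟩ := hrel (n+1) (y2 + act s y2)
    (by
      rw [mem_Inv, map_add, act_act, hs, Equiv.swap_mul_self]
      have : act (1 : Equiv.Perm V) y2 = y2 := rei_some y2
      rw [this, add_comm])
    (Submodule.add_mem _ hy2 (act_Al hΓs hy2)) (Submodule.add_mem _ hyn2 (act_Gr s hyn2))
    (by rw [hh_sub2, map_add, DD_act]; exact Submodule.add_mem _ hd2 (act_Al (PG_clq hsG) hd2))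
  rw [hh_sub2] at hee
  set v := y2 + act s y2 - DD ∅ e' with hv
  have hvn : v ∈ Gr (n+1) := by
    refine Submodule.sub_mem _ (Submodule.add_mem _ hyn2 (act_Gr s hyn2)) ?_
    have := DD_Gr ∅ hen'
    rwa [add_sub_cancel_right] at this
  have hDv : DD ∅ v = DD ∅ y2 + act s (DD ∅ y2) := by
    rw [hv, map_sub, DD_DD, sub_zero, map_add, DD_act]
  refine ⟨y1 + L x, Submodule.add_mem _ hy1 (hLA _ _ (Finsupp.supported_mono (Al_mono (off_sub hgoff)) hx)),
    Submodule.add_mem _ hyn1 (hLG _ _ hxn), DD ∅ y2 + SD^[k] b, ⟨Submodule.add_mem _ hd2 (SDi_Al k hb.1), ?_, ?_, ?_⟩, ?_⟩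
  · have := DD_Gr ∅ hyn2
    rw [add_sub_cancel_right] at this
    exact Submodule.add_mem _ this (SDi_Gr k hb.2.1)
  · rw [map_add, DD_DD, ← SDi_DD, hb.2.2.1, zero_add]
    clear * -
    induction k with
    | zero => rfl
    | succ k ih => rw [Function.iterate_succ_apply, map_zero, ih]
  · obtain ⟨-, -, -, v', hv', hvn', hbv⟩ := hb
    refine ⟨(2⁻¹ : ℚ) • av C v + SD^[k] v', ?_, ?_, ?_⟩
    · exact Submodule.add_mem _ (Submodule.smul_mem _ _ (av_Al hee)) (SDi_Al k hv')
    · exact Submodule.add_mem _ (Submodule.smul_mem _ _ (av_Gr hvn)) (SDi_Gr k hvn')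
    · rw [map_add, map_add, map_smul, av_DD, hDv, map_add, av_act hsG, ← two_smul ℚ (av C (DD ∅ y2)), smul_smul,
        ← av_SD, hbv, SDi_DD]
      norm_num
      rfl
  · rw [map_add, hLx]
    have := eSD
    rw [this]; abel

lemma clq_step (hlb : LBase M) (hni : ∀ J : Set M, IsOpen J → J.Nonempty → J.Nontrivial)
    {n : ℤ} {x : Ch V M}
    (hx : x ∈ sp (Al (XX ∅ (offd V) Set.univ))) (hxn : x ∈ Gr n) (hdx : DD ∅ x = 0)
    (hxg : ∀ g, act g x = x)
    (h0 : ∃ y ∈ sp (Al (XX (M := M) ∅ (∅ : Set (V × V)) Set.univ)), y ∈ Gr (n+1) ∧ x = DD ∅ y) (C : Finset V) :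
    ∃ y ∈ sp (Al (XX (M := M) ∅ (clq C) Set.univ)), y ∈ Gr (n+1) ∧ x = DD ∅ y := by
  induction C using Finset.induction_on with
  | empty =>
    have : clq (∅ : Finset V) = ∅ := by ext; simp [clq]
    rw [this]; exact h0
  | insert r A hr ih =>
    obtain ⟨y, hy, hyn, e⟩ := ih
    have key : ∀ B : Finset V, B ⊆ A → SG A r B n x := by
      intro B
      induction B using Finset.induction_on with
      | empty =>
        intro _
        refine ⟨y, ?_, hyn, 0, ⟨Submodule.zero_mem _, Submodule.zero_mem _, map_zero _, 0, Submodule.zero_mem _,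
          Submodule.zero_mem _, by simp⟩, by rw [e, add_zero]⟩
        have : gst A r ∅ = clq A := by ext; simp [gst]
        rwa [this]
      | insert j B _ ihB =>
        intro h
        exact SG_step hlb hni hr (fun v hv => h (Finset.mem_insert_of_mem hv)) (h (Finset.mem_insert_self _ _))
          hx hxn hdx (ihB (fun v hv => h (Finset.mem_insert_of_mem hv)))
    obtain ⟨y1, hy1, hyn1, b, ⟨-, -, -, v, hv, hvn, hbv⟩, e1⟩ := key A subset_rfl
    rw [gst_full hr] at hy1
    set C := insert r A
    have hc : ((PG C).card : ℚ) ≠ 0 := by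
      rw [Nat.cast_ne_zero, Finset.card_ne_zero]
      exact ⟨1, Finset.mem_filter.2 ⟨Finset.mem_univ _, fun v => Iff.rfl⟩⟩
    refine ⟨((PG C).card : ℚ)⁻¹ • (av C y1 + v), Submodule.smul_mem _ _ (Submodule.add_mem _ (av_Al hy1) hv),
      Submodule.smul_mem _ _ (Submodule.add_mem _ (av_Gr hyn1) hvn), ?_⟩
    have : av C x = ((PG C).card : ℚ) • x := by
      rw [av_apply, Finset.sum_congr rfl (fun g _ => hxg g), Finset.sum_const, Nat.cast_smul_eq_nsmul]
    rw [map_smul, map_add, av_DD, ← hbv, ← map_add, ← e1, this, smul_smul, inv_mul_cancel₀ hc, one_smul]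

lemma unp_sp {Γ : Set (V × V)} {W : Set (V → M)} {x : Ch V M} (hx : x ∈ sp (Al (XX ∅ Γ W))) :
    x ∈ sp {σ : Sim V M | ∀ v, σ.2 v ≠ none} := by
  refine Finsupp.supported_mono (fun σ hσ v => ?_) hx
  rw [ne_eq, ← ev_none σ.2 (vt 0)]
  exact (hσ (vt 0)).1 v (Finset.notMem_empty _)

lemma DD_unp {x : Ch V M} (hx : x ∈ sp {σ : Sim V M | ∀ v, σ.2 v ≠ none}) : DD ∅ x = dd x := by
  have h : PP ∅ x = 0 := by
    refine lin_ext_apply (f := PP ∅) (g := 0) (fun σ => ?_) x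
    rw [PP_bs]; simp
  rw [DD_apply, h, add_zero]
  exact Ep_unp (dd_sp_pat (fun p => ∀ v, ¬ p v) hx)

lemma nopark_unp {α : Type} {σ : V → Option α} (h1 : ∀ v, σ v ≠ none) : nopark σ = 0 := by
  rw [nopark, Finset.card_eq_zero, Finset.filter_eq_empty_iff]
  exact fun v _ => h1 v

lemma Di_Gr {x : Ch V M} (hx : x ∈ sp {σ : Sim V M | ∀ v, σ.2 v ≠ none}) (n : ℕ) : x ∈ Di n ↔ x ∈ Gr (n : ℤ) := by
  constructor
  · intro h
    refine Finsupp.supported_mono ?_ (sp_inter hx h)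
    rintro ⟨k, σ⟩ ⟨h1, h2⟩
    have h2 : k = n := h2
    simp [deg, nopark_unp h1, h2]
  · intro h
    refine Finsupp.supported_mono ?_ (sp_inter hx h)
    rintro ⟨k, σ⟩ ⟨h1, h2⟩
    have h2 : deg _ = _ := h2
    simp [deg, nopark_unp h1] at h2
    exact h2

theorem KEY_one [PathConnectedSpace M] (hcb : CBase M) (hlb : LBase M)
    (hni : ∀ J : Set M, IsOpen J → J.Nonempty → J.Nontrivial) {i m : ℕ} (h : i ≤ m) : KEY M i m := by
  intro z hz hzi hzg hdz w hw hwi hwg hzw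
  obtain ⟨u, hu, hui, hzu⟩ := key_of_acy (Γ := ∅) (Set.empty_subset _)
    (acyV0 hcb _ Finset.univ rfl Set.univ isOpen_univ (fun _ _ _ _ => trivial) i (by simp; lia))
    hz hzi hzg hdz hw hwi hwg hzw
  obtain ⟨y, hy, hyn, e⟩ := clq_step hlb hni hz ((Di_Gr (unp_sp hz) i).1 hzi) (by rw [DD_unp (unp_sp hz), hdz]) hzg
    ⟨u, hu, by exact_mod_cast (Di_Gr (unp_sp hu) (i+1)).1 hui, by rw [DD_unp (unp_sp hu), hzu]⟩ Finset.univ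
  have ec : clq (Finset.univ : Finset (Fin (m+1))) = offd _ := by ext p; simp [clq, offd]
  rw [ec] at hy
  exact ⟨y, hy, (Di_Gr (unp_sp hy) (i+1)).2 (by exact_mod_cast hyn), by rw [e, DD_unp (unp_sp hy)]⟩

end
end CFS

set_option linter.unusedSectionVars false
set_option linter.unusedSimpArgs false

namespace CFS
noncomputable section

open scoped Manifold Topology

section geom
variable {E : Type} [NormedAddCommGroup E] [NormedSpace ℝ E] {M : Type} [TopologicalSpace M]

structure CN (B : Set M) (K : Set E) (e : M → E) (e' : E → M) : Prop where
  op : IsOpen B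
  ce : ContinuousOn e B
  ce' : ContinuousOn e' K
  mp : ∀ x ∈ B, e x ∈ K
  mp' : ∀ v ∈ K, e' v ∈ B
  li : ∀ x ∈ B, e' (e x) = x
  ri : ∀ v ∈ K, e (e' v) = v
  cvx : Convex ℝ K
  int : (interior K).Nonempty

def MBase (E : Type) [NormedAddCommGroup E] [NormedSpace ℝ E] (M : Type) [TopologicalSpace M] : Prop :=
  ∀ (x : M) (U : Set M), IsOpen U → x ∈ U → ∃ (B : Set M) (K : Set E) (e : M → E) (e' : E → M), CN B K e e' ∧ x ∈ B ∧ B ⊆ U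

lemma MBase_of {H : Type*} [TopologicalSpace H] (I : ModelWithCorners ℝ E H) [ChartedSpace H M] : MBase E M := by
  intro x U hU hx
  have h1 : (extChartAt I x).target ∈ 𝓝[Set.range I] (extChartAt I x x) := extChartAt_target_mem_nhdsWithin x
  have h2 : (extChartAt I x).symm ⁻¹' U ∈ 𝓝[Set.range I] (extChartAt I x x) := by
    have := (continuousAt_extChartAt_symm (I := I) x).preimage_mem_nhds (t := U)
      (by rw [extChartAt_to_inv]; exact hU.mem_nhds hx)
    exact mem_nhdsWithin_of_mem_nhds this
  obtain ⟨r, hr, hsub⟩ := Metric.mem_nhdsWithin_iff.1 (Filter.inter_mem h1 h2)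
  have hcr : Convex ℝ (Set.range I) := I.convex_range
  refine ⟨(extChartAt I x).source ∩ extChartAt I x ⁻¹' Metric.ball (extChartAt I x x) r,
    Metric.ball (extChartAt I x x) r ∩ Set.range I, extChartAt I x, (extChartAt I x).symm, ?_, ?_, ?_⟩
  · refine ⟨(continuousOn_extChartAt x).isOpen_inter_preimage (isOpen_extChartAt_source x) Metric.isOpen_ball,
      (continuousOn_extChartAt x).mono Set.inter_subset_left, ?_, ?_, ?_, ?_, ?_, ?_, ?_⟩
    · exact (continuousOn_extChartAt_symm x).mono (fun v hv => (hsub hv).1)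
    · rintro y ⟨hy, hy'⟩
      exact ⟨hy', ⟨_, rfl⟩⟩
    · intro v hv
      refine ⟨(extChartAt I x).map_target (hsub hv).1, ?_⟩
      rw [Set.mem_preimage, (extChartAt I x).right_inv (hsub hv).1]
      exact hv.1
    · rintro y ⟨hy, -⟩; exact (extChartAt I x).left_inv hy
    · intro v hv; exact (extChartAt I x).right_inv (hsub hv).1
    · exact (convex_ball _ _).inter hcr
    · rw [interior_inter, Metric.isOpen_ball.interior_eq]
      have hc : extChartAt I x x ∈ closure (interior (Set.range I)) := by
        rw [hcr.closure_interior_eq_closure_of_nonempty_interior I.nonempty_interior']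
        exact subset_closure ⟨_, rfl⟩
      exact mem_closure_iff.1 hc _ Metric.isOpen_ball (Metric.mem_ball_self hr)
  · exact ⟨mem_extChartAt_source x, Metric.mem_ball_self hr⟩
  · rintro y ⟨hy, hy'⟩
    have := (hsub ⟨hy', ⟨_, rfl⟩⟩).2
    rwa [Set.mem_preimage, (extChartAt I x).left_inv hy] at this

lemma CN.cball {B : Set M} {K : Set E} {e : M → E} {e' : E → M} (h : CN B K e e') : CBall B := by
  refine ⟨h.op, fun p hp => ⟨fun x u => e' ((1 - u) • e x + u • e p), ?_, ?_, ?_, ?_, ?_⟩⟩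
  · refine h.ce'.comp (f := fun q : M × ℝ => (1 - q.2) • e q.1 + q.2 • e p) ?_ ?_
    · have h1 : ContinuousOn (fun q : M × ℝ => e q.1) (B ×ˢ Set.Icc (0:ℝ) 1) :=
        h.ce.comp continuousOn_fst (fun q hq => hq.1)
      exact ((continuousOn_const.sub continuousOn_snd).smul h1).add (continuousOn_snd.smul continuousOn_const)
    · rintro ⟨x, u⟩ ⟨hx, hu⟩
      exact h.cvx (h.mp x hx) (h.mp p hp) (by linarith [hu.2]) hu.1 (by ring)
  · intro x hx; simp [h.li x hx]
  · intro x hx; simp [h.li p hp]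
  · intro u hu
    dsimp only
    rw [← add_smul]; simp [h.li p hp]
  · intro x hx u hu
    exact h.mp' _ (h.cvx (h.mp x hx) (h.mp p hp) (by linarith [hu.2]) hu.1 (by ring))

lemma MBase.cbase (h : MBase E M) : CBase M := by
  intro x U hU hx
  obtain ⟨B, K, e, e', hB, h1, h2⟩ := h x U hU hx
  exact ⟨B, hB.cball, h1, h2⟩

lemma CN.image {B : Set M} {K : Set E} {e : M → E} {e' : E → M} (h : CN B K e e') : e' '' K = B := by
  ext x; constructor
  · rintro ⟨v, hv, rfl⟩; exact h.mp' v hv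
  · intro hx; exact ⟨e x, h.mp x hx, h.li x hx⟩

lemma MBase.path (h : MBase E M) [ConnectedSpace M] : PathConnectedSpace M := by
  have : LocallyPathConnectedSpace M := by
    refine LocallyPathConnectedSpace.of_bases (p := fun x (B : Set M) => IsOpen B ∧ x ∈ B ∧ IsPathConnected B) (s := fun _ B => B) ?_
      (fun x B hB => hB.2.2)
    intro x
    refine ⟨fun U => ⟨fun hU => ?_, ?_⟩⟩
    · obtain ⟨V, hVU, hV, hxV⟩ := mem_nhds_iff.1 hU
      obtain ⟨B, K, e, e', hB, h1, h2⟩ := h x V hV hxV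
      refine ⟨B, ⟨hB.op, h1, ?_⟩, h2.trans hVU⟩
      rw [← hB.image]
      exact (hB.cvx.isPathConnected ⟨_, hB.mp x h1⟩).image' hB.ce'
    · rintro ⟨B, ⟨hB, hx, -⟩, hBU⟩
      exact Filter.mem_of_superset (hB.mem_nhds hx) hBU
  exact pathConnectedSpace_iff_connectedSpace.2 inferInstance

lemma lbase_of (L : E ≃L[ℝ] ℝ) (h : MBase E M) : LBase M := by
  intro x U hU hx
  obtain ⟨B, K, e, e', hB, h1, h2⟩ := h x U hU hx
  have him : (fun y => L (e y)) '' B = L '' K := by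
    ext t; constructor
    · rintro ⟨y, hy, rfl⟩; exact ⟨e y, hB.mp y hy, rfl⟩
    · rintro ⟨v, hv, rfl⟩; exact ⟨e' v, hB.mp' v hv, by simp only [hB.ri v hv]⟩
  refine ⟨B, fun y => L (e y), fun t => e' (L.symm t), ⟨hB.op, L.continuous.comp_continuousOn hB.ce, ?_, ?_, ?_⟩, h1, h2⟩
  · rw [him]
    refine hB.ce'.comp L.symm.continuous.continuousOn ?_
    rintro _ ⟨v, hv, rfl⟩
    simpa using hv
  · intro y hy; simp [hB.li y hy]
  · rw [him]; exact hB.cvx.linear_image L.toLinearEquiv.toLinearMap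

lemma convex_punct [FiniteDimensional ℝ E] (hd : 1 < Module.finrank ℝ E) {K : Set E} (hK : Convex ℝ K)
    (hi : (interior K).Nonempty) (p : E) : IsPathConnected (K \ {p}) := by
  borelize E
  have line : ∀ x, (line[ℝ, p, x]) ≠ ⊤ := by
    intro x h
    have h1 := finrank_vectorSpan_insert_le_set ℝ ({x} : Set E) p
    rw [vectorSpan_singleton, finrank_bot] at h1
    have h2 : vectorSpan ℝ ({p, x} : Set E) = ⊤ := by
      rw [← direction_affineSpan, h, AffineSubspace.direction_top]
    rw [h2, finrank_top] at h1
    lia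
  let μ := MeasureTheory.Measure.addHaar (G := E)
  have ex : ∀ x y, ∃ z ∈ K, z ∉ line[ℝ, p, x] ∧ z ∉ line[ℝ, p, y] := by
    intro x y
    by_contra! hc
    have hsub : interior K ⊆ (line[ℝ, p, x] : Set E) ∪ line[ℝ, p, y] := by
      intro z hz
      by_cases h : z ∈ line[ℝ, p, x]
      · exact Or.inl h
      · exact Or.inr (hc z (interior_subset hz) h)
    have h0 : μ (interior K) = 0 :=
      MeasureTheory.measure_mono_null hsub (MeasureTheory.measure_union_null
        (MeasureTheory.Measure.addHaar_affineSubspace μ _ (line x))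
        (MeasureTheory.Measure.addHaar_affineSubspace μ _ (line y)))
    exact (isOpen_interior.measure_pos μ hi).ne' h0
  have seg : ∀ x ∈ K, x ≠ p → ∀ z ∈ K, z ∉ line[ℝ, p, x] → JoinedIn (K \ {p}) x z := by
    intro x hx hxp z hz hzl
    apply JoinedIn.of_segment_subset
    intro w hw
    refine ⟨hK.segment_subset hx hz hw, ?_⟩
    rintro rfl
    obtain ⟨a, b, ha, hb, hab, h⟩ := hw
    have hb0 : b ≠ 0 := by
      rintro rfl
      rw [add_zero] at hab
      apply hxp
      rw [← h, hab]; simp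
    apply hzl
    have : z = AffineMap.lineMap w x (-(a/b)) := by
      rw [AffineMap.lineMap_apply_module]
      have ea : a = 1 - b := by linarith
      have hz : z = b⁻¹ • (w - a • x) := by
        rw [← h]; simp [smul_smul, inv_mul_cancel₀ hb0]
      rw [hz, smul_sub, smul_smul, sub_eq_add_neg, ← neg_smul]
      congr 2
      · field_simp; rw [ea]; ring
      · field_simp
    rw [this]
    exact AffineMap.lineMap_mem_affineSpan_pair _ _ _
  obtain ⟨x, hx, hx1, -⟩ := ex p p
  refine ⟨x, ⟨hx, fun h => hx1 ?_⟩, ?_⟩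
  · rw [Set.mem_singleton_iff.1 h]; exact left_mem_affineSpan_pair _ _ _
  · have hxp : x ≠ p := fun h => hx1 (by rw [h]; exact left_mem_affineSpan_pair _ _ _)
    rintro y ⟨hy, hyp⟩
    obtain ⟨z, hz, h1, h2⟩ := ex x y
    exact (seg x hx hxp z hz h1).trans (seg y hy hyp z hz h2).symm

lemma pbase_of [FiniteDimensional ℝ E] (hd : 1 < Module.finrank ℝ E) (h : MBase E M) : PBase M := by
  intro x U hU hx
  obtain ⟨B, K, e, e', hB, h1, h2⟩ := h x U hU hx
  refine ⟨B, hB.cball, fun u => ?_, h1, h2⟩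
  by_cases hu : u ∈ B
  · have : B \ {u} = e' '' (K \ {e u}) := by
      ext y; constructor
      · rintro ⟨hy, hyu⟩
        refine ⟨e y, ⟨hB.mp y hy, fun h => hyu ?_⟩, hB.li y hy⟩
        have h : e y = e u := h
        rw [Set.mem_singleton_iff, ← hB.li y hy, h, hB.li u hu]
      · rintro ⟨v, ⟨hv, hvu⟩, rfl⟩
        refine ⟨hB.mp' v hv, fun h => hvu ?_⟩
        have h : e' v = u := h
        rw [Set.mem_singleton_iff, ← h, hB.ri v hv]
    rw [this]
    exact (convex_punct hd hB.cvx hB.int _).image' (hB.ce'.mono Set.sdiff_subset)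
  · rw [Set.sdiff_singleton_eq_self hu, ← hB.image]
    exact (hB.cvx.isPathConnected ⟨_, hB.mp x h1⟩).image' hB.ce'

lemma subsing_of [Subsingleton E] [ConnectedSpace M] (h : MBase E M) : Subsingleton M := by
  have : DiscreteTopology M := by
    rw [discreteTopology_iff_isOpen_singleton]
    intro x
    obtain ⟨B, K, e, e', hB, h1, h2⟩ := h x Set.univ isOpen_univ trivial
    have : B = {x} := by
      ext y; constructor
      · intro hy
        rw [Set.mem_singleton_iff, ← hB.li y hy, Subsingleton.elim (e y) (e x), hB.li x h1]
      · rintro rfl; exact h1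
    rw [← this]; exact hB.op
  exact PreconnectedSpace.trivial_of_discrete

end geom

lemma KEY_sub {M : Type} [TopologicalSpace M] [Inhabited M] [Subsingleton M] {i m : ℕ} (h : 1 ≤ m) : KEY M i m := by
  intro z hz hzi hzg hdz w hw hwi hwg hzw
  have : Al (XX (M := M) ∅ (offd (Fin (m+1))) Set.univ) = ∅ := by
    ext σ
    simp only [Set.mem_empty_iff_false, iff_false]
    intro hσ
    have h1 := (hσ (vt 0)).1
    have h2 := (hσ (vt 0)).2.1
    obtain ⟨n, rfl⟩ : ∃ n, m = n + 1 := ⟨m - 1, by lia⟩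
    obtain ⟨a, ha⟩ := Option.ne_none_iff_exists'.1 (h1 0 (by simp))
    obtain ⟨b, hb⟩ := Option.ne_none_iff_exists'.1 (h1 1 (by simp))
    exact h2 0 1 (by simp [offd]) a ha (by rw [hb, Subsingleton.elim a b])
  rw [this, sp, Finsupp.supported_empty, Submodule.mem_bot] at hz
  exact ⟨0, Submodule.zero_mem _, Submodule.zero_mem _, by rw [hz, map_zero]⟩

theorem KEY_all (d : ℕ) {H : Type*} [TopologicalSpace H] (I : ModelWithCorners ℝ (EuclideanSpace ℝ (Fin d)) H)
    (M : Type) [TopologicalSpace M] [ChartedSpace H M] [T2Space M] [ConnectedSpace M] [Inhabited M] (i : ℕ) :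
    ∃ N, ∀ m, N ≤ m → KEY M i m := by
  have hM : MBase (EuclideanSpace ℝ (Fin d)) M := MBase_of I
  have := hM.path
  rcases subsingleton_or_nontrivial M with hs | hn
  · exact ⟨1, fun m hm => KEY_sub hm⟩
  · have hni : ∀ J : Set M, IsOpen J → J.Nonempty → J.Nontrivial := by
      rintro J hJ ⟨x, hx⟩
      have hne := ConnectedSpace.neBot_nhdsWithin_compl_of_nontrivial_of_t1space x
      obtain ⟨y, hy, hyx⟩ := (Filter.nonempty_of_mem (f := 𝓝[≠] x) (Filter.inter_mem
        (mem_nhdsWithin_of_mem_nhds (hJ.mem_nhds hx)) self_mem_nhdsWithin))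
      exact ⟨x, hx, y, hy, fun h => hyx h.symm⟩
    match d, I, hM with
    | 0, I, hM =>
      have := subsing_of hM
      exact absurd hn (not_nontrivial M)
    | 1, I, hM =>
      refine ⟨i, fun m hm => KEY_one hM.cbase (lbase_of ?_ hM) hni hm⟩
      exact ContinuousLinearEquiv.ofFinrankEq (by simp)
    | d+2, I, hM =>
      exact ⟨2*i+1, fun m hm => KEY_two hM.cbase (pbase_of (by simp) hM) hm⟩

end
end CFS

set_option linter.unusedSectionVars false
set_option linter.unusedSimpArgs false

namespace CFS
noncomputable section

section cover
open Topology
variable {M : Type} [TopologicalSpace M]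

abbrev FF (M : Type) (m : ℕ) : Type := {f : Fin m → M // Function.Injective f}

def qp {m : ℕ} (f : FF M m) : UnordConfigSpace M m := Quotient.mk (configSetoid M m) f

def pmf {M : Type} {m : ℕ} (g : Equiv.Perm (Fin m)) (f : FF M m) : FF M m := ⟨f.1 ∘ g, f.2.comp g.injective⟩

lemma qp_quot {m : ℕ} : IsQuotientMap (qp : FF M m → UnordConfigSpace M m) := isQuotientMap_quotient_mk'

lemma qp_cont {m : ℕ} : Continuous (qp : FF M m → UnordConfigSpace M m) := qp_quot.continuous

lemma qp_eq {m : ℕ} {f g : FF M m} : qp f = qp g ↔ ∃ s : Equiv.Perm (Fin m), g = pmf s f := by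
  refine (Quotient.eq (r := configSetoid M m)).trans ?_
  constructor
  · rintro ⟨s, hs⟩
    exact ⟨s, Subtype.ext hs.symm⟩
  · rintro ⟨s, hs⟩
    exact ⟨s, (congrArg Subtype.val hs).symm⟩

lemma pmf_cont {m : ℕ} (g : Equiv.Perm (Fin m)) : Continuous (pmf g : FF M m → FF M m) := by
  refine Continuous.subtype_mk ?_ _
  exact continuous_pi (fun v => (continuous_apply (g v)).comp continuous_subtype_val)

instance pmAct (M : Type) (m : ℕ) : MulAction (Equiv.Perm (Fin m)) (FF M m) where
  smul g f := pmf g⁻¹ f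
  one_smul f := Subtype.ext (by funext v; rfl)
  mul_smul g h f := Subtype.ext (by
    funext v
    change f.1 ((g * h)⁻¹ v) = f.1 (h⁻¹ (g⁻¹ v))
    rw [mul_inv_rev]; rfl)


lemma smul_def {m : ℕ} (g : Equiv.Perm (Fin m)) (f : FF M m) : g • f = pmf g⁻¹ f := rfl

lemma qp_cover [T2Space M] {m : ℕ} : IsQuotientCoveringMap (qp : FF M m → UnordConfigSpace M m) (Equiv.Perm (Fin m)) where
  toIsQuotientMap := qp_quot
  continuous_const_smul g := pmf_cont g⁻¹
  apply_eq_iff_mem_orbit {e₁ e₂} := by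
    rw [eq_comm, qp_eq]
    constructor
    · rintro ⟨s, hs⟩
      exact ⟨s⁻¹, by simp only [smul_def, inv_inv]; exact hs.symm⟩
    · rintro ⟨s, hs⟩
      exact ⟨s⁻¹, hs.symm⟩
  disjoint e := by
    obtain ⟨U, hU, hd⟩ := (Set.finite_range e.1).t2_separation
    refine ⟨{f | ∀ v, f.1 v ∈ U (e.1 v)}, ?_, ?_⟩
    · refine IsOpen.mem_nhds ?_ (fun v => (hU _).1)
      simp only [Set.ofPred_forall]
      exact isOpen_iInter_of_finite (fun v => (hU _).2.preimage ((continuous_apply v).comp continuous_subtype_val))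
    · rintro g ⟨_, ⟨f, hf, rfl⟩, hg⟩
      have h1 : ∀ v, g⁻¹ v = v := by
        intro v
        by_contra hne
        have h2 : e.1 (g⁻¹ v) ≠ e.1 v := fun h => hne (e.2 h)
        exact Set.disjoint_left.1 (hd ⟨_, rfl⟩ ⟨_, rfl⟩ h2) (hf (g⁻¹ v)) (hg v)
      rw [← inv_eq_one]
      exact Equiv.ext h1

instance (n : ℕ) : ContractibleSpace (Dl n) :=
  (convex_stdSimplex ℝ (Fin (n+1))).contractibleSpace ⟨_, (vt 0 : Dl n).2⟩

instance (n : ℕ) : LocallyPathConnectedSpace (Dl n) :=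
  (convex_stdSimplex ℝ (Fin (n+1))).locallyPathConnectedSpace

lemma lift_exists [T2Space M] {m n : ℕ} (τ : C(Dl n, UnordConfigSpace M m)) :
    ∃ L : C(Dl n, FF M m), ∀ t, qp (L t) = τ t := by
  obtain ⟨e, he⟩ := qp_quot.surjective (τ (vt 0))
  obtain ⟨F, ⟨_, hF⟩, _⟩ := qp_cover.isCoveringMap.existsUnique_continuousMap_lifts τ (vt 0) e he
  exact ⟨F, fun t => congrFun hF t⟩

def pmL {m n : ℕ} (g : Equiv.Perm (Fin m)) (L : C(Dl n, FF M m)) : C(Dl n, FF M m) :=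
  ⟨fun t => pmf g (L t), (pmf_cont g).comp L.continuous⟩

lemma lift_unique [T2Space M] {m n : ℕ} (L L' : C(Dl n, FF M m)) (h : ∀ t, qp (L t) = qp (L' t)) :
    ∃ g : Equiv.Perm (Fin m), L' = pmL g L := by
  obtain ⟨g, hg⟩ := qp_eq.1 (h (vt 0))
  refine ⟨g, ?_⟩
  let τ : C(Dl n, UnordConfigSpace M m) := ⟨fun t => qp (L t), qp_cont.comp L.continuous⟩
  have := qp_cover.isCoveringMap.existsUnique_continuousMap_lifts τ (vt 0) (L' (vt 0)) (h _).symm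
  refine this.unique ⟨rfl, funext fun t => (h t).symm⟩ ⟨hg.symm, funext fun t => ?_⟩
  exact (qp_eq.2 ⟨g, rfl⟩).symm

end cover
end
end CFS

set_option linter.unusedSectionVars false
set_option linter.unusedSimpArgs false

namespace CFS
noncomputable section

section tc
variable {X Y Z : Type} [TopologicalSpace X] [TopologicalSpace Y] [TopologicalSpace Z]

abbrev TS (X : Type) [TopologicalSpace X] := Σ n : ℕ, C(Dl n, X)
abbrev TC (X : Type) [TopologicalSpace X] := TS X →₀ ℚ

/-- the boundary of a singular simplex -/
def btS : ∀ (n : ℕ), C(Dl n, X) → TC X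
  | 0, _ => 0
  | n+1, τ => ∑ j : Fin (n+2), (-1 : ℚ)^(j:ℕ) • bs (⟨n, τ.comp (rl (vt ∘ j.succAbove))⟩ : TS X)

def bt : TC X →ₗ[ℚ] TC X := Finsupp.linearCombination ℚ (fun s => btS s.1 s.2)

lemma bt_bs (s : TS X) : bt (bs s) = btS s.1 s.2 := by simp [bt, bs]

def mpS (φ : C(X, Y)) (s : TS X) : TS Y := ⟨s.1, φ.comp s.2⟩

def mp (φ : C(X, Y)) : TC X →ₗ[ℚ] TC Y := Finsupp.lmapDomain ℚ ℚ (mpS φ)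

lemma mp_bs (φ : C(X, Y)) (s : TS X) : mp φ (bs s) = bs (mpS φ s) := by simp [mp, bs]

lemma mp_mp (φ : C(X, Y)) (ψ : C(Y, Z)) (x : TC X) : mp ψ (mp φ x) = mp (ψ.comp φ) x := by
  refine lin_ext_apply (f := (mp ψ).comp (mp φ)) (g := mp (ψ.comp φ)) (fun s => ?_) x
  simp only [LinearMap.comp_apply, mp_bs]
  rfl

lemma mp_bt (φ : C(X, Y)) (x : TC X) : mp φ (bt x) = bt (mp φ x) := by
  refine lin_ext_apply (f := (mp φ).comp bt) (g := bt.comp (mp φ)) (fun s => ?_) x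
  simp only [LinearMap.comp_apply, mp_bs, bt_bs]
  obtain ⟨n, τ⟩ := s
  cases n with
  | zero => simp [btS, mpS]
  | succ n =>
    simp only [btS, mpS, map_sum, map_smul, mp_bs]
    rfl

/-- degree -/
def DT (n : ℕ) : Submodule ℚ (TC X) := Finsupp.supported ℚ ℚ {s | s.1 = n}

lemma mp_DT (φ : C(X, Y)) {n : ℕ} {x : TC X} (hx : x ∈ DT n) : mp φ x ∈ DT n := by
  refine supp_map _ _ _ (fun s hs => ?_) hx
  rw [mp_bs]
  exact supp_bs hs

end tc

section conf
variable {M : Type} [TopologicalSpace M] {m : ℕ}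

def pmC (g : Equiv.Perm (Fin m)) : C(FF M m, FF M m) := ⟨pmf g, pmf_cont g⟩
def qpC : C(FF M m, UnordConfigSpace M m) := ⟨qp, qp_cont⟩

def drC : C(FF M (m+1), FF M m) where
  toFun f := ⟨fun v => f.1 v.castSucc, fun _ _ h => Fin.castSucc_injective _ (f.2 h)⟩
  continuous_toFun := by
    refine Continuous.subtype_mk ?_ _
    exact continuous_pi (fun v => (continuous_apply _).comp continuous_subtype_val)

lemma qp_pm (g : Equiv.Perm (Fin m)) (x : TC (FF M m)) : mp qpC (mp (pmC g) x) = mp qpC x := by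
  rw [mp_mp]
  congr 2
  ext f
  exact (qp_eq.2 ⟨g, rfl⟩).symm

lemma pm_pm (g h : Equiv.Perm (Fin m)) (x : TC (FF M m)) :
    mp (pmC g) (mp (pmC h) x) = mp (pmC (h * g)) x := by
  rw [mp_mp]
  rfl

variable [T2Space M]

def lf (s : TS (UnordConfigSpace M m)) : TS (FF M m) := ⟨s.1, (lift_exists s.2).choose⟩

lemma q_lf (s : TS (UnordConfigSpace M m)) : mpS qpC (lf s) = s := by
  obtain ⟨n, τ⟩ := s
  have := (lift_exists τ).choose_spec
  refine Sigma.ext rfl (heq_of_eq ?_)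
  ext t
  exact this t

lemma lf_q (s : TS (FF M m)) : ∃ g : Equiv.Perm (Fin m), lf (mpS qpC s) = mpS (pmC g) s := by
  obtain ⟨n, L⟩ := s
  have := (lift_exists (mpS qpC ⟨n, L⟩).2).choose_spec
  obtain ⟨g, hg⟩ := lift_unique L (lf (mpS qpC ⟨n, L⟩)).2 (fun t => (this t).symm)
  exact ⟨g, Sigma.ext rfl (heq_of_eq hg)⟩

/-- transfer -/
def tr : TC (UnordConfigSpace M m) →ₗ[ℚ] TC (FF M m) :=
  ∑ g : Equiv.Perm (Fin m), (mp (pmC g)).comp (Finsupp.lmapDomain ℚ ℚ lf)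

lemma tr_bs (s : TS (UnordConfigSpace M m)) : tr (bs s) = ∑ g, mp (pmC g) (bs (lf s)) := by
  simp [tr, bs, LinearMap.sum_apply]

lemma tr_q (x : TC (FF M m)) : tr (mp qpC x) = ∑ g, mp (pmC g) x := by
  refine (lin_ext_apply (f := tr.comp (mp qpC)) (g := ∑ g, mp (pmC g)) (fun s => ?_) x).trans
    (LinearMap.sum_apply _ _ _)
  rw [LinearMap.sum_apply, LinearMap.comp_apply, mp_bs, tr_bs]
  obtain ⟨h, hh⟩ := lf_q s
  rw [hh]
  simp_rw [← mp_bs, pm_pm]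
  exact Fintype.sum_equiv (Equiv.mulLeft h) _ _ (fun g => rfl)

lemma q_surj (z : TC (UnordConfigSpace M m)) : ∃ x, mp qpC x = z := by
  refine ⟨Finsupp.lmapDomain ℚ ℚ lf z, ?_⟩
  refine lin_ext_apply (f := (mp qpC).comp (Finsupp.lmapDomain ℚ ℚ lf)) (g := LinearMap.id) (fun s => ?_) z
  simp only [LinearMap.comp_apply, LinearMap.id_apply]
  rw [Finsupp.lmapDomain_apply, Finsupp.mapDomain_single, mp_bs, q_lf]

lemma tr_bt (z : TC (UnordConfigSpace M m)) : tr (bt z) = bt (tr z) := by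
  obtain ⟨x, rfl⟩ := q_surj z
  rw [← mp_bt, tr_q, tr_q, map_sum]
  simp_rw [mp_bt]

lemma q_tr (z : TC (UnordConfigSpace M m)) : mp qpC (tr z) = (Fintype.card (Equiv.Perm (Fin m)) : ℚ) • z := by
  obtain ⟨x, rfl⟩ := q_surj z
  rw [tr_q, map_sum]
  simp_rw [qp_pm]
  simp [Nat.cast_smul_eq_nsmul]

lemma pm_tr (h : Equiv.Perm (Fin m)) (z : TC (UnordConfigSpace M m)) : mp (pmC h) (tr z) = tr z := by
  obtain ⟨x, rfl⟩ := q_surj z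
  rw [tr_q, map_sum]
  simp_rw [pm_pm]
  exact Fintype.sum_equiv (Equiv.mulRight h) _ _ (fun g => rfl)

lemma tr_DT {n : ℕ} {z : TC (UnordConfigSpace M m)} (hz : z ∈ DT n) : tr z ∈ DT n := by
  refine supp_map _ _ _ (fun s hs => ?_) hz
  rw [tr_bs]
  exact Submodule.sum_mem _ (fun g _ => mp_DT _ (supp_bs hs))

/-- the stabilisation transfer -/
def TF : TC (UnordConfigSpace M (m+1)) →ₗ[ℚ] TC (UnordConfigSpace M m) :=
  (mp qpC).comp ((mp drC).comp tr)

lemma TF_apply (z : TC (UnordConfigSpace M (m+1))) : TF z = mp qpC (mp drC (tr z)) := rfl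

lemma TF_bt (z : TC (UnordConfigSpace M (m+1))) : TF (bt z) = bt (TF z) := by
  rw [TF_apply, TF_apply, tr_bt, mp_bt, mp_bt]

lemma TF_DT {n : ℕ} {z : TC (UnordConfigSpace M (m+1))} (hz : z ∈ DT n) : TF z ∈ DT n :=
  mp_DT _ (mp_DT _ (tr_DT hz))

lemma ext_perm (g : Equiv.Perm (Fin m)) : ∃ h : Equiv.Perm (Fin (m+1)), ∀ v, h v.castSucc = (g v).castSucc := by
  refine ⟨?_, ?_⟩
  · exact (finSuccEquivLast.trans (Equiv.optionCongr g)).trans finSuccEquivLast.symm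
  · intro v
    simp

lemma pm_dr (g : Equiv.Perm (Fin m)) (z : TC (UnordConfigSpace M (m+1))) :
    mp (pmC g) (mp drC (tr z)) = mp drC (tr z) := by
  obtain ⟨h, hh⟩ := ext_perm g
  conv_rhs => rw [← pm_tr h]
  rw [mp_mp, mp_mp]
  congr 2
  ext f v
  change f.1 (g v).castSucc = f.1 (h v.castSucc)
  rw [hh]

lemma tr_TF (z : TC (UnordConfigSpace M (m+1))) :
    tr (TF z) = (Fintype.card (Equiv.Perm (Fin m)) : ℚ) • mp drC (tr z) := by
  rw [TF_apply, tr_q]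
  simp_rw [pm_dr]
  simp [Nat.cast_smul_eq_nsmul]

end conf

section icc
variable {M : Type} [TopologicalSpace M] {m : ℕ}

def icc (m : ℕ) (M : Type) [TopologicalSpace M] (v : Fin m) : C(FF M m, M) :=
  ⟨fun f => f.1 v, (continuous_apply v).comp continuous_subtype_val⟩

def icS (s : TS (FF M m)) : Sim (Fin m) M := ⟨s.1, fun v => some ((icc m M v).comp s.2)⟩

def ic : TC (FF M m) →ₗ[ℚ] Ch (Fin m) M := Finsupp.lmapDomain ℚ ℚ icS

lemma ic_bs (s : TS (FF M m)) : ic (bs s) = bs (icS s) := by simp [ic, bs]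

lemma icS_inj : Function.Injective (icS : TS (FF M m) → Sim (Fin m) M) := by
  rintro ⟨n, L⟩ ⟨n', L'⟩ h
  obtain rfl : n = n' := congrArg Sigma.fst h
  refine Sigma.ext rfl (heq_of_eq ?_)
  have h2 := eq_of_heq (Sigma.mk.inj h).2
  ext t v
  exact DFunLike.congr_fun (Option.some.inj (congrFun h2 v)) t

lemma ic_inj : Function.Injective (ic : TC (FF M m) → Ch (Fin m) M) := Finsupp.mapDomain_injective icS_inj

lemma dd_zero {V : Type} (σ : V → Option C(Dl 0, M)) : dd (bs (⟨0, σ⟩ : Sim V M)) = 0 := by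
  rw [dd_bs]; rfl

lemma dd_succ {V : Type} {n : ℕ} (σ : V → Option C(Dl (n+1), M)) :
    dd (bs (⟨n+1, σ⟩ : Sim V M)) =
      ∑ j : Fin (n+2), (-1 : ℚ)^(j:ℕ) • bs (⟨n, pb (rl (vt ∘ j.succAbove)) σ⟩ : Sim V M) := by
  rw [dd_bs, bd_bs, map_sum]
  refine Finset.sum_congr rfl (fun j _ => ?_)
  rw [map_smul, ps_bs]
  rfl

lemma ic_bt (x : TC (FF M m)) : ic (bt x) = dd (ic x) := by
  refine lin_ext_apply (f := ic.comp bt) (g := dd.comp ic) (fun s => ?_) x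
  simp only [LinearMap.comp_apply, ic_bs, bt_bs]
  obtain ⟨n, τ⟩ := s
  cases n with
  | zero => rw [icS, dd_zero]; simp [btS]
  | succ n =>
    rw [icS, dd_succ]
    simp only [btS, map_sum, map_smul, ic_bs]
    rfl

lemma ic_pm (g : Equiv.Perm (Fin m)) (x : TC (FF M m)) : ic (mp (pmC g) x) = act g (ic x) := by
  refine lin_ext_apply (f := ic.comp (mp (pmC g))) (g := (act g).comp ic) (fun s => ?_) x
  simp only [LinearMap.comp_apply, ic_bs, mp_bs]
  obtain ⟨n, L⟩ := s
  exact (act_bs (M := M) g (icS ⟨n, L⟩).2).symm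

lemma ic_dr (x : TC (FF M (m+1))) :
    ic (mp drC x) = rei (fun j : Fin m => some j.castSucc) (ic x) := by
  have key : ∀ s : TS (FF M (m+1)), (ic.comp (mp drC)) (bs s) =
      ((rei (fun j : Fin m => some j.castSucc)).comp (ic (M := M))) (bs s) := by
    intro s
    simp only [LinearMap.comp_apply, ic_bs, mp_bs, rei_bs]
    rfl
  exact lin_ext_apply key x

lemma ic_Di {n : ℕ} {x : TC (FF M m)} (hx : x ∈ DT n) : ic x ∈ (Di n : Submodule ℚ (Ch (Fin m) M)) := by
  refine supp_map _ _ _ (fun s hs => ?_) hx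
  rw [ic_bs]
  exact supp_bs hs

variable [Inhabited M]

lemma ic_XX (x : TC (FF M m)) : ic x ∈ (sp (Al (XX ∅ (offd _) Set.univ)) : Submodule ℚ (Ch (Fin m) M)) := by
  refine supp_map _ Set.univ _ (fun s _ => ?_) (by rw [Finsupp.supported_univ]; trivial)
  rw [ic_bs]
  refine supp_bs (fun t => ⟨fun v _ => ?_, fun a b hab p hp hp' => ?_, trivial⟩)
  · exact Option.some_ne_none _
  · have h1 : (s.2 t).1 a = p := Option.some.inj hp
    have h2 : (s.2 t).1 b = p := Option.some.inj hp'
    exact hab ((s.2 t).2 (h1.trans h2.symm))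

lemma icS_surj {σ : Sim (Fin m) M} (h : σ ∈ Al (XX ∅ (offd (Fin m)) Set.univ)) : ∃ s, icS s = σ := by
  obtain ⟨n, σ⟩ := σ
  have h1 : ∀ v, ∃ c, σ v = some c := by
    intro v
    have := (h (vt 0)).1 v (by simp)
    cases hv : σ v with
    | none => exact absurd (by simp [ev, hv]) this
    | some c => exact ⟨c, rfl⟩
  choose c hc using h1
  refine ⟨⟨n, ⟨fun t => ⟨fun v => c v t, fun a b hab => ?_⟩, ?_⟩⟩, ?_⟩
  · by_contra hne
    refine (h t).2.1 a b hne (c a t) (by simp [ev, hc]) ?_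
    simp only [ev, hc, Option.map_some]
    exact congrArg some hab.symm
  · refine Continuous.subtype_mk ?_ _
    exact continuous_pi (fun v => (c v).continuous)
  · refine Sigma.ext rfl (heq_of_eq (funext fun v => ?_))
    exact (hc v).symm

lemma ic_surj {n : ℕ} {x : Ch (Fin m) M} (h : x ∈ sp (Al (XX ∅ (offd _) Set.univ))) (hn : x ∈ Di n) :
    ∃ y : TC (FF M m), y ∈ DT n ∧ ic y = x := by
  have h3 := sp_inter h hn
  refine supp_map LinearMap.id _ ((DT n).map ic) (fun σ hσ => ?_) h3
  obtain ⟨s, rfl⟩ := icS_surj hσ.1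
  exact ⟨bs s, supp_bs hσ.2, ic_bs s⟩

theorem TF_inj [T2Space M] {i : ℕ} (hK : KEY M i m) (z : TC (UnordConfigSpace M (m+1))) (hz : z ∈ DT i) (hbz : bt z = 0)
    (w : TC (UnordConfigSpace M m)) (hw : w ∈ DT (i+1)) (hzw : TF z = bt w) :
    ∃ u : TC (UnordConfigSpace M (m+1)), u ∈ DT (i+1) ∧ z = bt u := by
  have hc : (Fintype.card (Equiv.Perm (Fin m)) : ℚ) ≠ 0 := by exact_mod_cast Fintype.card_ne_zero
  have hc' : (Fintype.card (Equiv.Perm (Fin (m+1))) : ℚ) ≠ 0 := by exact_mod_cast Fintype.card_ne_zero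
  have h1 := congrArg tr hzw
  rw [tr_TF, tr_bt] at h1
  obtain ⟨u, hu, hui, hzu⟩ := hK (ic (tr z)) (ic_XX _) (ic_Di (tr_DT hz)) (fun g => by rw [← ic_pm, pm_tr])
    (by rw [← ic_bt, ← tr_bt, hbz]; simp)
    (ic ((Fintype.card (Equiv.Perm (Fin m)) : ℚ)⁻¹ • tr w)) (ic_XX _)
    (ic_Di (Submodule.smul_mem _ _ (tr_DT hw)))
    (fun g => by rw [← ic_pm, map_smul, pm_tr])
    (by rw [← ic_bt, map_smul, ← h1, inv_smul_smul₀ hc, ic_dr])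
  obtain ⟨y, hy, rfl⟩ := ic_surj hu hui
  rw [← ic_bt] at hzu
  have h2 := congrArg (mp qpC) (ic_inj hzu)
  rw [q_tr, mp_bt] at h2
  refine ⟨(Fintype.card (Equiv.Perm (Fin (m+1))) : ℚ)⁻¹ • mp qpC y, Submodule.smul_mem _ _ (mp_DT _ hy), ?_⟩
  rw [map_smul, ← h2, inv_smul_smul₀ hc']

end icc
end
end CFS

set_option linter.unusedSectionVars false
set_option linter.unusedSimpArgs false

namespace CFS
noncomputable section
open CategoryTheory

lemma rank_le {K L : ChainComplex (ModuleCat.{0} ℚ) ℕ} (f : K ⟶ L) (i : ℕ)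
    (h : ∀ z : K.X i, (∀ j, K.d i j z = 0) → (∃ w : L.X (i+1), L.d (i+1) i w = f.f i z) →
      ∃ u : K.X (i+1), K.d (i+1) i u = z) :
    Module.rank ℚ (K.homology i) ≤ Module.rank ℚ (L.homology i) := by
  have hinj : Function.Injective (HomologicalComplex.homologyMap f i) := by
    rw [injective_iff_map_eq_zero]
    intro a ha
    obtain ⟨c, rfl⟩ := (ModuleCat.epi_iff_surjective (K.homologyπ i)).1 inferInstance a
    have h1 : L.homologyπ i (HomologicalComplex.cyclesMap f i c) = 0 := by
      rw [← ha, ← ConcreteCategory.comp_apply, ← ConcreteCategory.comp_apply, HomologicalComplex.homologyπ_naturality]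
    have hex : (ShortComplex.mk (L.toCycles (i+1) i) (L.homologyπ i) (by simp)).Exact :=
      ShortComplex.exact_of_g_is_cokernel _ (L.homologyIsCokernel (i+1) i (by simp))
    rw [ShortComplex.moduleCat_exact_iff] at hex
    obtain ⟨w, hw⟩ := hex _ h1
    obtain ⟨u, hu⟩ := h (K.iCycles i c) (fun j => by
        rw [← ConcreteCategory.comp_apply, HomologicalComplex.iCycles_d]; rfl) ⟨w, by
        rw [← ConcreteCategory.comp_apply, ← HomologicalComplex.cyclesMap_i, ConcreteCategory.comp_apply, ← hw,
          ← ConcreteCategory.comp_apply]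
        simp⟩
    have hc : c = K.toCycles (i+1) i u := by
      apply (ModuleCat.mono_iff_injective (K.iCycles i)).1 inferInstance
      rw [← hu, ← ConcreteCategory.comp_apply]
      simp
    rw [hc, ← ConcreteCategory.comp_apply]
    simp
  exact LinearMap.rank_le_of_injective (HomologicalComplex.homologyMap f i).hom hinj

section bridge
open Simplicial

abbrev SC (X : Type) [TopologicalSpace X] : ChainComplex (ModuleCat.{0} ℚ) ℕ :=
  (singularChainComplexFunctor ℚ).obj (TopCat.of X)

abbrev SS (X : Type) [TopologicalSpace X] (n : ℕ) : Type := (TopCat.toSSet.obj (TopCat.of X)) _⦋n⦌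

variable {X Y : Type} [TopologicalSpace X] [TopologicalSpace Y]

/-- identification of chains -/
def cE (X : Type) [TopologicalSpace X] (n : ℕ) : (SC X).X n ≃ₗ[ℚ] (SS X n →₀ ℚ) := LinearEquiv.refl ℚ _

def eqv (X : Type) [TopologicalSpace X] (n : ℕ) : SS X n ≃ C(Dl n, X) := TopCat.toSSetObjEquiv (TopCat.of X) _

def toTS {n : ℕ} (s : SS X n) : TS X := ⟨n, eqv X n s⟩

lemma toTS_inj {n : ℕ} : Function.Injective (toTS : SS X n → TS X) := by
  intro a b h
  exact (eqv X n).injective (eq_of_heq (Sigma.mk.inj h).2)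

def io (X : Type) [TopologicalSpace X] (n : ℕ) : (SC X).X n →ₗ[ℚ] TC X :=
  (Finsupp.lmapDomain ℚ ℚ toTS).comp (cE X n).toLinearMap

lemma io_inj (n : ℕ) : Function.Injective (io X n) :=
  (Finsupp.mapDomain_injective toTS_inj).comp (cE X n).injective

lemma io_DT {n : ℕ} (x : (SC X).X n) : io X n x ∈ DT n := by
  refine supp_map (Finsupp.lmapDomain ℚ ℚ toTS) Set.univ (DT n) (fun s _ => ?_) (x := cE X n x)
    (by rw [Finsupp.supported_univ]; trivial)
  rw [Finsupp.lmapDomain_apply, Finsupp.mapDomain_single]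
  exact supp_bs rfl

lemma io_surj {n : ℕ} {x : TC X} (hx : x ∈ DT n) : ∃ y, io X n y = x := by
  refine supp_map LinearMap.id _ (LinearMap.range (io X n)) (fun s hs => ?_) hx
  obtain ⟨k, τ⟩ := s
  obtain rfl : k = n := hs
  refine ⟨(cE X k).symm (bs ((eqv X k).symm τ)), ?_⟩
  simp [io, toTS, bs]

lemma alt_apply {A B : ModuleCat.{0} ℚ} {k : ℕ} (F : Fin k → (A ⟶ B)) (a : A) :
    (∑ i : Fin k, (-1 : ℤ) ^ (i : ℕ) • F i).hom a = ∑ i : Fin k, (-1 : ℚ) ^ (i : ℕ) • (F i).hom a := by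
  rw [ModuleCat.hom_sum, LinearMap.sum_apply]
  refine Finset.sum_congr rfl (fun i _ => ?_)
  rcases Nat.even_or_odd (i : ℕ) with he | ho
  · simp [he.neg_one_pow]
  · simp [ho.neg_one_pow]

lemma io_d (n : ℕ) (x : (SC X).X (n+1)) : io X n ((SC X).d (n+1) n x) = bt (io X (n+1) x) := by
  have key : ∀ s : SS X (n+1), ((io X n).comp (((SC X).d (n+1) n).hom.comp (cE X (n+1)).symm.toLinearMap)) (bs s) =
      (bt.comp (Finsupp.lmapDomain ℚ ℚ toTS)) (bs s) := by
    intro s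
    simp only [LinearMap.comp_apply, Finsupp.lmapDomain_apply, Finsupp.mapDomain_single, bt_bs]
    have h1 : (SC X).d (n+1) n = ∑ i : Fin (n+2), (-1 : ℤ) ^ (i : ℕ) •
      (ModuleCat.free ℚ).map ((TopCat.toSSet.obj (TopCat.of X)).δ i) :=
      AlgebraicTopology.alternatingFaceMapComplex_obj_d _ n
    have h2 : ((SC X).d (n+1) n).hom ((cE X (n+1)).symm (bs s)) =
        ∑ i : Fin (n+2), (-1 : ℚ) ^ (i : ℕ) •
          (cE X n).symm (bs ((TopCat.toSSet.obj (TopCat.of X)).δ i s)) := by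
      refine (congrArg (fun φ => φ.hom ((cE X (n+1)).symm (bs s))) h1).trans ?_
      refine (alt_apply _ _).trans (Finset.sum_congr rfl (fun i _ => ?_))
      exact congrArg (fun y => (-1 : ℚ) ^ (i : ℕ) • y) (ModuleCat.free_map_apply _ _)
    refine (congrArg (io X n) h2).trans ?_
    rw [map_sum]
    refine Finset.sum_congr rfl (fun i _ => ?_)
    rw [map_smul]
    congr 1
    simp only [io, LinearMap.comp_apply, LinearEquiv.coe_coe, LinearEquiv.apply_symm_apply,
      Finsupp.lmapDomain_apply, Finsupp.mapDomain_single]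
    congr 1
    refine Sigma.ext rfl (heq_of_eq ?_)
    ext t
    exact congrArg (eqv X (n+1) s) (rl_map i.succAbove t).symm
  exact lin_ext_apply key (cE X (n+1) x)

section chmap
variable (T : TC X →ₗ[ℚ] TC Y)

/-- degree part of an operator -/
def dgp (hd : ∀ n x, x ∈ DT n → T x ∈ DT n) (n : ℕ) : (SC X).X n →ₗ[ℚ] (SC Y).X n :=
  (LinearEquiv.ofInjective (io Y n) (io_inj n)).symm.toLinearMap.comp
    ((T.comp (io X n)).codRestrict (LinearMap.range (io Y n))
      (fun x => by obtain ⟨y, hy⟩ := io_surj (hd n _ (io_DT x)); exact ⟨y, hy⟩))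

lemma io_dgp (hd : ∀ n x, x ∈ DT n → T x ∈ DT n) (n : ℕ) (x : (SC X).X n) : io Y n (dgp T hd n x) = T (io X n x) := by
  have := (LinearEquiv.ofInjective (io Y n) (io_inj n)).apply_symm_apply
    ((T.comp (io X n)).codRestrict (LinearMap.range (io Y n))
      (fun x => by obtain ⟨y, hy⟩ := io_surj (hd n _ (io_DT x)); exact ⟨y, hy⟩) x)
  exact congrArg Subtype.val this

def chm (hd : ∀ n x, x ∈ DT n → T x ∈ DT n) (hb : ∀ x, T (bt x) = bt (T x)) : SC X ⟶ SC Y where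
  f n := ModuleCat.ofHom (dgp T hd n)
  comm' a b hab := by
    obtain rfl : b + 1 = a := hab
    ext x
    apply io_inj
    change io Y b ((SC Y).d (b+1) b (dgp T hd (b+1) x)) = io Y b (dgp T hd b ((SC X).d (b+1) b x))
    rw [io_d, io_dgp, io_dgp, io_d, hb]

lemma rank_le_of (hd : ∀ n x, x ∈ DT n → T x ∈ DT n) (hb : ∀ x, T (bt x) = bt (T x)) (i : ℕ)
    (h : ∀ z ∈ DT i, bt z = 0 → ∀ w ∈ DT (i+1), T z = bt w → ∃ u ∈ DT (i+1), z = bt u) :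
    Module.rank ℚ (SingularHomology ℚ i X) ≤ Module.rank ℚ (SingularHomology ℚ i Y) := by
  refine rank_le (chm T hd hb) i ?_
  rintro z hz ⟨w, hw⟩
  obtain ⟨u, hu, hzu⟩ := h (io X i z) (io_DT z) (by
    cases i with
    | zero =>
      refine supp_map bt _ ⊥ (fun s hs => ?_) (io_DT z)
      obtain ⟨k, τ⟩ := s
      obtain rfl : k = 0 := hs
      rw [bt_bs]
      rfl
    | succ i => rw [← io_d, hz i, map_zero]) (io Y (i+1) w) (io_DT w) (by
      rw [← io_d, hw]; exact (io_dgp T hd i z).symm)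
  obtain ⟨u, rfl⟩ := io_surj hu
  exact ⟨u, io_inj i (by rw [io_d, hzu])⟩

end chmap

end bridge

theorem main (d : ℕ) {H' : Type} [TopologicalSpace H']
    (I : ModelWithCorners ℝ (EuclideanSpace ℝ (Fin d)) H')
    (M : Type) [TopologicalSpace M] [ChartedSpace H' M]
    [T2Space M] [ConnectedSpace M] (i : ℕ) :
    ∃ N : ℕ, ∀ k l : ℕ, N ≤ k → N ≤ l →
      Module.rank ℚ (SingularHomology ℚ i (UnordConfigSpace M k)) =
      Module.rank ℚ (SingularHomology ℚ i (UnordConfigSpace M l)) := by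
  obtain ⟨x0⟩ : Nonempty M := inferInstance
  let _ : Inhabited M := ⟨x0⟩
  obtain ⟨N, hN⟩ := KEY_all d I M i
  have hle : ∀ m, N ≤ m → Module.rank ℚ (SingularHomology ℚ i (UnordConfigSpace M (m+1))) ≤
      Module.rank ℚ (SingularHomology ℚ i (UnordConfigSpace M m)) := fun m hm =>
    rank_le_of TF (fun n x hx => TF_DT hx) TF_bt i
      (fun z hz hbz w hw hzw => TF_inj (hN m hm) z hz hbz w hw hzw)
  let a : ℕ → Cardinal := fun j => Module.rank ℚ (SingularHomology ℚ i (UnordConfigSpace M (N + j)))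
  have ha : Antitone a := antitone_nat_of_succ_le (fun j => hle (N + j) (Nat.le_add_right _ _))
  obtain ⟨n, hn⟩ := WellFoundedLT.antitone_chain_condition ha
  have hc : ∀ k, N + n ≤ k → Module.rank ℚ (SingularHomology ℚ i (UnordConfigSpace M k)) = a n := by
    intro k hk
    have := hn (k - N) (by lia)
    have e : N + (k - N) = k := by lia
    change a n = Module.rank ℚ (SingularHomology ℚ i (UnordConfigSpace M (N + (k - N)))) at this
    rw [e] at this
    exact this.symm
  exact ⟨N + n, fun k l hk hl => (hc k hk).trans (hc l hl).symm⟩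
end
end CFS

/-- **Homological stability (McDuff, Segal, Church).** Let `M` be a connected manifold of
finite type (all rational Betti numbers finite). For each fixed degree `i`, the dimension
over `ℚ` of `H_i(C_k(M); ℚ)` is eventually constant in the number of points `k`. -/
theorem homology_of_configuration_spaces_eventually_constant
    (d : ℕ) {H' : Type} [TopologicalSpace H']
    (I : ModelWithCorners ℝ (EuclideanSpace ℝ (Fin d)) H')
    (M : Type) [TopologicalSpace M] [ChartedSpace H' M]
    [T2Space M] [SecondCountableTopology M] [ConnectedSpace M]
    (hfin : ∀ i : ℕ, Module.Finite ℚ (SingularHomology ℚ i M))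
    (i : ℕ) :
    ∃ N : ℕ, ∀ k l : ℕ, N ≤ k → N ≤ l →
      Module.rank ℚ (SingularHomology ℚ i (UnordConfigSpace M k)) =
      Module.rank ℚ (SingularHomology ℚ i (UnordConfigSpace M l)) := by
  exact CFS.main d I M i
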